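/- Fix an integer n > 2. There exists a constant c = c(n) such that the following holds for all f, H, d. Let f ∈ ℤ[x_1,…,x_n] be irreducible in ℚ[x_1,…,x_n], primitive (the gcd of its coefficients is 1) and of degree d ≥ 1, and suppose that the degree-d homogeneous part f_d of f is absolutely irreducible (i.e., irreducible in ℂ[x_1,…,x_n]). Then for every real H ≥ 1 there is a polynomial g ∈ ℤ[x_1,…,x_n] of degree at most c·d^{4−1/n}·H^{1/d^{1/(n−1)}}, not divisible by f, which vanishes at every point x ∈ ℤ^n satisfying f(x) = 0 and |x_i| ≤ H for all i = 1,…,n. -/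

import Mathlib

section

open MvPolynomial

namespace AuxPoly

/-! ## Part 1: vanishing along a derivation and a Bezout bound -/

section Van
variable {k A : Type*} [Field k] [CommRing A] [Algebra k A]

/-- order of vanishing at least `K` along the derivation `D` at the point `φ`. -/
def Van (D : Derivation k A A) (φ : A →ₐ[k] k) (K : ℕ) (G : A) : Prop :=
  ∀ j < K, φ (D^[j] G) = 0

variable {D : Derivation k A A} {φ : A →ₐ[k] k}

theorem van_zero (G : A) : Van D φ 0 G := fun j hj => absurd hj (Nat.not_lt_zero j)

theorem van_succ {K : ℕ} {G : A} : Van D φ (K + 1) G ↔ φ G = 0 ∧ Van D φ K (D G) := by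
  constructor
  · intro h
    refine ⟨by simpa using h 0 (Nat.succ_pos K), fun j hj => ?_⟩
    have := h (j + 1) (by omega)
    simpa [Function.iterate_succ_apply] using this
  · rintro ⟨h0, h1⟩ j hj
    cases j with
    | zero => simpa using h0
    | succ j => 
      have := h1 j (by omega)
      simpa [Function.iterate_succ_apply] using this

theorem van_mono {K L : ℕ} {G : A} (h : Van D φ K G) (hL : L ≤ K) : Van D φ L G :=
  fun j hj => h j (by omega)

theorem iter_add (j : ℕ) (a b : A) : D^[j] (a + b) = D^[j] a + D^[j] b := by
  induction j generalizing a b with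
  | zero => simp
  | succ j ih => simp [Function.iterate_succ_apply, ih]

theorem iter_smul (j : ℕ) (c : k) (a : A) : D^[j] (c • a) = c • D^[j] a := by
  induction j generalizing a with
  | zero => simp
  | succ j ih => simp [Function.iterate_succ_apply, ih]

theorem van_add {K : ℕ} {a b : A} (ha : Van D φ K a) (hb : Van D φ K b) : Van D φ K (a + b) := by
  intro j hj
  rw [iter_add, map_add, ha j hj, hb j hj, add_zero]

theorem van_smul {K : ℕ} (c : k) {a : A} (ha : Van D φ K a) : Van D φ K (c • a) := by
  intro j hj
  rw [iter_smul, map_smul, ha j hj, smul_zero]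

theorem van_mul {K : ℕ} {G : A} (u : A) (h : Van D φ K G) : Van D φ K (u * G) := by
  induction K generalizing u G with
  | zero => exact van_zero _
  | succ K ih =>
    rw [van_succ] at h ⊢
    refine ⟨by rw [map_mul, h.1, mul_zero], ?_⟩
    rw [D.leibniz]
    have hG : Van D φ K G := van_mono (van_succ.2 h) (Nat.le_succ K)
    simp only [smul_eq_mul]
    rw [mul_comm G]
    exact van_add (ih u h.2) (ih (D u) hG)

theorem van_mul_vanish {K : ℕ} {G L : A} (hL : φ L = 0) (h : Van D φ K G) :
    Van D φ (K + 1) (L * G) := by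
  induction K generalizing G with
  | zero => rw [van_succ]; exact ⟨by simp [hL], van_zero _⟩
  | succ K ih =>
    rw [van_succ]
    refine ⟨by simp [hL], ?_⟩
    rw [D.leibniz]
    simp only [smul_eq_mul]
    rw [mul_comm G]
    exact van_add (ih (van_succ.1 h).2) (van_mul _ h)

theorem van_iter_mul {K : ℕ} {G : A} (u : A) (h : Van D φ K G) :
    φ (D^[K] (u * G)) = φ u * φ (D^[K] G) := by
  induction K generalizing u G with
  | zero => simp
  | succ K ih =>
    rw [Function.iterate_succ_apply, D.leibniz, iter_add, map_add]
    simp only [smul_eq_mul]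
    have h2 : Van D φ (K + 1) (G * D u) := by rw [mul_comm]; exact van_mul _ h
    rw [h2 K (Nat.lt_succ_self K), add_zero, ih u (van_succ.1 h).2, ← Function.iterate_succ_apply]

theorem van_iter_mul_vanish {K : ℕ} {G L : A} (hL : φ L = 0) (h : Van D φ K G) :
    φ (D^[K + 1] (L * G)) = (K + 1 : k) * φ (D L) * φ (D^[K] G) := by
  induction K generalizing G with
  | zero => simp [D.leibniz, hL, mul_comm]
  | succ K ih =>
    rw [Function.iterate_succ_apply, D.leibniz, iter_add, map_add]
    simp only [smul_eq_mul]
    rw [ih (van_succ.1 h).2, mul_comm G, van_iter_mul _ h, ← Function.iterate_succ_apply]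
    push_cast
    ring

theorem van_pow {L : A} (hL : φ L = 0) (u : A) (K : ℕ) :
    Van D φ K (L ^ K * u) := by
  induction K with
  | zero => exact van_zero _
  | succ K ih => rw [pow_succ', mul_assoc]; exact van_mul_vanish hL ih

theorem van_iter_pow {L : A} (hL : φ L = 0) (u : A) (K : ℕ) :
    φ (D^[K] (L ^ K * u)) = (K.factorial : k) * φ (D L) ^ K * φ u := by
  induction K with
  | zero => simp
  | succ K ih =>
    rw [pow_succ', mul_assoc, van_iter_mul_vanish hL (van_pow hL u K), ih, Nat.factorial_succ]
    push_cast
    ring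

theorem van_prod {ι : Type*} (s : Finset ι) (Lf : ι → A) {K : ℕ} (i : ι) (hi : i ∈ s)
    (h : φ (Lf i) = 0) (u : A) : Van D φ K (u * ∏ i ∈ s, Lf i ^ K) := by
  classical
  rw [← Finset.mul_prod_erase s _ hi]
  have : u * (Lf i ^ K * ∏ x ∈ s.erase i, Lf x ^ K) =
    Lf i ^ K * (u * ∏ x ∈ s.erase i, Lf x ^ K) := by ring
  rw [this]
  exact van_pow h _ _

end Van

section Dim
variable (k : Type*) [Field k]

noncomputable abbrev PT (T : ℕ) : Submodule k (MvPolynomial (Fin 2) k) := restrictTotalDegree (Fin 2) k T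

theorem card_deg_le (T : ℕ) :
    Nat.card {n : Fin 2 →₀ ℕ | (n.sum fun _ e => e) ≤ T} = (T + 2).choose 2 := by
  have e : {n : Fin 2 →₀ ℕ | (n.sum fun _ e => e) ≤ T} ≃
      (Finset.range (T + 1)).sigma (fun m => Finset.HasAntidiagonal.antidiagonal m) := by
    refine ⟨fun n => ⟨⟨n.1 0 + n.1 1, (n.1 0, n.1 1)⟩, ?_⟩,
      fun p => ⟨Finsupp.equivFunOnFinite.symm ![p.1.2.1, p.1.2.2], ?_⟩, ?_, ?_⟩
    · have := n.2
      simp [Finsupp.sum_fintype] at this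
      simp; omega
    · have := Finset.mem_sigma.1 p.2
      have h2 := Finset.HasAntidiagonal.mem_antidiagonal.1 this.2
      have h1 := Finset.mem_range.1 this.1
      simp [Finsupp.sum_fintype]; omega
    · intro n
      apply Subtype.ext
      ext i
      fin_cases i <;> simp
    · intro p
      obtain ⟨⟨m, a, b⟩, hp⟩ := p
      simp [Finset.mem_sigma] at hp
      obtain ⟨h1, rfl⟩ := hp
      simp
  rw [Nat.card_congr e, Nat.card_eq_fintype_card, Fintype.card_coe, Finset.card_sigma]
  simp only [Finset.Nat.card_antidiagonal]
  clear e
  induction T with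
  | zero => rfl
  | succ T ih =>
    rw [Finset.sum_range_succ, ih]
    have := Nat.choose_succ_succ' (T + 2) 1
    rw [Nat.choose_one_right] at this
    have e : (T + 1 + 2).choose 2 = (T + 2 + 1).choose (1 + 1) := rfl
    have e' : (T + 2).choose 2 = (T + 2).choose (1 + 1) := rfl
    rw [e, e']
    omega

instance finDegLe (T : ℕ) : Finite {n : Fin 2 →₀ ℕ | (n.sum fun _ e => e) ≤ T} := by
  apply Nat.finite_of_card_ne_zero
  rw [card_deg_le]
  exact (Nat.choose_pos (by omega)).ne'

theorem finrank_PT (T : ℕ) : Module.finrank k (PT k T) = (T + 2).choose 2 := by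
  rw [← card_deg_le]
  exact Module.finrank_eq_nat_card_basis (basisRestrictSupport k _)

instance finitePT (T : ℕ) : Module.Finite k (PT k T) :=
  Module.Finite.of_basis (basisRestrictSupport k _)

end Dim

section BZ
variable {k : Type*} [Field k]

/-- The tangential derivation of the curve `h = 0`. -/
noncomputable def Dh (h : MvPolynomial (Fin 2) k) :
    Derivation k (MvPolynomial (Fin 2) k) (MvPolynomial (Fin 2) k) :=
  pderiv 0 h • pderiv 1 - pderiv 1 h • pderiv 0

theorem Dh_apply (h G : MvPolynomial (Fin 2) k) :
    Dh h G = pderiv 0 h * pderiv 1 G - pderiv 1 h * pderiv 0 G := by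
  simp [Dh]

theorem Dh_self (h : MvPolynomial (Fin 2) k) : Dh h h = 0 := by
  rw [Dh_apply]; ring

theorem Dh_X1 (h : MvPolynomial (Fin 2) k) : Dh h (X 1) = pderiv 0 h := by
  rw [Dh_apply]; simp [pderiv_X]

noncomputable abbrev ev (P : Fin 2 → k) : MvPolynomial (Fin 2) k →ₐ[k] k := aeval P

theorem van_self (h : MvPolynomial (Fin 2) k) (P : Fin 2 → k) (hP : eval P h = 0) (K : ℕ) :
    Van (Dh h) (ev P) K h := by
  intro j hj
  cases j with
  | zero => simpa [MvPolynomial.aeval_eq_eval] using hP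
  | succ j =>
    rw [Function.iterate_succ_apply, Dh_self]
    have : ∀ j, (Dh h)^[j] 0 = 0 := by
      intro j
      induction j with
      | zero => rfl
      | succ j ih => simp [Function.iterate_succ_apply, ih]
    rw [this]; simp

/-- the functionals `G ↦ (D^j G)(P)` -/
noncomputable def ell (h : MvPolynomial (Fin 2) k) (T : ℕ) (P : Fin 2 → k) (j : ℕ) :
    Module.Dual k (PT k T) :=
  ((ev P).toLinearMap ∘ₗ ((Dh h : MvPolynomial (Fin 2) k →ₗ[k] MvPolynomial (Fin 2) k) ^ j)) ∘ₗ
    (PT k T).subtype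

theorem ell_apply (h : MvPolynomial (Fin 2) k) (T : ℕ) (P : Fin 2 → k) (j : ℕ) (G : PT k T) :
    ell h T P j G = ev P ((Dh h)^[j] (G : MvPolynomial (Fin 2) k)) := by
  simp [ell, Module.End.pow_apply]

theorem totalDegree_X_sub_C_le (i : Fin 2) (c : k) :
    (X i - C c : MvPolynomial (Fin 2) k).totalDegree ≤ 1 := by
  refine (totalDegree_sub _ _).trans ?_
  simp

theorem ell_indep (h : MvPolynomial (Fin 2) k) (T : ℕ) (S : Finset (Fin 2 → k)) (K : ℕ)
    (hT : K * S.card ≤ T)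
    (hns : ∀ P ∈ S, ∀ j < K, (j.factorial : k) * (eval P (pderiv 0 h)) ^ j ≠ 0) :
    LinearIndependent k (fun i : S × Fin K => ell h T i.1.1 i.2) := by
  classical
  rw [Fintype.linearIndependent_iff]
  intro g hg
  by_contra hne
  push Not at hne
  obtain ⟨⟨P0, j0⟩, hmem, hmax⟩ := Finset.exists_max_image
    (Finset.univ.filter (fun i : S × Fin K => g i ≠ 0)) (fun i => i.2)
    (by obtain ⟨i, hi⟩ := hne; exact ⟨i, by simpa using hi⟩)
  have hsep : ∀ P : Fin 2 → k, ∃ L : MvPolynomial (Fin 2) k, L.totalDegree ≤ 1 ∧ eval P L = 0 ∧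
      (P ≠ P0.1 → eval P0.1 L ≠ 0) := by
    intro P
    by_cases hP : P = P0.1
    · exact ⟨0, by simp, by simp, fun h => absurd hP h⟩
    · obtain ⟨i, hi⟩ := Function.ne_iff.1 hP
      refine ⟨X i - C (P i), totalDegree_X_sub_C_le _ _, by simp, fun _ => ?_⟩
      simpa [sub_eq_zero] using fun h => hi h.symm
  choose Lf hL1 hL2 hL3 using hsep
  set u : MvPolynomial (Fin 2) k := ∏ P ∈ S.erase P0.1, Lf P ^ K with hu
  set G : MvPolynomial (Fin 2) k := (X 1 - C (P0.1 1)) ^ (j0 : ℕ) * u with hG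
  have hudeg : u.totalDegree ≤ K * (S.card - 1) := by
    refine (totalDegree_finsetProd _ _).trans ?_
    rw [← Finset.card_erase_of_mem P0.2, mul_comm]
    refine Finset.sum_le_card_nsmul _ _ _ (fun P _ => ?_)
    refine (totalDegree_pow _ _).trans ?_
    nlinarith [hL1 P]
  have hcard : 1 ≤ S.card := Finset.card_pos.2 ⟨_, P0.2⟩
  have hGdeg : G ∈ PT k T := by
    rw [mem_restrictTotalDegree]
    refine (totalDegree_mul _ _).trans ?_
    have h1 : ((X 1 - C (P0.1 1)) ^ (j0 : ℕ) : MvPolynomial (Fin 2) k).totalDegree ≤ K := by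
      refine (totalDegree_pow _ _).trans ?_
      have := totalDegree_X_sub_C_le (1 : Fin 2) (P0.1 1)
      nlinarith [j0.2]
    have h2 : K + K * (S.card - 1) = K * S.card := by
      obtain ⟨m, hm⟩ := Nat.exists_eq_add_of_le hcard
      rw [hm]; simp; ring
    omega
  have key := congrArg (fun l : Module.Dual k (PT k T) => l ⟨G, hGdeg⟩) hg
  simp only [LinearMap.sum_apply, LinearMap.smul_apply, ell_apply, LinearMap.zero_apply] at key
  rw [Finset.sum_eq_single (P0, j0)] at key
  · have hX : ev P0.1 (X 1 - C (P0.1 1)) = 0 := by simp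
    rw [hG, van_iter_pow hX] at key
    have h1 : ev P0.1 u ≠ 0 := by
      rw [hu, map_prod, Finset.prod_ne_zero_iff]
      intro P hP
      rw [map_pow]
      apply pow_ne_zero
      have := hL3 P (Finset.ne_of_mem_erase hP)
      simpa [MvPolynomial.aeval_eq_eval] using this
    have h2 := hns P0.1 P0.2 j0 j0.2
    have h3 : ev P0.1 ((Dh h) (X 1 - C (P0.1 1))) = eval P0.1 (pderiv 0 h) := by
      rw [map_sub, Dh_X1]
      have : Dh h (C (P0.1 1)) = 0 := by
        rw [← MvPolynomial.algebraMap_eq]; exact Derivation.map_algebraMap _ _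
      rw [this]; simp [MvPolynomial.aeval_eq_eval]
    rw [h3] at key
    have h4 : g (P0, j0) ≠ 0 := by simpa using hmem
    exact (mul_ne_zero h4 (mul_ne_zero h2 h1)) key
  · rintro ⟨P, j⟩ - hne'
    by_cases hPP : P = P0
    · subst hPP
      have hjne : j ≠ j0 := fun h => hne' (by rw [h])
      rcases lt_or_gt_of_ne hjne with hlt | hgt
      · have hX : ev P.1 (X 1 - C (P.1 1)) = 0 := by simp
        have := van_pow (D := Dh h) hX u j0 j hlt
        simp only [hG]
        rw [this]; simp
      · have : g (P, j) = 0 := by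
          by_contra hg0
          have := hmax (P, j) (by simpa using hg0)
          exact absurd this (not_le.2 hgt)
        simp [this]
    · have hm : P.1 ∈ S.erase P0.1 :=
        Finset.mem_erase.2 ⟨fun h => hPP (Subtype.ext h), P.2⟩
      have := van_prod (D := Dh h) (φ := ev P.1) (S.erase P0.1) Lf (K := K) P.1 hm
        (by simpa [MvPolynomial.aeval_eq_eval] using hL2 P.1) ((X 1 - C (P0.1 1)) ^ (j0 : ℕ)) j j.2
      simp only [hG, hu]
      rw [this]; simp
  · simp

theorem bezout_bound (h Ψ : MvPolynomial (Fin 2) k) (hp : Prime h) (hnd : ¬ h ∣ Ψ) (d E : ℕ)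
    (hd : h.totalDegree = d) (hE : Ψ.totalDegree ≤ E) (S : Finset (Fin 2 → k))
    (hS : ∀ P ∈ S, eval P h = 0) (K : ℕ) (hV : ∀ P ∈ S, Van (Dh h) (ev P) K Ψ)
    (hns : ∀ P ∈ S, ∀ j < K, (j.factorial : k) * (eval P (pderiv 0 h)) ^ j ≠ 0) :
    K * S.card ≤ d * E := by
  classical
  set T := K * S.card + d + E with hT
  have hmem : ∀ ab : PT k (T - d) × PT k (T - E),
      h * (ab.1 : MvPolynomial (Fin 2) k) + Ψ * ab.2 ∈ PT k T := by
    intro ab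
    rw [mem_restrictTotalDegree]
    refine (totalDegree_add _ _).trans (max_le ?_ ?_)
    · refine (totalDegree_mul _ _).trans ?_
      have := (mem_restrictTotalDegree _ _ _).1 ab.1.2
      omega
    · refine (totalDegree_mul _ _).trans ?_
      have := (mem_restrictTotalDegree _ _ _).1 ab.2.2
      omega
  let m : (PT k (T - d) × PT k (T - E)) →ₗ[k] PT k T :=
    { toFun := fun ab => ⟨_, hmem ab⟩
      map_add' := by intro a b; apply Subtype.ext; simp; ring
      map_smul' := by intro c a; apply Subtype.ext; simp }
  have hmem2 : ∀ c : PT k (T - d - E),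
      (-(Ψ * (c : MvPolynomial (Fin 2) k)) ∈ PT k (T - d)) ∧ (h * c : MvPolynomial (Fin 2) k) ∈ PT k (T - E) := by
    intro c
    have := (mem_restrictTotalDegree _ _ _).1 c.2
    constructor
    · apply Submodule.neg_mem
      rw [mem_restrictTotalDegree]
      refine (totalDegree_mul _ _).trans ?_
      omega
    · rw [mem_restrictTotalDegree]
      refine (totalDegree_mul _ _).trans ?_
      omega
  let q : PT k (T - d - E) →ₗ[k] (PT k (T - d) × PT k (T - E)) :=
    { toFun := fun c => (⟨_, (hmem2 c).1⟩, ⟨_, (hmem2 c).2⟩)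
      map_add' := by
        intro a b; apply Prod.ext <;> apply Subtype.ext <;> simp <;> ring
      map_smul' := by intro c a; apply Prod.ext <;> apply Subtype.ext <;> simp }
  have hker : LinearMap.ker m ≤ LinearMap.range q := by
    rintro ⟨a, b⟩ hab
    have hab' : h * (a : MvPolynomial (Fin 2) k) + Ψ * b = 0 := congrArg Subtype.val hab
    have hdv : h ∣ Ψ * (b : MvPolynomial (Fin 2) k) :=
      ⟨-a, by linear_combination hab'⟩
    obtain ⟨c, hc⟩ := (hp.dvd_or_dvd hdv).resolve_left hnd
    have hc' : c.totalDegree ≤ T - d - E := by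
      by_cases hc0 : c = 0
      · simp [hc0]
      · have := totalDegree_mul_of_isDomain hp.ne_zero hc0
        have h2 := (mem_restrictTotalDegree _ _ _).1 b.2
        rw [hc] at h2
        omega
    refine ⟨⟨c, (mem_restrictTotalDegree _ _ _).2 hc'⟩, ?_⟩
    have ha : (a : MvPolynomial (Fin 2) k) = -(Ψ * c) := by
      apply mul_left_cancel₀ hp.ne_zero
      rw [hc] at hab'
      linear_combination hab'
    apply Prod.ext <;> apply Subtype.ext
    · exact ha.symm
    · exact hc.symm
  have hW : Module.finrank k (LinearMap.range m) + Module.finrank k (LinearMap.ker m) =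
      (T - d + 2).choose 2 + (T - E + 2).choose 2 := by
    rw [LinearMap.finrank_range_add_finrank_ker, Module.finrank_prod, finrank_PT, finrank_PT]
  have hk2 : Module.finrank k (LinearMap.ker m) ≤ (T - d - E + 2).choose 2 := by
    refine (Submodule.finrank_mono hker).trans ?_
    rw [← finrank_PT k]
    exact LinearMap.finrank_range_le q
  have hli := ell_indep h T S K (by omega) hns
  have hann : ∀ i : S × Fin K, ell h T i.1.1 i.2 ∈ (LinearMap.range m).dualAnnihilator := by
    rintro ⟨P, j⟩
    rw [Submodule.mem_dualAnnihilator]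
    rintro _ ⟨ab, rfl⟩
    rw [ell_apply]
    have : Van (Dh h) (ev P.1) K (h * (ab.1 : MvPolynomial (Fin 2) k) + Ψ * ab.2) := by
      apply van_add
      · rw [mul_comm]; exact van_mul _ (van_self h P.1 (hS P.1 P.2) K)
      · rw [mul_comm]; exact van_mul _ (hV P.1 P.2)
    exact this j j.2
  have hcard : K * S.card ≤ Module.finrank k (LinearMap.range m).dualAnnihilator := by
    have h1 := finrank_span_eq_card hli
    have h2 : Submodule.span k (Set.range (fun i : S × Fin K => ell h T i.1.1 i.2)) ≤
        (LinearMap.range m).dualAnnihilator := by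
      rw [Submodule.span_le]; rintro _ ⟨i, rfl⟩; exact hann i
    have h3 := Submodule.finrank_mono h2
    rw [h1] at h3
    simpa [mul_comm] using h3
  have hdual := Subspace.finrank_add_finrank_dualAnnihilator_eq (LinearMap.range m)
  rw [finrank_PT] at hdual
  have hc : ∀ x : ℕ, 2 * (x + 2).choose 2 = (x + 2) * (x + 1) := by
    intro x
    rw [Nat.choose_two_right, Nat.mul_div_cancel']
    · simp
    · have := Nat.even_mul_pred_self (x + 2)
      exact this.two_dvd
  have e1 : T - d = K * S.card + E := by omega
  have e2 : T - E = K * S.card + d := by omega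
  have e3 : T - d - E = K * S.card := by omega
  generalize Module.finrank k (LinearMap.range m) = r1 at *
  generalize Module.finrank k (LinearMap.ker m) = r2 at *
  generalize Module.finrank k (LinearMap.range m).dualAnnihilator = r3 at *
  clear hann hli hker
  rw [e3] at hk2
  rw [e1, e2] at hW
  have c1 := hc T
  have c2 := hc (K * S.card + E)
  have c3 := hc (K * S.card + d)
  have c4 := hc (K * S.card)
  rw [hT] at c1 hdual
  clear_value T
  generalize K * S.card = N at *
  nlinarith

end BZ

end AuxPoly

end

section

open MvPolynomial

namespace AuxPoly

/-! ## Part 2: generalities on degrees -/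

section General

theorem fin2_sum (m : Fin 2 →₀ ℕ) : (m.sum fun _ e => e) = m 0 + m 1 := by
  simp [Finsupp.sum_fintype]

theorem fsum_fintype {n : ℕ} (m : Fin n →₀ ℕ) : (m.sum fun _ e => e) = ∑ i, m i := by
  simp [Finsupp.sum_fintype]

variable {R : Type*} [CommRing R]

theorem totalDegree_pderiv_le {n : ℕ} (i : Fin n) (G : MvPolynomial (Fin n) R) :
    (pderiv i G).totalDegree ≤ G.totalDegree - 1 := by
  rw [totalDegree]
  apply Finset.sup_le
  intro m hm
  have h1 : coeff (m + Finsupp.single i 1) G ≠ 0 := by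
    intro h
    rw [mem_support_iff, coeff_pderiv, h, zero_mul] at hm
    exact hm rfl
  have h2 := le_totalDegree (mem_support_iff.2 h1)
  rw [Finsupp.sum_add_index' (by simp) (by simp), Finsupp.sum_single_index rfl] at h2
  omega

/-- total degree at most `d` and nonzero coefficient of `X₀ ^ d`. -/
def Reg {n : ℕ} (d : ℕ) (h : MvPolynomial (Fin (n + 1)) R) : Prop :=
  h.totalDegree ≤ d ∧ h.coeff (Finsupp.single 0 d) ≠ 0

theorem Reg.ne_zero {n d : ℕ} {h : MvPolynomial (Fin (n + 1)) R} (H : Reg d h) : h ≠ 0 := by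
  rintro rfl
  exact H.2 (by simp)

theorem Reg.degreeOf {n d : ℕ} {h : MvPolynomial (Fin (n + 1)) R} (H : Reg d h) :
    h.degreeOf 0 = d := by
  apply le_antisymm ((degreeOf_le_totalDegree _ _).trans H.1)
  have := monomial_le_degreeOf 0 (mem_support_iff.2 H.2)
  simpa using this

theorem Reg.totalDegree {n d : ℕ} {h : MvPolynomial (Fin (n + 1)) R} (H : Reg d h) :
    h.totalDegree = d := by
  apply le_antisymm H.1
  rw [← H.degreeOf]
  exact degreeOf_le_totalDegree _ _

theorem reg_of_degreeOf {n : ℕ} {h : MvPolynomial (Fin (n + 1)) R} (h0 : h ≠ 0)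
    (H : h.degreeOf 0 = h.totalDegree) : Reg h.totalDegree h := by
  refine ⟨le_rfl, ?_⟩
  have hne : h.support.Nonempty := by simpa using h0
  obtain ⟨m, hm, hm2⟩ := Finset.exists_mem_eq_sup _ hne (fun s => s 0)
  rw [← degreeOf_eq_sup, H] at hm2
  have h1 := le_totalDegree hm
  rw [fsum_fintype, Fin.sum_univ_succ] at h1
  have h3 : ∀ i : Fin n, m i.succ = 0 := by
    have : ∑ i : Fin n, m i.succ = 0 := by omega
    simpa using this
  have : m = Finsupp.single 0 h.totalDegree := by
    ext i
    refine Fin.cases ?_ (fun i => ?_) i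
    · simp [hm2]
    · simp [h3]
  rw [← this]
  exact mem_support_iff.1 hm

theorem reg_of_mul {n d : ℕ} [IsDomain R] {a b : MvPolynomial (Fin (n + 1)) R}
    (H : Reg d (a * b)) : Reg a.totalDegree a := by
  have h0 := H.ne_zero
  have ha : a ≠ 0 := left_ne_zero_of_mul h0
  have hb : b ≠ 0 := right_ne_zero_of_mul h0
  apply reg_of_degreeOf ha
  have h1 := H.degreeOf
  have h2 := H.totalDegree
  rw [degreeOf_mul_eq ha hb] at h1
  rw [totalDegree_mul_of_isDomain ha hb] at h2
  have h3 := degreeOf_le_totalDegree a 0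
  have h4 := degreeOf_le_totalDegree b 0
  omega

theorem coeff_finSucc_top {n d : ℕ} {h : MvPolynomial (Fin (n + 1)) R} (H : h.totalDegree ≤ d) :
    (finSuccEquiv R n h).coeff d = C (h.coeff (Finsupp.single 0 d)) := by
  ext m
  rw [finSuccEquiv_coeff_coeff, coeff_C]
  split_ifs with hm
  · subst hm
    congr 1
    ext i
    refine Fin.cases ?_ (fun i => ?_) i
    · simp
    · simp
  · by_contra hc
    have h1 := le_totalDegree (mem_support_iff.2 hc)
    rw [fsum_fintype, Fin.sum_univ_succ] at h1
    simp only [Finsupp.cons_zero, Finsupp.cons_succ] at h1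
    have : ∑ i : Fin n, m i = 0 := by omega
    apply hm
    ext i
    simp at this
    simp [this]

theorem natDegree_finSucc_le {n d : ℕ} {h : MvPolynomial (Fin (n + 1)) R} (H : h.totalDegree ≤ d) :
    (finSuccEquiv R n h).natDegree ≤ d := by
  rw [natDegree_finSuccEquiv]
  exact (degreeOf_le_totalDegree _ _).trans H

/-- The section `h(X, y)` as a univariate polynomial. -/
noncomputable def sec {n : ℕ} (h : MvPolynomial (Fin (n + 1)) R) (y : Fin n → R) : Polynomial R :=
  (finSuccEquiv R n h).map (eval y)

theorem sec_eval {n : ℕ} (h : MvPolynomial (Fin (n + 1)) R) (y : Fin n → R) (x : R) :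
    (sec h y).eval x = eval (Fin.cons x y : Fin (n + 1) → R) h := by
  rw [sec, eval_eq_eval_mv_eval']

theorem sec_natDegree_le {n d : ℕ} {h : MvPolynomial (Fin (n + 1)) R} (H : h.totalDegree ≤ d)
    (y : Fin n → R) : (sec h y).natDegree ≤ d :=
  (Polynomial.natDegree_map_le).trans (natDegree_finSucc_le H)

theorem sec_coeff_top {n d : ℕ} {h : MvPolynomial (Fin (n + 1)) R} (H : h.totalDegree ≤ d)
    (y : Fin n → R) : (sec h y).coeff d = h.coeff (Finsupp.single 0 d) := by
  rw [sec, Polynomial.coeff_map, coeff_finSucc_top H, eval_C]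

theorem Reg.sec_ne_zero {n d : ℕ} {h : MvPolynomial (Fin (n + 1)) R} (H : Reg d h)
    (y : Fin n → R) : sec h y ≠ 0 := by
  intro h0
  have := sec_coeff_top H.1 y
  rw [h0, Polynomial.coeff_zero] at this
  exact H.2 this.symm

theorem Reg.sec_natDegree {n d : ℕ} {h : MvPolynomial (Fin (n + 1)) R} (H : Reg d h)
    (y : Fin n → R) : (sec h y).natDegree = d := by
  apply le_antisymm (sec_natDegree_le H.1 y)
  apply Polynomial.le_natDegree_of_ne_zero
  rw [sec_coeff_top H.1]
  exact H.2

theorem sec_mul {n : ℕ} (a b : MvPolynomial (Fin (n + 1)) R) (y : Fin n → R) :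
    sec (a * b) y = sec a y * sec b y := by simp [sec]

theorem sec_derivative {n : ℕ} (h : MvPolynomial (Fin (n + 1)) R) (y : Fin n → R) :
    sec (pderiv 0 h) y = Polynomial.derivative (sec h y) := by
  rw [sec, sec, Polynomial.derivative_map]
  congr 1
  ext i m
  rw [Polynomial.coeff_derivative, finSuccEquiv_coeff_coeff, coeff_pderiv]
  have h1 : (Finsupp.cons i m + Finsupp.single 0 1 : Fin (n + 1) →₀ ℕ) = Finsupp.cons (i + 1) m := by
    ext j
    refine Fin.cases ?_ (fun j => ?_) j
    · simp
    · simp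
  rw [h1]
  have h2 : (i + 1 : MvPolynomial (Fin n) R) = C (i + 1 : R) := by simp
  rw [h2, mul_comm _ (C _), coeff_C_mul, finSuccEquiv_coeff_coeff, mul_comm]
  simp

end General

section NotDvd
variable {k : Type*} [Field k]

theorem Reg.not_dvd {d : ℕ} {h G : MvPolynomial (Fin 2) k} (H : Reg d h) (hG : G ≠ 0)
    (hlt : G.degreeOf 0 < d) : ¬ h ∣ G := by
  rintro ⟨c, rfl⟩
  have hc : c ≠ 0 := right_ne_zero_of_mul hG
  rw [degreeOf_mul_eq H.ne_zero hc, H.degreeOf] at hlt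
  omega

theorem Reg.pderiv_ne {n d : ℕ} {h : MvPolynomial (Fin (n + 1)) k} (H : Reg d h) (hd : 1 ≤ d)
    (hchar : (d : k) ≠ 0) : pderiv 0 h ≠ 0 := by
  intro h0
  have h1 := coeff_pderiv (i := (0 : Fin (n + 1))) h (Finsupp.single 0 (d - 1))
  rw [h0, ← Finsupp.single_add, Nat.sub_add_cancel hd] at h1
  simp only [coeff_zero, Finsupp.single_eq_same] at h1
  have h2 : ((d - 1 : ℕ) : k) + 1 = d := by
    have : ((d - 1 + 1 : ℕ) : k) = d := by rw [Nat.sub_add_cancel hd]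
    simpa using this
  rw [h2] at h1
  exact mul_ne_zero H.2 hchar h1.symm

theorem degreeOf_pderiv_lt {n d : ℕ} {h : MvPolynomial (Fin (n + 1)) k} (H : h.totalDegree ≤ d)
    (hd : 1 ≤ d) (i : Fin (n + 1)) : (pderiv i h).degreeOf 0 < d := by
  have h1 := degreeOf_le_totalDegree (pderiv i h) 0
  have h2 := totalDegree_pderiv_le i h
  omega

theorem Reg.not_dvd_pderiv {d : ℕ} {h : MvPolynomial (Fin 2) k} (H : Reg d h) (hd : 1 ≤ d)
    (hchar : (d : k) ≠ 0) : ¬ h ∣ pderiv 0 h :=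
  H.not_dvd (H.pderiv_ne hd hchar) (degreeOf_pderiv_lt H.1 hd 0)

end NotDvd
end AuxPoly

end

section

open MvPolynomial

namespace AuxPoly

/-! ## Part 3: Stepanov's method -/

section MonoRing
variable {k : Type*} [CommRing k]

noncomputable def ex2 (a : ℕ × ℕ) : Fin 2 →₀ ℕ := Finsupp.single 0 a.1 + Finsupp.single 1 a.2

theorem ex2_zero (a : ℕ × ℕ) : ex2 a 0 = a.1 := by simp [ex2]
theorem ex2_one (a : ℕ × ℕ) : ex2 a 1 = a.2 := by simp [ex2]

theorem ex2_inj {a b : ℕ × ℕ} (h : ex2 a = ex2 b) : a = b := by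
  apply Prod.ext
  · rw [← ex2_zero, h, ex2_zero]
  · rw [← ex2_one, h, ex2_one]

/-- the monomial `X^i t^j` -/
noncomputable def mono (k : Type*) [CommRing k] {d A : ℕ} (a : Fin d × Fin A) :
    MvPolynomial (Fin 2) k := monomial (ex2 (a.1, a.2)) 1

theorem ex2_fin_inj {d A : ℕ} {a b : Fin d × Fin A}
    (h : ex2 ((a.1 : ℕ), (a.2 : ℕ)) = ex2 ((b.1 : ℕ), (b.2 : ℕ))) : a = b := by
  have := ex2_inj h
  simp only [Prod.mk.injEq] at this
  exact Prod.ext (Fin.ext this.1) (Fin.ext this.2)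

theorem coeff_sum_mono {d A : ℕ} (c : Fin d × Fin A → k) (a : Fin d × Fin A) :
    coeff (ex2 (a.1, a.2)) (∑ b, c b • mono k b) = c a := by
  classical
  rw [coeff_sum, Finset.sum_eq_single a]
  · simp [mono]
  · intro b _ hb
    rw [coeff_smul, mono, coeff_monomial, if_neg (fun h => hb (ex2_fin_inj h)), smul_zero]
  · simp

theorem totalDegree_mono {d A : ℕ} (a : Fin d × Fin A) : (mono k a).totalDegree ≤ d + A := by
  rw [mono]
  refine (totalDegree_monomial_le _ _).trans ?_
  change ((ex2 ((a.1 : ℕ), (a.2 : ℕ))).sum fun _ e => e) ≤ d + A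
  rw [fin2_sum, ex2_zero, ex2_one]
  have := a.1.2
  have := a.2.2
  simp only
  omega

theorem sum_mono_ne {d A : ℕ} {c : Fin d × Fin A → k} (hc : c ≠ 0) :
    ∑ b, c b • mono k b ≠ 0 := by
  obtain ⟨a, ha⟩ := Function.ne_iff.1 hc
  intro h
  have := coeff_sum_mono c a
  rw [h, coeff_zero] at this
  exact ha this.symm

theorem degreeOf_sum_mono {d A : ℕ} (hd : 1 ≤ d) (c : Fin d × Fin A → k) :
    (∑ b, c b • mono k b).degreeOf 0 < d := by
  classical
  rw [degreeOf_lt_iff (by omega)]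
  intro m hm
  rw [mem_support_iff, coeff_sum] at hm
  obtain ⟨b, _, hb⟩ := Finset.exists_ne_zero_of_sum_ne_zero hm
  rw [coeff_smul, mono, coeff_monomial] at hb
  split_ifs at hb with h
  · rw [← h, ex2_zero]; exact b.1.2
  · simp at hb

theorem totalDegree_sum_smul_le {ι : Type*} (s : Finset ι) (c : ι → k)
    (m : ι → MvPolynomial (Fin 2) k) (T : ℕ) (h : ∀ i ∈ s, (m i).totalDegree ≤ T) :
    (∑ b ∈ s, c b • m b).totalDegree ≤ T := by
  rw [← mem_restrictTotalDegree]
  exact Submodule.sum_mem _ (fun i hi => Submodule.smul_mem _ _ ((mem_restrictTotalDegree _ _ _).2 (h i hi)))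

end MonoRing

section Mono
variable {k : Type*} [Field k]

theorem Reg.not_dvd_sum_mono {d A : ℕ} {h : MvPolynomial (Fin 2) k} (H : Reg d h) (hd : 1 ≤ d)
    {c : Fin d × Fin A → k} (hc : c ≠ 0) : ¬ h ∣ ∑ b, c b • mono k b :=
  H.not_dvd (sum_mono_ne hc) (degreeOf_sum_mono hd c)

theorem totalDegree_Dh_le {d : ℕ} {h : MvPolynomial (Fin 2) k} (H : h.totalDegree ≤ d)
    (G : MvPolynomial (Fin 2) k) : (Dh h G).totalDegree ≤ G.totalDegree + d := by
  rw [Dh_apply]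
  refine (totalDegree_sub _ _).trans (max_le ?_ ?_)
  all_goals
    refine (totalDegree_mul _ _).trans ?_
    have h0 := totalDegree_pderiv_le 0 h
    have h1 := totalDegree_pderiv_le 1 h
    have h2 := totalDegree_pderiv_le 0 G
    have h3 := totalDegree_pderiv_le 1 G
    omega

theorem totalDegree_Dh_iter_le {d : ℕ} {h : MvPolynomial (Fin 2) k} (H : h.totalDegree ≤ d) (j : ℕ)
    (G : MvPolynomial (Fin 2) k) : ((Dh h)^[j] G).totalDegree ≤ G.totalDegree + j * d := by
  induction j generalizing G with
  | zero => simp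
  | succ j ih =>
    rw [Function.iterate_succ_apply]
    have := ih (Dh h G)
    have := totalDegree_Dh_le H G
    nlinarith

theorem Dh_iter_mul_pow {p : ℕ} [CharP k p] (h a b : MvPolynomial (Fin 2) k) (j : ℕ) :
    (Dh h)^[j] (a * b ^ p) = (Dh h)^[j] a * b ^ p := by
  induction j generalizing a with
  | zero => rfl
  | succ j ih =>
    rw [Function.iterate_succ_apply, Function.iterate_succ_apply, ← ih, Derivation.leibniz,
      Derivation.leibniz_pow]
    simp [mul_comm]

theorem Dh_iter_dvd (h G : MvPolynomial (Fin 2) k) (hG : h ∣ G) (j : ℕ) :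
    h ∣ (Dh h)^[j] G := by
  induction j generalizing G with
  | zero => exact hG
  | succ j ih =>
    rw [Function.iterate_succ_apply]
    apply ih
    obtain ⟨c, rfl⟩ := hG
    rw [Derivation.leibniz, Dh_self, smul_zero, add_zero, smul_eq_mul]
    exact dvd_mul_right _ _

theorem Dh_iter_sum {ι : Type*} (s : Finset ι) (h : MvPolynomial (Fin 2) k)
    (G : ι → MvPolynomial (Fin 2) k) (j : ℕ) :
    (Dh h)^[j] (∑ i ∈ s, G i) = ∑ i ∈ s, (Dh h)^[j] (G i) := by
  classical
  induction s using Finset.induction_on with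
  | empty =>
    simpa using iter_smul (D := Dh h) j (0 : k) (0 : MvPolynomial (Fin 2) k)
  | insert a s ha ih => rw [Finset.sum_insert ha, iter_add, ih, Finset.sum_insert ha]

/-- Codimension of `h * P_{T-d}` in `P_T`. -/
theorem finrank_quot {d T : ℕ} {h : MvPolynomial (Fin 2) k} (h0 : h ≠ 0) (H : h.totalDegree = d)
    (hT : d ≤ T) : ∃ (V : Submodule k (PT k T)), (∀ G ∈ V, h ∣ (G : MvPolynomial (Fin 2) k)) ∧
      Module.finrank k (PT k T ⧸ V) ≤ d * (T + 2) := by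
  have hmem : ∀ a : PT k (T - d), h * (a : MvPolynomial (Fin 2) k) ∈ PT k T := by
    intro a
    rw [mem_restrictTotalDegree]
    refine (totalDegree_mul _ _).trans ?_
    have := (mem_restrictTotalDegree _ _ _).1 a.2
    omega
  let m : PT k (T - d) →ₗ[k] PT k T :=
    { toFun := fun a => ⟨_, hmem a⟩
      map_add' := by intro a b; apply Subtype.ext; simp; ring
      map_smul' := by intro c a; apply Subtype.ext; simp }
  have hinj : Function.Injective m := by
    intro a b hab
    have : h * (a : MvPolynomial (Fin 2) k) = h * b := congrArg Subtype.val hab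
    exact Subtype.ext (mul_left_cancel₀ h0 this)
  refine ⟨LinearMap.range m, ?_, ?_⟩
  · rintro _ ⟨a, rfl⟩
    exact dvd_mul_right _ _
  · have h1 := Submodule.finrank_quotient_add_finrank (LinearMap.range m)
    rw [LinearMap.finrank_range_of_inj hinj, finrank_PT, finrank_PT] at h1
    have hc : ∀ x : ℕ, 2 * (x + 2).choose 2 = (x + 2) * (x + 1) := by
      intro x
      rw [Nat.choose_two_right, Nat.mul_div_cancel']
      · simp
      · have := Nat.even_mul_pred_self (x + 2)
        exact this.two_dvd
    have c1 := hc T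
    have c2 := hc (T - d)
    obtain ⟨e, he⟩ := Nat.exists_eq_add_of_le hT
    have he' : T - d = e := by omega
    generalize Module.finrank k (PT k T ⧸ LinearMap.range m) = r1 at *
    clear hinj
    clear m hmem
    rw [he'] at c2 h1
    subst he
    nlinarith

end Mono


section Stepanov
variable {κ : Type*} [Field κ]

theorem stepanov_coeffs {d A B K T : ℕ} {h : MvPolynomial (Fin 2) κ} (H : Reg d h)
    (hT : d + A + K * d + (d + B) ≤ T) (hcount : K * (d * (T + 2)) < (d * A) * (d * B)) :
    ∃ c : (Fin d × Fin A) × (Fin d × Fin B) → κ, c ≠ 0 ∧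
      ∀ j < K, h ∣ ∑ ab, c ab • ((Dh h)^[j] (mono κ ab.1) * mono κ ab.2) := by
  obtain ⟨V, hV1, hV2⟩ := finrank_quot H.ne_zero H.totalDegree (show d ≤ T by omega)
  have hmem : ∀ (j : Fin K) (ab : (Fin d × Fin A) × (Fin d × Fin B)),
      (Dh h)^[j] (mono κ ab.1) * mono κ ab.2 ∈ PT κ T := by
    intro j ab
    rw [mem_restrictTotalDegree]
    refine (totalDegree_mul _ _).trans ?_
    have h1 := totalDegree_Dh_iter_le H.1 j (mono κ ab.1)
    have h2 := totalDegree_mono (k := κ) ab.1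
    have h3 := totalDegree_mono (k := κ) ab.2
    have h4 : (j : ℕ) * d ≤ K * d := Nat.mul_le_mul_right _ j.2.le
    omega
  let Φ : ((Fin d × Fin A) × (Fin d × Fin B) → κ) →ₗ[κ] (Fin K → (PT κ T ⧸ V)) :=
    LinearMap.pi (fun j => V.mkQ ∘ₗ Fintype.linearCombination κ
      (fun ab => (⟨_, hmem j ab⟩ : PT κ T)))
  have hker : LinearMap.ker Φ ≠ ⊥ := by
    apply LinearMap.ker_ne_bot_of_finrank_lt
    rw [Module.finrank_pi_fintype, Module.finrank_fintype_fun_eq_card]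
    simp only [Finset.sum_const, Finset.card_univ, Fintype.card_fin, smul_eq_mul,
      Fintype.card_prod]
    exact lt_of_le_of_lt (Nat.mul_le_mul_left _ hV2) hcount
  obtain ⟨c, hc, hc0⟩ := Submodule.exists_mem_ne_zero_of_ne_bot hker
  refine ⟨c, hc0, fun j hj => ?_⟩
  have h1 : Φ c ⟨j, hj⟩ = 0 := by rw [LinearMap.mem_ker.1 hc]; rfl
  have h2 : (Fintype.linearCombination κ
      (fun ab => (⟨_, hmem ⟨j, hj⟩ ab⟩ : PT κ T))) c ∈ V := by
    rw [← Submodule.Quotient.mk_eq_zero]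
    exact h1
  have h3 := hV1 _ h2
  rw [Fintype.linearCombination_apply] at h3
  simpa using h3

/-- A regular irreducible curve over an algebraically closed field has points where a given function is nonzero. -/
theorem exists_point [IsAlgClosed κ] {d : ℕ} {h G : MvPolynomial (Fin 2) κ} (H : Reg d h)
    (hd : 1 ≤ d) (hp : Prime h) (hG : ¬ h ∣ G) : ∃ P : Fin 2 → κ, eval P h = 0 ∧ eval P G ≠ 0 := by
  classical
  by_contra hcon
  push Not at hcon
  have hroot : ∀ t : κ, ∃ x : κ, eval (Fin.cons x (fun _ => t) : Fin 2 → κ) h = 0 := by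
    intro t
    have hdeg : (sec h (fun _ : Fin 1 => t)).degree ≠ 0 := by
      rw [Polynomial.degree_eq_natDegree (H.sec_ne_zero _), H.sec_natDegree]
      exact_mod_cast (by omega : d ≠ 0)
    obtain ⟨x, hx⟩ := IsAlgClosed.exists_root _ hdeg
    exact ⟨x, by rw [← sec_eval]; exact hx⟩
  choose xf hxf using hroot
  have hinf : Infinite κ := IsAlgClosed.instInfinite
  obtain ⟨s, hs⟩ := Infinite.exists_subset_card_eq κ (d * G.totalDegree + 1)
  let S : Finset (Fin 2 → κ) := s.image (fun t => (Fin.cons (xf t) (fun _ => t) : Fin 2 → κ))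
  have hScard : S.card = d * G.totalDegree + 1 := by
    rw [← hs]
    apply Finset.card_image_of_injective
    intro a b hab
    have := congrFun hab 1
    exact this
  have hSp : ∀ P ∈ S, eval P h = 0 := by
    intro P hP
    obtain ⟨t, _, rfl⟩ := Finset.mem_image.1 hP
    exact hxf t
  have := bezout_bound h G hp hG d _ H.totalDegree le_rfl S hSp 1
    (fun P hP j hj => by
      obtain rfl : j = 0 := by omega
      have := hcon P (hSp P hP)
      simpa [MvPolynomial.aeval_eq_eval] using this)
    (fun P hP j hj => by
      obtain rfl : j = 0 := by omega
      simp)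
  omega

theorem factorial_ne {p : ℕ} [CharP κ p] (hp : p.Prime) {j : ℕ} (hj : j < p) :
    (j.factorial : κ) ≠ 0 := by
  rw [Ne, CharP.cast_eq_zero_iff κ p, hp.dvd_factorial]
  omega

theorem stepanov_nonvanish [IsAlgClosed κ] {p : ℕ} (hpp : p.Prime) [CharP κ p] {d A B : ℕ}
    {h : MvPolynomial (Fin 2) κ} (H : Reg d h) (hd : 1 ≤ d) (hdp : d < p) (hp : Prime h)
    (hA : d * (d + A) < p)
    (c : (Fin d × Fin A) × (Fin d × Fin B) → κ) (hc : c ≠ 0) :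
    ¬ h ∣ ∑ ab, c ab • (mono κ ab.1 * (mono κ ab.2) ^ p) := by
  classical
  intro hdvd
  have : Fact p.Prime := ⟨hpp⟩
  have hroot : ∀ x : κ, ∃ y : κ, y ^ p = x := fun x => IsAlgClosed.exists_pow_nat_eq x hpp.pos
  choose rt hrt using hroot
  have hchar : CharP (MvPolynomial (Fin 2) κ) p := inferInstance
  let Γ : Fin d × Fin A → MvPolynomial (Fin 2) κ := fun a => ∑ b, rt (c (a, b)) • mono κ b
  have hΓ : ∀ a, Γ a ^ p = ∑ b, c (a, b) • (mono κ b) ^ p := by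
    intro a
    rw [sum_pow_char]
    refine Finset.sum_congr rfl (fun b _ => ?_)
    rw [smul_pow, hrt]
  have hΨ : ∑ ab, c ab • (mono κ ab.1 * (mono κ ab.2) ^ p) = ∑ a, mono κ a * Γ a ^ p := by
    rw [Fintype.sum_prod_type]
    refine Finset.sum_congr rfl (fun a _ => ?_)
    rw [hΓ, Finset.mul_sum]
    refine Finset.sum_congr rfl (fun b _ => ?_)
    rw [mul_smul_comm]
  rw [hΨ] at hdvd
  obtain ⟨⟨a0, b0⟩, hab⟩ := Function.ne_iff.1 hc
  have hΓnd : ¬ h ∣ Γ a0 := by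
    apply H.not_dvd_sum_mono hd
    intro h0
    have := congrFun h0 b0
    apply hab
    rw [← hrt (c (a0, b0)), this]
    simp [hpp.ne_zero]
  have hchard : (d : κ) ≠ 0 := by
    rw [Ne, CharP.cast_eq_zero_iff κ p]
    exact Nat.not_dvd_of_pos_of_lt (by omega) hdp
  have hnd2 : ¬ h ∣ pderiv 0 h * Γ a0 := by
    intro hh
    rcases hp.dvd_or_dvd hh with h1 | h1
    · exact H.not_dvd_pderiv hd hchard h1
    · exact hΓnd h1
  obtain ⟨P, hP1, hP2⟩ := exists_point H hd hp hnd2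
  rw [map_mul] at hP2
  have hP3 := left_ne_zero_of_mul hP2
  have hP4 := right_ne_zero_of_mul hP2
  let A0 : MvPolynomial (Fin 2) κ := ∑ a, (eval P (Γ a)) ^ p • mono κ a
  have hA0 : ¬ h ∣ A0 := by
    apply H.not_dvd_sum_mono (c := fun a => (eval P (Γ a)) ^ p) hd
    intro h0
    exact pow_ne_zero p hP4 (congrFun h0 a0)
  have hbz := bezout_bound h A0 hp hA0 d (d + A) H.totalDegree
    (totalDegree_sum_smul_le _ _ _ _ (fun a _ => totalDegree_mono a)) {P}
    (by simpa using hP1) p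
    (by
      intro Q hQ j hj
      rw [Finset.mem_singleton] at hQ
      subst hQ
      have h1 : ev Q ((Dh h)^[j] (∑ a, mono κ a * Γ a ^ p)) = 0 := by
        obtain ⟨w, hw⟩ := Dh_iter_dvd h _ hdvd j
        rw [hw, map_mul]
        have : ev Q h = 0 := by simpa [MvPolynomial.aeval_eq_eval] using hP1
        rw [this, zero_mul]
      rw [Dh_iter_sum, map_sum] at h1
      simp only [A0]
      rw [Dh_iter_sum, map_sum, ← h1]
      refine Finset.sum_congr rfl (fun a _ => ?_)
      rw [iter_smul, Dh_iter_mul_pow, map_smul, map_mul, map_pow, smul_eq_mul, mul_comm]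
      simp [MvPolynomial.aeval_eq_eval])
    (by
      intro Q hQ j hj
      rw [Finset.mem_singleton] at hQ
      subst hQ
      exact mul_ne_zero (factorial_ne hpp hj) (pow_ne_zero _ hP3))
  simp at hbz
  omega

theorem stepanov_core [IsAlgClosed κ] {p : ℕ} (hpp : p.Prime) [CharP κ p] {d A B K : ℕ}
    {h : MvPolynomial (Fin 2) κ} (H : Reg d h) (hd : 1 ≤ d) (hdp : d < p) (hp : Prime h)
    (hA : d * (d + A) < p) (hK : K ≤ p)
    (hcount : K * (d * (2 * d + A + B + K * d + 2)) < (d * A) * (d * B))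
    (S : Finset (Fin 2 → κ)) (hS : ∀ P ∈ S, eval P h = 0 ∧ eval P (pderiv 0 h) ≠ 0 ∧
      ∀ i, P i ^ p = P i) :
    K * S.card ≤ d * (d + A + p * (d + B)) := by
  classical
  have : Fact p.Prime := ⟨hpp⟩
  obtain ⟨c, hc0, hc⟩ := stepanov_coeffs (T := 2 * d + A + B + K * d) H (by omega) hcount
  have hnv := stepanov_nonvanish hpp H hd hdp hp hA c hc0
  refine bezout_bound h _ hp hnv d _ H.totalDegree
    (totalDegree_sum_smul_le _ _ _ _ (fun ab _ => ?_)) S (fun P hP => (hS P hP).1) K ?_ ?_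
  · refine (totalDegree_mul _ _).trans ?_
    have h1 := totalDegree_mono (k := κ) ab.1
    have h2 := totalDegree_mono (k := κ) ab.2
    have h3 := totalDegree_pow (mono κ ab.2) p
    have h4 : p * (mono κ ab.2).totalDegree ≤ p * (d + B) := Nat.mul_le_mul_left _ h2
    omega
  · intro P hP j hj
    obtain ⟨hP1, hP2, hP3⟩ := hS P hP
    obtain ⟨w, hw⟩ := hc j hj
    have h1 : ev P (∑ ab, c ab • ((Dh h)^[j] (mono κ ab.1) * mono κ ab.2)) = 0 := by
      rw [hw, map_mul]
      have : ev P h = 0 := by simpa [MvPolynomial.aeval_eq_eval] using hP1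
      rw [this, zero_mul]
    rw [map_sum] at h1
    rw [Dh_iter_sum, map_sum, ← h1]
    refine Finset.sum_congr rfl (fun ab _ => ?_)
    rw [iter_smul, Dh_iter_mul_pow, map_smul, map_smul, map_mul, map_mul, map_pow]
    congr 2
    have : ∀ G : MvPolynomial (Fin 2) κ, G = mono κ ab.2 → (ev P G) ^ p = ev P G := by
      rintro _ rfl
      rw [mono, aeval_monomial]
      simp only [map_one, one_mul, Finsupp.prod_fintype, pow_zero, implies_true]
      rw [← Finset.prod_pow]
      refine Finset.prod_congr rfl (fun i _ => ?_)
      rw [← pow_mul, mul_comm, pow_mul, hP3]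
    exact this _ rfl
  · intro P hP j hj
    exact mul_ne_zero (factorial_ne hpp (by omega)) (pow_ne_zero _ (hS P hP).2.1)

end Stepanov

end AuxPoly

end

section

open MvPolynomial

namespace AuxPoly

theorem rootMult_le_natDegree {R : Type*} [CommRing R] [IsDomain R] (q : Polynomial R) (x : R) :
    q.rootMultiplicity x ≤ q.natDegree := by
  classical
  rw [← Polynomial.count_roots]
  exact (Multiset.count_le_card _ _).trans (Polynomial.card_roots' q)

section Stepanov2
variable {κ : Type*} [Field κ]

theorem stepanov_arith (p d : ℕ) (hd : 1 ≤ d) (hp : 100 * d ^ 4 ≤ p) :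
    ∃ A B K : ℕ, d * (d + A) < p ∧ K ≤ p ∧
      K * (d * (2 * d + A + B + K * d + 2)) < (d * A) * (d * B) ∧
      ∀ N : ℕ, K * N ≤ d * (d + A + p * (d + B)) → (N : ℝ) ≤ p + 8 * d ^ 2 * √p := by
  have hd2 : d ≤ d ^ 2 := by nlinarith
  have hd4 : d ^ 2 ≤ d ^ 4 := Nat.pow_le_pow_right hd (by norm_num)
  set K := Nat.sqrt p with hK
  have hK1 : K * K ≤ p := Nat.sqrt_le p
  have hK2 : p < (K + 1) * (K + 1) := Nat.lt_succ_sqrt p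
  have hK3 : 10 * d ^ 2 ≤ K := by
    rw [hK, Nat.le_sqrt]; nlinarith
  have hd1 : 1 ≤ d ^ 2 := Nat.one_le_pow _ _ hd
  have hK10 : 10 ≤ K := by omega
  set q := (p - 1) / d with hq
  have hq1 : d * q ≤ p - 1 := Nat.mul_div_le _ _
  have hq2 : p - 1 < d * q + d := by
    have := Nat.lt_mul_div_succ (p - 1) (show 0 < d by omega)
    rw [← hq] at this
    nlinarith
  have hqd : d ≤ q := by
    rw [hq, Nat.le_div_iff_mul_le (by omega)]
    have : d * d = d ^ 2 := by ring
    omega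
  obtain ⟨A, hA⟩ := Nat.exists_eq_add_of_le hqd
  set u := (K + 4 * d ^ 2) / d with hu
  have hu1 : d * u ≤ K + 4 * d ^ 2 := Nat.mul_div_le _ _
  have hu2 : K + 4 * d ^ 2 < d * u + d := by
    have := Nat.lt_mul_div_succ (K + 4 * d ^ 2) (show 0 < d by omega)
    rw [← hu] at this
    nlinarith
  refine ⟨A, u + 1, K, ?_, ?_, ?_, ?_⟩
  · rw [← hA]; omega
  · exact (Nat.le_mul_self K).trans hK1
  · set a := d * A with ha
    set b := d * (u + 1) with hb
    have e1 : K * (d * (2 * d + A + (u + 1) + K * d + 2)) =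
        K * (2 * d ^ 2 + a + b + K * d ^ 2 + 2 * d) := by rw [ha, hb]; ring
    rw [e1]
    have hb1 : K + 4 * d ^ 2 ≤ b := by rw [hb]; nlinarith
    have hb2 : b ≤ K + 4 * d ^ 2 + d := by rw [hb]; nlinarith
    have ha1 : p ≤ a + 2 * d ^ 2 := by
      rw [hA] at hq2
      have : d * (d + A) = d ^ 2 + a := by rw [ha]; ring
      rw [this] at hq2; omega
    obtain ⟨w, hw⟩ := Nat.exists_eq_add_of_le hb1
    have s1 : K * (2 * d ^ 2 + b + K * d ^ 2 + 2 * d) ≤ 9 * d ^ 2 * K + 2 * d ^ 2 * p := by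
      have : 2 * d ^ 2 + b + K * d ^ 2 + 2 * d ≤ 9 * d ^ 2 + 2 * (d ^ 2 * K) := by
        have : K ≤ d ^ 2 * K := Nat.le_mul_of_pos_left _ (by positivity)
        nlinarith
      calc K * (2 * d ^ 2 + b + K * d ^ 2 + 2 * d) ≤ K * (9 * d ^ 2 + 2 * (d ^ 2 * K)) :=
            Nat.mul_le_mul_left _ this
        _ = 9 * d ^ 2 * K + 2 * d ^ 2 * (K * K) := by ring
        _ ≤ _ := by gcongr
    have s2 : 10 * K ≤ p := (Nat.mul_le_mul_right K hK10).trans hK1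
    have s3 : a * (b - K) ≥ a * (4 * d ^ 2) := by
      apply Nat.mul_le_mul_left; omega
    have s4 : a * b = a * (b - K) + a * K := by
      rw [← Nat.mul_add]; congr 1; omega
    have s5 : K * (2 * d ^ 2 + a + b + K * d ^ 2 + 2 * d) =
      K * (2 * d ^ 2 + b + K * d ^ 2 + 2 * d) + a * K := by ring
    rw [s4, s5]
    have s6 : 9 * d ^ 2 * K + 2 * d ^ 2 * p < a * (4 * d ^ 2) := by
      have : 9 * K + 2 * p < 4 * a := by
        have : 100 * d ^ 2 ≤ p := by omega
        have : 100 ≤ p := by omega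
        omega
      have h7 := Nat.mul_lt_mul_of_pos_left this (show 0 < d ^ 2 by omega)
      calc 9 * d ^ 2 * K + 2 * d ^ 2 * p = d ^ 2 * (9 * K + 2 * p) := by ring
        _ < d ^ 2 * (4 * a) := h7
        _ = _ := by ring
    omega
  · intro N hN
    have hKpos : (0 : ℝ) < K := by
      have : 0 < K := by omega
      exact_mod_cast this
    have hsq : √(p : ℝ) ≤ K + 1 := by
      rw [Real.sqrt_le_left (by positivity)]
      have : p ≤ (K + 1) ^ 2 := by nlinarith
      exact_mod_cast this
    have hK10' : (10 : ℝ) ≤ K := by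
      exact_mod_cast hK10
    have hsq0 : 0 ≤ √(p : ℝ) := Real.sqrt_nonneg _
    have hpp : √(p : ℝ) * √(p : ℝ) = p := Real.mul_self_sqrt (by positivity)
    have h1 : K * N ≤ p * (K + 7 * d ^ 2) := by
      refine hN.trans ?_
      have e1 : d * (d + A + p * (d + (u + 1))) = d * (d + A) + p * (d ^ 2 + d * u + d) := by ring
      rw [e1, ← hA]
      have : d ^ 2 + d * u + d + 1 ≤ K + 7 * d ^ 2 := by omega
      have h5 := Nat.mul_le_mul_left p this
      have h3 : d * q ≤ p := by omega
      calc d * q + p * (d ^ 2 + d * u + d) ≤ p + p * (d ^ 2 + d * u + d) := by omega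
        _ = p * (d ^ 2 + d * u + d + 1) := by ring
        _ ≤ _ := h5
    have h2 : (K : ℝ) * N ≤ p * (K + 7 * d ^ 2) := by exact_mod_cast h1
    have h30 : √(p : ℝ) ≤ 8 / 7 * K := by linarith
    have h3 : (p : ℝ) ≤ 8 / 7 * K * √p := by
      calc (p : ℝ) = √p * √p := hpp.symm
        _ ≤ 8 / 7 * K * √p := mul_le_mul_of_nonneg_right h30 hsq0
    have h4 : (K : ℝ) * N ≤ K * (p + 8 * d ^ 2 * √p) := by
      have : (0 : ℝ) ≤ 7 * d ^ 2 := by positivity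
      have h5 := mul_le_mul_of_nonneg_left h3 this
      calc (K : ℝ) * N ≤ p * (K + 7 * d ^ 2) := h2
        _ = p * K + 7 * d ^ 2 * p := by ring
        _ ≤ p * K + 7 * d ^ 2 * (8 / 7 * K * √p) := by linarith
        _ = _ := by ring
    exact le_of_mul_le_mul_left h4 hKpos

theorem stepanov_smooth [IsAlgClosed κ] {p : ℕ} (hpp : p.Prime) [CharP κ p] {d : ℕ}
    {h : MvPolynomial (Fin 2) κ} (H : Reg d h) (hd : 1 ≤ d) (hdp : 100 * d ^ 4 ≤ p) (hp : Prime h)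
    (S : Finset (Fin 2 → κ)) (hS : ∀ P ∈ S, eval P h = 0 ∧ eval P (pderiv 0 h) ≠ 0 ∧
      ∀ i, P i ^ p = P i) : (S.card : ℝ) ≤ p + 8 * d ^ 2 * √p := by
  obtain ⟨A, B, K, h1, h2, h3, h4⟩ := stepanov_arith p d hd hdp
  have hdp' : d < p := by
    have : d ≤ d ^ 4 := Nat.le_self_pow (by norm_num) d
    omega
  exact h4 _ (stepanov_core hpp H hd hdp' hp h1 h2 h3 S hS)

variable {p : ℕ} [Fact p.Prime] [Algebra (ZMod p) κ]

/-- multiplicity of the point `(x,t)` on the fibre of `h`. -/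
noncomputable def nu (h : MvPolynomial (Fin 2) κ) (x t : ZMod p) : ℕ :=
  (sec h (fun _ => algebraMap (ZMod p) κ t)).rootMultiplicity (algebraMap (ZMod p) κ x)

/-- the point of `κ²` given by a pair in `ZMod p`. -/
noncomputable def pt (κ : Type*) [Field κ] {p : ℕ} [Fact p.Prime] [Algebra (ZMod p) κ]
    (xt : ZMod p × ZMod p) : Fin 2 → κ :=
  Fin.cons (algebraMap (ZMod p) κ xt.1) (fun _ => algebraMap (ZMod p) κ xt.2)

theorem pt_inj : Function.Injective (pt κ (p := p)) := by
  intro a b hab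
  have h0 := congrFun hab 0
  have h1 := congrFun hab 1
  exact Prod.ext ((algebraMap (ZMod p) κ).injective h0) ((algebraMap (ZMod p) κ).injective h1)

theorem pt_frob (a : ZMod p × ZMod p) (i : Fin 2) : pt κ a i ^ p = pt κ a i := by
  fin_cases i
  · change algebraMap (ZMod p) κ a.1 ^ p = algebraMap (ZMod p) κ a.1
    rw [← map_pow, ZMod.pow_card]
  · change algebraMap (ZMod p) κ a.2 ^ p = algebraMap (ZMod p) κ a.2
    rw [← map_pow, ZMod.pow_card]

theorem nu_sum_prime [IsAlgClosed κ] {d : ℕ} {h : MvPolynomial (Fin 2) κ} (H : Reg d h) (hd : 1 ≤ d)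
    (hdp : 100 * d ^ 4 ≤ p) (hp : Prime h) :
    ((∑ xt : ZMod p × ZMod p, nu h xt.1 xt.2 : ℕ) : ℝ) ≤ p + 9 * d ^ 2 * √p := by
  classical
  have hpp : p.Prime := Fact.out
  have : CharP κ p := charP_of_injective_algebraMap (algebraMap (ZMod p) κ).injective p
  have hdp' : d < p := by
    have : d ≤ d ^ 4 := Nat.le_self_pow (by norm_num) d
    omega
  have hchard : (d : κ) ≠ 0 := by
    rw [Ne, CharP.cast_eq_zero_iff κ p]
    exact Nat.not_dvd_of_pos_of_lt (by omega) hdp'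
  let Z := Finset.univ.filter (fun xt : ZMod p × ZMod p => eval (pt κ xt) h = 0)
  let Z1 := Z.filter (fun xt => eval (pt κ xt) (pderiv 0 h) ≠ 0)
  let Z2 := Z.filter (fun xt => ¬ eval (pt κ xt) (pderiv 0 h) ≠ 0)
  have hz : ∑ xt : ZMod p × ZMod p, nu h xt.1 xt.2 = ∑ xt ∈ Z, nu h xt.1 xt.2 := by
    symm
    apply Finset.sum_subset (Finset.subset_univ _)
    intro xt _ hxt
    apply Polynomial.rootMultiplicity_eq_zero
    intro hr
    apply hxt
    simp only [Z, Finset.mem_filter, Finset.mem_univ, true_and]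
    have := sec_eval h (fun _ => algebraMap (ZMod p) κ xt.2) (algebraMap (ZMod p) κ xt.1)
    rw [pt, ← this]; exact hr
  have hsplit : ∑ xt ∈ Z, nu h xt.1 xt.2 = ∑ xt ∈ Z1, nu h xt.1 xt.2 + ∑ xt ∈ Z2, nu h xt.1 xt.2 :=
    (Finset.sum_filter_add_sum_filter_not Z _ _).symm
  have h1 : ∑ xt ∈ Z1, nu h xt.1 xt.2 ≤ Z1.card := by
    rw [Finset.card_eq_sum_ones]
    apply Finset.sum_le_sum
    intro xt hxt
    simp only [Z1, Finset.mem_filter] at hxt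
    by_contra hlt
    push Not at hlt
    have h2 := (Polynomial.one_lt_rootMultiplicity_iff_isRoot (H.sec_ne_zero _)).1 hlt
    apply hxt.2
    have := sec_eval (pderiv 0 h) (fun _ => algebraMap (ZMod p) κ xt.2) (algebraMap (ZMod p) κ xt.1)
    rw [pt, ← this, sec_derivative]
    exact h2.2
  have h2 : ∑ xt ∈ Z2, nu h xt.1 xt.2 ≤ d * Z2.card := by
    rw [mul_comm]
    apply Finset.sum_le_card_nsmul
    intro xt _
    rw [nu]
    calc _ ≤ (sec h (fun _ => algebraMap (ZMod p) κ xt.2)).natDegree :=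
          rootMult_le_natDegree _ _
      _ = d := H.sec_natDegree _
  have h3 : (Z1.card : ℝ) ≤ p + 8 * d ^ 2 * √p := by
    rw [← Finset.card_image_of_injective Z1 (pt_inj (κ := κ))]
    apply stepanov_smooth hpp H hd hdp hp
    intro P hP
    obtain ⟨xt, hxt, rfl⟩ := Finset.mem_image.1 hP
    simp only [Z1, Z, Finset.mem_filter, Finset.mem_univ, true_and] at hxt
    exact ⟨hxt.1, hxt.2, pt_frob xt⟩
  have h4 : Z2.card ≤ d * d := by
    rw [← Finset.card_image_of_injective Z2 (pt_inj (κ := κ)), ← one_mul (Finset.card _)]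
    have hmem : ∀ P ∈ Z2.image (pt κ), eval P h = 0 ∧ eval P (pderiv 0 h) = 0 := by
      intro P hP
      obtain ⟨xt, hxt, rfl⟩ := Finset.mem_image.1 hP
      simp only [Z2, Z, Finset.mem_filter, Finset.mem_univ, true_and] at hxt
      exact ⟨hxt.1, not_not.1 hxt.2⟩
    refine bezout_bound h (pderiv 0 h) hp (H.not_dvd_pderiv hd hchard) d d H.totalDegree
      ((totalDegree_pderiv_le 0 h).trans (by have := H.1; omega)) _ (fun P hP => (hmem P hP).1) 1 ?_ ?_
    · intro P hP j hj
      obtain rfl : j = 0 := by omega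
      simpa [MvPolynomial.aeval_eq_eval] using (hmem P hP).2
    · intro P hP j hj
      obtain rfl : j = 0 := by omega
      simp
  have h5 : (d : ℝ) ≤ √p := by
    apply Real.le_sqrt_of_sq_le
    have : d ^ 2 ≤ d ^ 4 := Nat.pow_le_pow_right hd (by norm_num)
    have : d ^ 2 ≤ p := by omega
    exact_mod_cast this
  rw [hz, hsplit]
  push_cast
  have h6 : ((∑ xt ∈ Z2, nu h xt.1 xt.2 : ℕ) : ℝ) ≤ d * (d * d) := by
    exact_mod_cast h2.trans (Nat.mul_le_mul_left _ h4)
  have h7 : ((∑ xt ∈ Z1, nu h xt.1 xt.2 : ℕ) : ℝ) ≤ Z1.card := by exact_mod_cast h1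
  push_cast at h6 h7
  have h8 : (d : ℝ) * (d * d) ≤ d ^ 2 * √p := by nlinarith [mul_le_mul_of_nonneg_left h5 (sq_nonneg (d : ℝ))]
  linarith

theorem nu_mul {a b : MvPolynomial (Fin 2) κ} {d : ℕ} (H : Reg d (a * b)) (x t : ZMod p) :
    nu (a * b) x t = nu a x t + nu b x t := by
  rw [nu, sec_mul, Polynomial.rootMultiplicity_mul]
  · rfl
  · rw [← sec_mul]; exact H.sec_ne_zero _

theorem nu_sum_multiset [IsAlgClosed κ] (s : Multiset (MvPolynomial (Fin 2) κ))
    (hs : ∀ h ∈ s, Prime h) {d : ℕ} (H : Reg d s.prod) (hdp : 100 * d ^ 4 ≤ p) :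
    ((∑ xt : ZMod p × ZMod p, nu s.prod xt.1 xt.2 : ℕ) : ℝ) ≤ s.card * p + 9 * d ^ 2 * √p := by
  induction s using Multiset.induction_on generalizing d with
  | empty =>
    have : ∀ x t : ZMod p, nu (1 : MvPolynomial (Fin 2) κ) x t = 0 := by
      intro x t
      simp only [nu, sec, map_one, Polynomial.map_one]
      exact Polynomial.rootMultiplicity_C 1 _
    simp only [Multiset.prod_zero, this, Finset.sum_const_zero, Nat.cast_zero, Multiset.card_zero,
      zero_mul, zero_add]
    positivity
  | cons h s ih =>
    rw [Multiset.prod_cons] at H ⊢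
    have hh : Prime h := hs h (Multiset.mem_cons_self _ _)
    have H1 := reg_of_mul H
    have H2 : Reg s.prod.totalDegree s.prod := reg_of_mul (b := h) (by rw [mul_comm]; exact H)
    have hdeg : h.totalDegree + s.prod.totalDegree = d := by
      rw [← totalDegree_mul_of_isDomain H1.ne_zero H2.ne_zero, H.totalDegree]
    have hd1 : 1 ≤ h.totalDegree := by
      by_contra h0
      have h0' : h.totalDegree = 0 := by omega
      rw [totalDegree_eq_zero_iff_eq_C] at h0'
      apply hh.not_isUnit
      rw [h0']
      apply IsUnit.map
      rw [isUnit_iff_ne_zero]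
      intro hz
      rw [hz, C_0] at h0'
      exact H1.ne_zero h0'
    have m1 : h.totalDegree ^ 4 ≤ d ^ 4 := Nat.pow_le_pow_left (by omega) 4
    have m2 : s.prod.totalDegree ^ 4 ≤ d ^ 4 := Nat.pow_le_pow_left (by omega) 4
    have i1 := nu_sum_prime (p := p) H1 hd1 (by omega) hh
    have i2 := ih (fun g hg => hs g (Multiset.mem_cons_of_mem hg)) H2 (by omega)
    simp only [nu_mul H, Finset.sum_add_distrib, Multiset.card_cons]
    rw [← hdeg]
    push_cast at i1 i2 ⊢
    have : (0 : ℝ) ≤ h.totalDegree * s.prod.totalDegree * √p := by positivity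
    nlinarith

/-- Counting points of a plane curve with multiplicity. -/
theorem nu_sum_le [IsAlgClosed κ] (F : MvPolynomial (Fin 2) κ) {d : ℕ} (H : Reg d F)
    (hdp : 100 * d ^ 4 ≤ p) :
    ((∑ xt : ZMod p × ZMod p, nu F xt.1 xt.2 : ℕ) : ℝ) ≤
      (UniqueFactorizationMonoid.factors F).card * p + 9 * d ^ 2 * √p := by
  obtain ⟨u, hu⟩ := UniqueFactorizationMonoid.factors_prod H.ne_zero
  set s := UniqueFactorizationMonoid.factors F with hs
  rw [← hu] at H
  have H1 : Reg s.prod.totalDegree s.prod := reg_of_mul H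
  have hdeg : s.prod.totalDegree ≤ d := by
    rw [← H.totalDegree, totalDegree_mul_of_isDomain H1.ne_zero u.ne_zero]
    omega
  have hnu : ∀ x t : ZMod p, nu F x t = nu s.prod x t := by
    intro x t
    rw [← hu, nu_mul H]
    have : nu (u : MvPolynomial (Fin 2) κ) x t = 0 := by
      apply Polynomial.rootMultiplicity_eq_zero
      intro hr
      have h1 : IsUnit (Polynomial.eval (algebraMap (ZMod p) κ x)
          (sec (u : MvPolynomial (Fin 2) κ) (fun _ => algebraMap (ZMod p) κ t))) := by
        rw [sec_eval]; exact u.isUnit.map _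
      rw [hr] at h1
      exact not_isUnit_zero h1
    omega
  have m2 : s.prod.totalDegree ^ 4 ≤ d ^ 4 := Nat.pow_le_pow_left hdeg 4
  have := nu_sum_multiset (p := p) s (fun h hh => UniqueFactorizationMonoid.prime_of_factor h hh) H1
    (by omega)
  simp only [hnu]
  refine this.trans ?_
  gcongr

end Stepanov2

end AuxPoly

end

section

open MvPolynomial

namespace AuxPoly

/-! ## Ruppert's criterion -/

section RupRing
variable {R : Type*} [CommRing R]

/-- Ruppert's linear operator. -/
noncomputable def rup (F : MvPolynomial (Fin 2) R) :
    (MvPolynomial (Fin 2) R × MvPolynomial (Fin 2) R) →ₗ[R] MvPolynomial (Fin 2) R where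
  toFun q := F * pderiv 1 q.1 - q.1 * pderiv 1 F - (F * pderiv 0 q.2 - q.2 * pderiv 0 F)
  map_add' a b := by simp only [Prod.fst_add, Prod.snd_add, map_add]; ring
  map_smul' c a := by
    simp only [Prod.smul_fst, Prod.smul_snd, smul_eq_C_mul, pderiv_C_mul, RingHom.id_apply]; ring

theorem rup_apply (F g h : MvPolynomial (Fin 2) R) : rup F (g, h) =
    F * pderiv 1 g - g * pderiv 1 F - (F * pderiv 0 h - h * pderiv 0 F) := rfl

theorem rup_mul (a F g h : MvPolynomial (Fin 2) R) :
    rup (a * F) (a * g, a * h) = a ^ 2 * rup F (g, h) := by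
  simp only [rup_apply, pderiv_mul]; ring

theorem pderiv_comm' (h : MvPolynomial (Fin 2) R) :
    pderiv 0 (pderiv 1 h) = pderiv 1 (pderiv 0 h) := by
  ext m
  simp only [coeff_pderiv]
  rw [add_right_comm]
  simp
  ring

theorem rup_factor (u h : MvPolynomial (Fin 2) R) (e : ℕ) :
    rup (u * h ^ e) (u * pderiv 0 h, u * pderiv 1 h) = 0 := by
  simp only [rup_apply, pderiv_mul, pderiv_pow, pderiv_comm']; ring

/-- Columns of the Ruppert matrix. -/
abbrev Col (d : ℕ) : Type :=
  {a : Fin d × Fin d // ¬ ((a.1 : ℕ) = d - 1 ∧ (a.2 : ℕ) = 0)} ⊕ (Fin d × Fin d)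

abbrev Row (d : ℕ) : Type := Fin (2 * d) × Fin (2 * d)

noncomputable def bas (R : Type*) [CommRing R] {d : ℕ} : Col d → MvPolynomial (Fin 2) R × MvPolynomial (Fin 2) R
  | Sum.inl a => (mono R a.1, 0)
  | Sum.inr a => (0, mono R a)

noncomputable def comb {d : ℕ} (v : Col d → R) : MvPolynomial (Fin 2) R × MvPolynomial (Fin 2) R :=
  ∑ c, v c • bas R c

/-- extension by zero at the normalised coefficient -/
noncomputable def extz {d : ℕ} (v : Col d → R) (a : Fin d × Fin d) : R :=
  if h : ¬ ((a.1 : ℕ) = d - 1 ∧ (a.2 : ℕ) = 0) then v (Sum.inl ⟨a, h⟩) else 0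

theorem comb_fst {d : ℕ} (v : Col d → R) : (comb v).1 = ∑ a, extz v a • mono R a := by
  classical
  rw [comb, Fintype.sum_sum_type, Prod.fst_add, Prod.fst_sum, Prod.fst_sum]
  simp only [bas, Prod.smul_fst, smul_zero, Finset.sum_const_zero, add_zero]
  rw [← Finset.sum_filter_add_sum_filter_not Finset.univ
    (fun a : Fin d × Fin d => ¬ ((a.1 : ℕ) = d - 1 ∧ (a.2 : ℕ) = 0)) (fun a => extz v a • mono R a)]
  have h2 : ∑ a ∈ Finset.univ.filter (fun a : Fin d × Fin d =>
      ¬ ¬ ((a.1 : ℕ) = d - 1 ∧ (a.2 : ℕ) = 0)), extz v a • mono R a = 0 := by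
    apply Finset.sum_eq_zero
    intro a ha
    rw [Finset.mem_filter] at ha
    rw [extz, dif_neg ha.2, zero_smul]
  rw [h2, add_zero]
  rw [← Finset.sum_subtype_of_mem (p := fun a : Fin d × Fin d => ¬ ((a.1 : ℕ) = d - 1 ∧ (a.2 : ℕ) = 0))
    (s := Finset.univ.filter (fun a : Fin d × Fin d => ¬ ((a.1 : ℕ) = d - 1 ∧ (a.2 : ℕ) = 0)))
    (f := fun a => extz v a • mono R a) (by intro a ha; exact (Finset.mem_filter.1 ha).2)]
  have : Finset.subtype (fun a : Fin d × Fin d => ¬ ((a.1 : ℕ) = d - 1 ∧ (a.2 : ℕ) = 0))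
      (Finset.univ.filter (fun a : Fin d × Fin d => ¬ ((a.1 : ℕ) = d - 1 ∧ (a.2 : ℕ) = 0))) =
      Finset.univ := by
    ext a; simpa using a.2
  rw [this]
  refine Finset.sum_congr rfl (fun a _ => ?_)
  rw [extz, dif_pos a.2]

theorem comb_snd {d : ℕ} (v : Col d → R) : (comb v).2 = ∑ a, v (Sum.inr a) • mono R a := by
  rw [comb, Fintype.sum_sum_type, Prod.snd_add, Prod.snd_sum, Prod.snd_sum]
  simp [bas]

/-- Ruppert matrix. -/
noncomputable def RM (d : ℕ) (F : MvPolynomial (Fin 2) R) : Matrix (Row d) (Col d) R :=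
  fun r c => coeff (ex2 (r.1, r.2)) (rup F (bas R c))

theorem RM_mulVec {d : ℕ} (F : MvPolynomial (Fin 2) R) (v : Col d → R) (r : Row d) :
    (RM d F).mulVec v r = coeff (ex2 (r.1, r.2)) (rup F (comb v)) := by
  rw [comb, map_sum, coeff_sum, Matrix.mulVec, dotProduct]
  refine Finset.sum_congr rfl (fun c _ => ?_)
  rw [map_smul, coeff_smul, smul_eq_mul, mul_comm]; rfl

theorem mono_map {S : Type*} [CommRing S] (φ : R →+* S) {d A : ℕ} (a : Fin d × Fin A) :
    map φ (mono R a) = mono S a := by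
  simp [mono]

theorem RM_map {S : Type*} [CommRing S] (φ : R →+* S) (d : ℕ) (F : MvPolynomial (Fin 2) R) :
    (RM d F).map φ = RM d (map φ F) := by
  ext r c
  simp only [RM, Matrix.map_apply, ← coeff_map]
  congr 1
  rcases c with a | a
  · simp only [bas, rup_apply, map_sub, map_mul, ← pderiv_map, mono_map, map_zero]
  · simp only [bas, rup_apply, map_sub, map_mul, ← pderiv_map, mono_map, map_zero]

/-- Degree at most `(d,d)`-box. -/
theorem degreeOf_pderiv_le (i j : Fin 2) (G : MvPolynomial (Fin 2) R) :
    (pderiv i G).degreeOf j ≤ G.degreeOf j := by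
  rw [degreeOf_le_iff]
  intro m hm
  have h1 : coeff (m + Finsupp.single i 1) G ≠ 0 := by
    intro h
    rw [mem_support_iff, coeff_pderiv, h, zero_mul] at hm
    exact hm rfl
  have h2 := monomial_le_degreeOf j (mem_support_iff.2 h1)
  simp only [Finsupp.add_apply] at h2
  omega

theorem degreeOf_sub_le' (i : Fin 2) (f g : MvPolynomial (Fin 2) R) (T : ℕ)
    (hf : f.degreeOf i ≤ T) (hg : g.degreeOf i ≤ T) : (f - g).degreeOf i ≤ T :=
  (degreeOf_sub_le _ _ _).trans (max_le hf hg)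

theorem degreeOf_mul_le' (i : Fin 2) (f g : MvPolynomial (Fin 2) R) {a b : ℕ}
    (hf : f.degreeOf i ≤ a) (hg : g.degreeOf i ≤ b) : (f * g).degreeOf i ≤ a + b :=
  (degreeOf_mul_le _ _ _).trans (add_le_add hf hg)

theorem degreeOf_rup {d : ℕ} (hd : 1 ≤ d) {F g h : MvPolynomial (Fin 2) R} (i : Fin 2)
    (hF : F.totalDegree ≤ d) (hg : g.degreeOf i < d) (hh : h.degreeOf i < d) :
    (rup F (g, h)).degreeOf i < 2 * d := by
  have hF' : F.degreeOf i ≤ d := (degreeOf_le_totalDegree _ _).trans hF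
  have hg' : g.degreeOf i ≤ d - 1 := by omega
  have hh' : h.degreeOf i ≤ d - 1 := by omega
  have : (rup F (g, h)).degreeOf i ≤ d + (d - 1) := by
    rw [rup_apply]
    apply degreeOf_sub_le'
    · apply degreeOf_sub_le'
      · exact degreeOf_mul_le' i _ _ hF' ((degreeOf_pderiv_le 1 i g).trans hg')
      · rw [mul_comm]
        exact degreeOf_mul_le' i _ _ ((degreeOf_pderiv_le 1 i F).trans hF') hg'
    · apply degreeOf_sub_le'
      · exact degreeOf_mul_le' i _ _ hF' ((degreeOf_pderiv_le 0 i h).trans hh')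
      · rw [mul_comm]
        exact degreeOf_mul_le' i _ _ ((degreeOf_pderiv_le 0 i F).trans hF') hh'
  omega

theorem degreeOf_sum_mono' {d A : ℕ} (hd : 1 ≤ A) (c : Fin d × Fin A → R) :
    (∑ b, c b • mono R b).degreeOf 1 < A := by
  classical
  rw [degreeOf_lt_iff (by omega)]
  intro m hm
  rw [mem_support_iff, coeff_sum] at hm
  obtain ⟨b, _, hb⟩ := Finset.exists_ne_zero_of_sum_ne_zero hm
  rw [coeff_smul, mono, coeff_monomial] at hb
  split_ifs at hb with h
  · rw [← h, ex2_one]; exact b.2.2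
  · simp at hb

theorem comb_degree {d : ℕ} (hd : 1 ≤ d) (v : Col d → R) :
    (comb v).1.degreeOf 0 < d ∧ (comb v).1.degreeOf 1 < d ∧
    (comb v).2.degreeOf 0 < d ∧ (comb v).2.degreeOf 1 < d := by
  rw [comb_fst, comb_snd]
  exact ⟨degreeOf_sum_mono hd _, degreeOf_sum_mono' hd _, degreeOf_sum_mono hd _,
    degreeOf_sum_mono' hd _⟩

theorem ex2_eta (m : Fin 2 →₀ ℕ) : ex2 (m 0, m 1) = m := by
  ext i
  fin_cases i
  · exact ex2_zero _
  · exact ex2_one _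

theorem RM_mulVec_eq_zero {d : ℕ} (hd : 1 ≤ d) {F : MvPolynomial (Fin 2) R} (hF : F.totalDegree ≤ d)
    (v : Col d → R) : (RM d F).mulVec v = 0 ↔ rup F (comb v) = 0 := by
  constructor
  · intro h
    obtain ⟨h1, h2, h3, h4⟩ := comb_degree hd v
    have d0 := degreeOf_rup hd 0 hF h1 h3
    have d1 := degreeOf_rup hd 1 hF h2 h4
    rw [degreeOf_lt_iff (by omega)] at d0 d1
    ext m
    rw [coeff_zero]
    by_contra hm
    have e0 := d0 m (mem_support_iff.2 hm)
    have e1 := d1 m (mem_support_iff.2 hm)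
    have := congrFun h (⟨m 0, e0⟩, ⟨m 1, e1⟩)
    rw [RM_mulVec] at this
    simp only [ex2_eta] at this
    exact hm this
  · intro h
    ext r
    rw [RM_mulVec, h]; rfl

theorem eq_sum_mono {d A : ℕ} {g : MvPolynomial (Fin 2) R} (h0 : ∀ m ∈ g.support, m 0 < d)
    (h1 : ∀ m ∈ g.support, m 1 < A) :
    g = ∑ a : Fin d × Fin A, coeff (ex2 (a.1, a.2)) g • mono R a := by
  classical
  ext m
  by_cases hm : m 0 < d ∧ m 1 < A
  · have := coeff_sum_mono (fun a : Fin d × Fin A => coeff (ex2 (a.1, a.2)) g) (⟨m 0, hm.1⟩, ⟨m 1, hm.2⟩)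
    simp only [ex2_eta] at this
    exact this.symm
  · have hg : coeff m g = 0 := by
      by_contra hc
      exact hm ⟨h0 m (mem_support_iff.2 hc), h1 m (mem_support_iff.2 hc)⟩
    rw [hg, coeff_sum]
    symm
    apply Finset.sum_eq_zero
    intro a _
    rw [coeff_smul, mono, coeff_monomial, if_neg, smul_zero]
    intro h
    apply hm
    rw [← h, ex2_zero, ex2_one]
    exact ⟨a.1.2, a.2.2⟩

end RupRing
end AuxPoly

end

section

open MvPolynomial

namespace AuxPoly

section RupField
variable {κ : Type*} [Field κ]


theorem van_div {D : Derivation κ (MvPolynomial (Fin 2) κ) (MvPolynomial (Fin 2) κ)} {φ : (MvPolynomial (Fin 2) κ) →ₐ[κ] κ} {a u : (MvPolynomial (Fin 2) κ)} (ha : φ a ≠ 0) (K : ℕ)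
    (h : Van D φ K (a * u)) : Van D φ K u := by
  induction K with
  | zero => exact van_zero _
  | succ K ih =>
    have h1 := ih (van_mono h (Nat.le_succ K))
    intro j hj
    rcases Nat.lt_succ_iff_lt_or_eq.1 hj with h2 | rfl
    · exact h1 j h2
    · have h3 := h j (Nat.lt_succ_self j)
      rw [van_iter_mul a h1] at h3
      exact (mul_eq_zero.1 h3).resolve_left ha

/-- The hard direction of Ruppert's criterion at a rational smooth point. -/
theorem ruppert_hard [CharZero κ] {d : ℕ} (hd : 1 ≤ d) {G : (MvPolynomial (Fin 2) κ)} (HG : Reg d G) (hp : Prime G)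
    (P : Fin 2 → κ) (hP : eval P G = 0) (hPX : eval P (pderiv 0 G) ≠ 0)
    (v : Col d → κ) (hv : (RM d G).mulVec v = 0) : v = 0 := by
  have hdk : (d : κ) ≠ 0 := by exact_mod_cast (by omega : d ≠ 0)
  rw [RM_mulVec_eq_zero hd HG.1] at hv
  obtain ⟨h1, -, h3, -⟩ := comb_degree hd v
  set g := (comb v).1 with hg
  set k := (comb v).2 with hk
  have hv' : rup G (g, k) = 0 := hv
  set l : κ := eval P g / eval P (pderiv 0 G) with hl
  set g1 : (MvPolynomial (Fin 2) κ) := g - C l * pderiv 0 G with hg1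
  set k1 : (MvPolynomial (Fin 2) κ) := k - C l * pderiv 1 G with hk1
  have hr : rup G (g1, k1) = 0 := by
    have e := rup_factor 1 G 1
    rw [one_mul, pow_one, one_mul, one_mul, rup_apply] at e
    rw [rup_apply] at hv' ⊢
    rw [hg1, hk1, map_sub, map_sub, pderiv_C_mul, pderiv_C_mul]
    linear_combination hv' - C l * e
  have hg0 : eval P g1 = 0 := by
    rw [hg1, map_sub, map_mul, eval_C, hl, div_mul_cancel₀ _ hPX, sub_self]
  have hdeg1 : g1.degreeOf 0 < d := by
    refine lt_of_le_of_lt (degreeOf_sub_le _ _ _) (max_lt h1 ?_)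
    exact lt_of_le_of_lt (degreeOf_C_mul_le _ _ _) (degreeOf_pderiv_lt HG.1 hd 0)
  have hdeg2 : k1.degreeOf 0 < d := by
    refine lt_of_le_of_lt (degreeOf_sub_le _ _ _) (max_lt h3 ?_)
    exact lt_of_le_of_lt (degreeOf_C_mul_le _ _ _) (degreeOf_pderiv_lt HG.1 hd 1)
  have hD : ∃ w, pderiv 0 G * Dh G g1 = Dh G (pderiv 0 G) * g1 + w * G := by
    have e1 := congrArg (pderiv 0) hr
    rw [rup_apply] at hr e1
    simp only [map_sub, pderiv_mul, map_zero, pderiv_comm'] at e1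
    refine ⟨pderiv 0 G * (pderiv 0 (pderiv 0 k1) - pderiv 1 (pderiv 0 g1)) +
      pderiv 0 (pderiv 0 G) * (pderiv 1 g1 - pderiv 0 k1), ?_⟩
    rw [Dh_apply, Dh_apply]
    linear_combination pderiv 0 G * e1 - pderiv 0 (pderiv 0 G) * hr
  have hV : ∀ K, Van (Dh G) (ev P) K g1 := by
    intro K
    induction K with
    | zero => exact van_zero _
    | succ K ih =>
      rw [van_succ]
      refine ⟨by simpa [MvPolynomial.aeval_eq_eval] using hg0, ?_⟩
      apply van_div (a := pderiv 0 G) (by simpa [MvPolynomial.aeval_eq_eval] using hPX)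
      obtain ⟨w, hw⟩ := hD
      rw [hw]
      exact van_add (van_mul _ ih) (van_mul _ (van_self G P hP K))
  have hdv : G ∣ g1 := by
    by_contra hnd
    have := bezout_bound G g1 hp hnd d g1.totalDegree HG.totalDegree le_rfl {P}
      (by simpa using hP) (d * g1.totalDegree + 1) (by simpa using hV _)
      (by
        intro Q hQ j _
        rw [Finset.mem_singleton.1 hQ]
        exact mul_ne_zero (by exact_mod_cast j.factorial_ne_zero) (pow_ne_zero _ hPX))
    rw [Finset.card_singleton] at this
    omega
  have hg1z : g1 = 0 := by
    by_contra h0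
    exact HG.not_dvd h0 hdeg1 hdv
  have hk1z : k1 = 0 := by
    by_contra h0
    apply HG.not_dvd h0 hdeg2
    rw [hg1z, rup_apply] at hr
    have : G ∣ k1 * pderiv 0 G := by
      refine ⟨pderiv 0 k1, ?_⟩
      simp only [map_zero, mul_zero, zero_mul, zero_sub, sub_zero] at hr
      linear_combination hr
    exact (hp.dvd_or_dvd this).resolve_right (HG.not_dvd_pderiv hd hdk)
  have hlz : l = 0 := by
    have hc : coeff (Finsupp.single 0 (d - 1)) g = 0 := by
      have := coeff_sum_mono (extz v) (⟨d - 1, by omega⟩, ⟨0, by omega⟩)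
      rw [hg, comb_fst]
      rw [extz, dif_neg (by simp)] at this
      rw [← this]
      congr 1
      ext i
      fin_cases i
      · simpa using (ex2_zero (d - 1, 0)).symm
      · simpa using (ex2_one (d - 1, 0)).symm
    rw [sub_eq_zero.1 (hg1.symm.trans hg1z), coeff_C_mul, coeff_pderiv] at hc
    have e : (Finsupp.single (0 : Fin 2) (d - 1)) + Finsupp.single 0 1 = Finsupp.single 0 d := by
      rw [← Finsupp.single_add]; congr 1; omega
    rw [e] at hc
    have e2 : (((Finsupp.single (0 : Fin 2) (d - 1)) 0 : ℕ) : κ) + 1 = d := by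
      rw [Finsupp.single_eq_same]; exact_mod_cast (by omega : d - 1 + 1 = d)
    rw [e2] at hc
    exact (mul_eq_zero.1 hc).resolve_right (mul_ne_zero HG.2 hdk)
  have hgz : g = 0 := by rw [sub_eq_zero.1 (hg1.symm.trans hg1z), hlz]; simp
  have hkz : k = 0 := by rw [sub_eq_zero.1 (hk1.symm.trans hk1z), hlz]; simp
  rw [hg, comb_fst] at hgz
  rw [hk, comb_snd] at hkz
  ext c
  rcases c with a | a
  · have := coeff_sum_mono (extz v) a.1
    rw [hgz, extz, dif_pos a.2] at this
    simpa using this.symm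
  · have := coeff_sum_mono (fun a => v (Sum.inr a)) a
    rw [hkz] at this
    simpa using this.symm

theorem ruppert_family (s : Multiset (MvPolynomial (Fin 2) κ)) (hs : ∀ h ∈ s, Prime h) {d : ℕ} (H : Reg d s.prod)
    (hch : ∀ j, 1 ≤ j → j ≤ d → (j : κ) ≠ 0) (N : ℕ) (hN : N = s.card) :
    ∃ q : Fin N → (MvPolynomial (Fin 2) κ) × (MvPolynomial (Fin 2) κ), LinearIndependent κ q ∧
      ∀ i, rup s.prod (q i) = 0 ∧ (q i).1.totalDegree < d ∧ (q i).2.totalDegree < d := by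
  induction s using Multiset.induction_on generalizing d N with
  | empty =>
    rw [Multiset.card_zero] at hN
    subst hN
    exact ⟨Fin.elim0, linearIndependent_empty_type, fun i => i.elim0⟩
  | cons h s ih =>
    rw [Multiset.card_cons] at hN
    subst hN
    rw [Multiset.prod_cons] at H ⊢
    have hp : Prime h := hs h (Multiset.mem_cons_self h s)
    have H1 : Reg h.totalDegree h := reg_of_mul H
    have H2 : Reg s.prod.totalDegree s.prod := reg_of_mul (b := h) (by rw [mul_comm]; exact H)
    have hdeg : h.totalDegree + s.prod.totalDegree = d := by
      rw [← totalDegree_mul_of_isDomain H1.ne_zero H2.ne_zero, H.totalDegree]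
    have he : 1 ≤ h.totalDegree := by
      by_contra h0
      have h0' : h.totalDegree = 0 := by omega
      rw [totalDegree_eq_zero_iff_eq_C] at h0'
      have hc : coeff 0 h ≠ 0 := by
        intro hc; rw [hc, C_0] at h0'; exact hp.ne_zero h0'
      apply hp.not_isUnit
      rw [h0']
      exact (isUnit_iff_ne_zero.2 hc).map C
    obtain ⟨q, hq, hq2⟩ := ih (fun x hx => hs x (Multiset.mem_cons_of_mem hx)) H2
      (fun j h1 h2 => hch j h1 (by omega)) s.card rfl
    -- new solution
    have hfin : FiniteMultiplicity h (h * s.prod) :=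
      FiniteMultiplicity.of_prime_left hp H.ne_zero
    obtain ⟨u, hu, hnu⟩ := hfin.exists_eq_pow_mul_and_not_dvd
    set m := multiplicity h (h * s.prod) with hm
    have hm1 : 1 ≤ m := by
      rw [hm]
      exact (hfin.le_multiplicity_of_pow_dvd (k := 1)) (by rw [pow_one]; exact dvd_mul_right _ _)
    have hu0 : u ≠ 0 := by rintro rfl; exact hnu (dvd_zero _)
    have hdu' : h.totalDegree + u.totalDegree ≤ d := by
      rw [← H.totalDegree, hu, ← Nat.succ_pred_eq_of_pos hm1, pow_succ', mul_assoc,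
        totalDegree_mul_of_isDomain hp.ne_zero (mul_ne_zero (pow_ne_zero _ hp.ne_zero) hu0),
        totalDegree_mul_of_isDomain (pow_ne_zero _ hp.ne_zero) hu0]
      omega
    set mulh : (MvPolynomial (Fin 2) κ) × (MvPolynomial (Fin 2) κ) →ₗ[κ] (MvPolynomial (Fin 2) κ) × (MvPolynomial (Fin 2) κ) := (LinearMap.mulLeft κ h).prodMap (LinearMap.mulLeft κ h)
      with hmulh
    have hinj : Function.Injective mulh := by
      intro a b hab
      have h1 := congrArg Prod.fst hab
      have h2 := congrArg Prod.snd hab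
      exact Prod.ext (mul_left_cancel₀ hp.ne_zero h1) (mul_left_cancel₀ hp.ne_zero h2)
    refine ⟨Fin.cons (u * pderiv 0 h, u * pderiv 1 h) (mulh ∘ q), ?_, ?_⟩
    · rw [linearIndependent_finCons]
      refine ⟨hq.map' mulh (LinearMap.ker_eq_bot.2 hinj), fun hmem => ?_⟩
      have key : ∀ x ∈ Submodule.span κ (Set.range (mulh ∘ q)), h ∣ x.1 := by
        intro x hx
        induction hx using Submodule.span_induction with
        | mem x hx => obtain ⟨i, rfl⟩ := hx; exact dvd_mul_right _ _
        | zero => exact dvd_zero _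
        | add x y _ _ hx hy => exact dvd_add hx hy
        | smul a x _ hx =>
          rw [Prod.smul_fst, smul_eq_C_mul]; exact hx.mul_left _
      rcases hp.dvd_or_dvd (key _ hmem) with h1 | h1
      · exact hnu h1
      · exact H1.not_dvd_pderiv he (hch _ he (by omega)) h1
    · intro i
      refine Fin.cases ?_ (fun i => ?_) i
      · rw [Fin.cons_zero]
        refine ⟨?_, ?_, ?_⟩
        · rw [hu, mul_comm]; exact rup_factor u h m
        · refine lt_of_le_of_lt (totalDegree_mul _ _) ?_
          have := totalDegree_pderiv_le 0 h
          omega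
        · refine lt_of_le_of_lt (totalDegree_mul _ _) ?_
          have := totalDegree_pderiv_le 1 h
          omega
      · rw [Fin.cons_succ]
        obtain ⟨h1, h2, h3⟩ := hq2 i
        refine ⟨?_, ?_, ?_⟩
        · have := rup_mul h s.prod (q i).1 (q i).2
          rw [show ((q i).1, (q i).2) = q i from rfl, h1, mul_zero] at this
          exact this
        · refine lt_of_le_of_lt (totalDegree_mul h (q i).1) ?_
          omega
        · refine lt_of_le_of_lt (totalDegree_mul h (q i).2) ?_
          omega

/-- extraction of coefficients -/
noncomputable def extr (κ : Type*) [Field κ] (d : ℕ) :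
    (MvPolynomial (Fin 2) κ × MvPolynomial (Fin 2) κ) →ₗ[κ] (Col d → κ) where
  toFun q c := match c with
    | Sum.inl a => coeff (ex2 (a.1.1, a.1.2)) q.1
    | Sum.inr a => coeff (ex2 (a.1, a.2)) q.2
  map_add' a b := by ext c; rcases c with c | c <;> simp
  map_smul' a b := by ext c; rcases c with c | c <;> simp

theorem comb_extr {d : ℕ} (q : (MvPolynomial (Fin 2) κ) × (MvPolynomial (Fin 2) κ)) (h1 : q.1.totalDegree < d) (h2 : q.2.totalDegree < d)
    (h0 : coeff (ex2 (d - 1, 0)) q.1 = 0) : comb (extr κ d q) = q := by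
  have hb : ∀ g : (MvPolynomial (Fin 2) κ), g.totalDegree < d → g = ∑ a : Fin d × Fin d, coeff (ex2 (a.1, a.2)) g • mono κ a := by
    intro g hg
    apply eq_sum_mono
    · intro m hm
      have := le_totalDegree hm
      rw [fin2_sum] at this; omega
    · intro m hm
      have := le_totalDegree hm
      rw [fin2_sum] at this; omega
  apply Prod.ext
  · rw [comb_fst]
    conv_rhs => rw [hb q.1 h1]
    refine Finset.sum_congr rfl (fun a _ => ?_)
    congr 1
    rw [extz]
    split_ifs with h
    · rw [h.1, h.2, h0]
    · rfl
  · rw [comb_snd]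
    conv_rhs => rw [hb q.2 h2]
    rfl

theorem ruppert_easy {F : (MvPolynomial (Fin 2) κ)} {d : ℕ} (hd : 1 ≤ d) (H : Reg d F)
    (hch : ∀ j, 1 ≤ j → j ≤ d → (j : κ) ≠ 0) :
    (UniqueFactorizationMonoid.factors F).card ≤
      Module.finrank κ (LinearMap.ker (RM d F).mulVecLin) + 1 := by
  classical
  set s := UniqueFactorizationMonoid.factors F with hs
  obtain ⟨w, hw⟩ := UniqueFactorizationMonoid.factors_prod H.ne_zero
  have hw1 : (w : (MvPolynomial (Fin 2) κ)).totalDegree = 0 := by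
    have := totalDegree_mul_of_isDomain (w.ne_zero) (w⁻¹).ne_zero
    rw [Units.mul_inv, totalDegree_one] at this
    omega
  rw [totalDegree_eq_zero_iff_eq_C] at hw1
  set c := coeff 0 (w : (MvPolynomial (Fin 2) κ)) with hc
  have Hs : Reg s.prod.totalDegree s.prod := reg_of_mul (b := (w : (MvPolynomial (Fin 2) κ))) (by rw [hw]; exact H)
  have hdeg : s.prod.totalDegree = d := by
    have := totalDegree_mul_of_isDomain Hs.ne_zero (w.ne_zero)
    rw [hw, H.totalDegree, hw1, totalDegree_C] at this
    omega
  rw [hdeg] at Hs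
  obtain ⟨q, hq, hq2⟩ := ruppert_family s
    (fun x hx => UniqueFactorizationMonoid.prime_of_factor x hx) Hs hch s.card rfl
  have hrF : ∀ x, rup s.prod x = 0 → rup F x = 0 := by
    intro x hx
    rw [← hw, hw1, mul_comm]
    rw [show x = (x.1, x.2) from rfl, rup_apply] at hx ⊢
    simp only [pderiv_C_mul]
    linear_combination C c * hx
  generalize hN : s.card = N at q hq hq2 ⊢
  set Lq : (Fin N → κ) →ₗ[κ] (MvPolynomial (Fin 2) κ) × (MvPolynomial (Fin 2) κ) := Fintype.linearCombination κ q with hLq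
  have hLinj : Function.Injective Lq := by
    exact linearIndependent_iff_injective_fintypeLinearCombination.1 hq
  set ℓ : (Fin N → κ) →ₗ[κ] κ :=
    (lcoeff κ (ex2 (d - 1, 0))) ∘ₗ LinearMap.fst κ (MvPolynomial (Fin 2) κ) (MvPolynomial (Fin 2) κ) ∘ₗ Lq with hℓ
  have hprop : ∀ v : Fin N → κ, rup F (Lq v) = 0 ∧ (Lq v).1.totalDegree < d ∧
      (Lq v).2.totalDegree < d := by
    intro v
    have e : Lq v = ∑ i, v i • q i := Fintype.linearCombination_apply _ _ _
    refine ⟨hrF _ ?_, ?_, ?_⟩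
    · rw [e, map_sum]
      refine Finset.sum_eq_zero (fun i _ => ?_)
      rw [map_smul, (hq2 i).1, smul_zero]
    · rw [e, Prod.fst_sum]
      refine lt_of_le_of_lt (totalDegree_finsetSum _ _) ?_
      rw [Finset.sup_lt_iff (by exact hd)]
      intro i _
      rw [Prod.smul_fst]
      exact lt_of_le_of_lt (totalDegree_smul_le _ _) (hq2 i).2.1
    · rw [e, Prod.snd_sum]
      refine lt_of_le_of_lt (totalDegree_finsetSum _ _) ?_
      rw [Finset.sup_lt_iff (by exact hd)]
      intro i _
      rw [Prod.smul_snd]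
      exact lt_of_le_of_lt (totalDegree_smul_le _ _) (hq2 i).2.2
  have hcomb : ∀ v : Fin N → κ, ℓ v = 0 → comb (extr κ d (Lq v)) = Lq v := by
    intro v hv
    exact comb_extr _ (hprop v).2.1 (hprop v).2.2 hv
  let Ψ : LinearMap.ker ℓ →ₗ[κ] LinearMap.ker (RM d F).mulVecLin :=
    LinearMap.codRestrict _ ((extr κ d ∘ₗ Lq) ∘ₗ (LinearMap.ker ℓ).subtype) (by
      intro v
      rw [LinearMap.mem_ker, Matrix.mulVecLin_apply, RM_mulVec_eq_zero hd H.1]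
      change rup F (comb (extr κ d (Lq v))) = 0
      rw [hcomb v v.2]
      exact (hprop v).1)
  have hΨ : Function.Injective Ψ := by
    intro v v' hvv
    have h1 : extr κ d (Lq v) = extr κ d (Lq v') := congrArg Subtype.val hvv
    have h2 := congrArg comb h1
    rw [hcomb v v.2, hcomb v' v'.2] at h2
    exact Subtype.ext (hLinj h2)
  have h1 := LinearMap.finrank_le_finrank_of_injective hΨ
  have h2 := LinearMap.finrank_range_add_finrank_ker ℓ
  rw [Module.finrank_fin_fun] at h2
  have h3 := Submodule.finrank_le (LinearMap.range ℓ)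
  rw [Module.finrank_self] at h3
  omega

end RupField
end AuxPoly

end

section

open MvPolynomial

namespace AuxPoly

/-! ## Determinants with large kernel at a point -/

section DetKer
variable {κ : Type*} [Field κ]

theorem det_dvd_of_ker {n : Type*} [Fintype n] [DecidableEq n] (M : Matrix n n (Polynomial κ)) (a : κ)
    (m : ℕ) (hm : m ≤ Module.finrank κ (LinearMap.ker (M.map (Polynomial.eval a)).mulVecLin)) :
    (Polynomial.X - Polynomial.C a) ^ m ∣ M.det := by
  classical
  set A := M.map (Polynomial.eval a) with hA
  obtain ⟨L, L', D, hD⟩ := Matrix.Pivot.exists_list_transvec_mul_mul_list_transvec_eq_diagonal A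
  set U := (L.map Matrix.TransvectionStruct.toMatrix).prod with hU
  set V := (L'.map Matrix.TransvectionStruct.toMatrix).prod with hV
  have hUd : U.det = 1 := Matrix.TransvectionStruct.det_toMatrix_prod L
  have hVd : V.det = 1 := Matrix.TransvectionStruct.det_toMatrix_prod L'
  have hrank : (Matrix.diagonal D).rank ≤ A.rank := by
    rw [← hD]
    exact (Matrix.rank_mul_le_left _ _).trans (Matrix.rank_mul_le_right _ _)
  rw [Matrix.rank_diagonal] at hrank
  have h2 := LinearMap.finrank_range_add_finrank_ker A.mulVecLin
  rw [Module.finrank_fintype_fun_eq_card] at h2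
  have hz : m ≤ (Finset.univ.filter (fun i => D i = 0)).card := by
    have h3 := Finset.card_filter_add_card_filter_not (s := (Finset.univ : Finset n)) (fun i => D i = 0)
    rw [Fintype.card_subtype] at hrank
    rw [Finset.card_univ] at h3
    change A.rank + _ = _ at h2
    have h4 : (Finset.univ.filter (fun i => D i ≠ 0)).card = (Finset.univ.filter (fun i => ¬ D i = 0)).card := rfl
    omega
  set M' := U.map Polynomial.C * M * V.map Polynomial.C with hM'
  have hdet : M'.det = M.det := by
    have e1 : (U.map Polynomial.C).det = 1 := by
      have := (RingHom.map_det (Polynomial.C : κ →+* Polynomial κ) U).symm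
      rw [hUd, map_one] at this; exact this
    have e2 : (V.map Polynomial.C).det = 1 := by
      have := (RingHom.map_det (Polynomial.C : κ →+* Polynomial κ) V).symm
      rw [hVd, map_one] at this; exact this
    rw [hM', Matrix.det_mul, Matrix.det_mul, e1, e2, one_mul, mul_one]
  have hM'a : M'.map (Polynomial.evalRingHom a) = Matrix.diagonal D := by
    rw [hM', Matrix.map_mul, Matrix.map_mul, ← hD]
    congr 1
    · congr 1
      ext i j; simp
    · ext i j; simp
  set v : n → Polynomial κ := fun i => if D i = 0 then Polynomial.X - Polynomial.C a else 1 with hv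
  have hdv : ∀ i j, v j ∣ M' i j := by
    intro i j
    simp only [hv]
    split_ifs with h
    · rw [Polynomial.dvd_iff_isRoot]
      have := congrFun (congrFun hM'a i) j
      rw [Matrix.map_apply] at this
      change Polynomial.eval a (M' i j) = 0
      rw [Polynomial.coe_evalRingHom] at this
      rw [this]
      by_cases hij : i = j
      · subst hij; rw [Matrix.diagonal_apply_eq, h]
      · rw [Matrix.diagonal_apply_ne _ hij]
    · exact one_dvd _
  choose N hN using hdv
  have hM'N : M' = Matrix.of (fun i j => v j * (Matrix.of N) i j) := by
    ext i j : 2; rw [hN]; rfl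
  rw [← hdet, hM'N, Matrix.det_mul_row]
  refine Dvd.dvd.mul_right ?_ _
  simp only [hv]
  rw [Finset.prod_ite, Finset.prod_const, Finset.prod_const_one, mul_one]
  exact pow_dvd_pow _ hz

theorem sum_ker_le {n : Type*} [Fintype n] [DecidableEq n] (M : Matrix n n (Polynomial κ))
    (h0 : M.det ≠ 0) (S : Finset κ) :
    ∑ a ∈ S, Module.finrank κ (LinearMap.ker (M.map (Polynomial.eval a)).mulVecLin) ≤
      M.det.natDegree := by
  classical
  refine le_trans ?_ (Polynomial.card_roots' _)
  calc _ ≤ ∑ a ∈ S, M.det.roots.count a := by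
        refine Finset.sum_le_sum (fun a _ => ?_)
        rw [Polynomial.count_roots, Polynomial.le_rootMultiplicity_iff h0]
        exact det_dvd_of_ker M a _ le_rfl
    _ ≤ ∑ a ∈ S ∪ M.det.roots.toFinset, M.det.roots.count a :=
        Finset.sum_le_sum_of_subset Finset.subset_union_left
    _ = M.det.roots.card := by
        apply Multiset.sum_count_eq_card
        intro a ha
        exact Finset.mem_union_right _ (Multiset.mem_toFinset.2 ha)

end DetKer

/-! ## Filtrations -/

structure Filt {R : Type*} [CommRing R] (A : ℕ → AddSubgroup R) : Prop where
  one : (1 : R) ∈ A 0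
  mul : ∀ {i j : ℕ} {a b : R}, a ∈ A i → b ∈ A j → a * b ∈ A (i + j)
  mono : Monotone A

section Filt
variable {R : Type*} [CommRing R] {A : ℕ → AddSubgroup R}

theorem Filt.pow (h : Filt A) {i : ℕ} {a : R} (ha : a ∈ A i) (n : ℕ) : a ^ n ∈ A (n * i) := by
  induction n with
  | zero => rw [pow_zero, zero_mul]; exact h.one
  | succ n ih => rw [pow_succ, Nat.succ_mul]; exact h.mul ih ha

theorem Filt.prod (h : Filt A) {ι : Type*} (s : Finset ι) (a : ι → R) (e : ι → ℕ)
    (ha : ∀ i ∈ s, a i ∈ A (e i)) : ∏ i ∈ s, a i ∈ A (∑ i ∈ s, e i) := by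
  classical
  induction s using Finset.induction_on with
  | empty => simpa using h.one
  | insert i s hi ih =>
    rw [Finset.prod_insert hi, Finset.sum_insert hi]
    exact h.mul (ha i (Finset.mem_insert_self _ _)) (ih fun j hj => ha j (Finset.mem_insert_of_mem hj))

theorem Filt.det (h : Filt A) {n : Type*} [Fintype n] [DecidableEq n] (M : Matrix n n R) (e : ℕ)
    (hM : ∀ i j, M i j ∈ A e) : M.det ∈ A (Fintype.card n * e) := by
  rw [Matrix.det_apply]
  refine AddSubgroup.sum_mem _ (fun σ _ => ?_)
  rw [Units.smul_def]
  apply AddSubgroup.zsmul_mem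
  have := h.prod Finset.univ (fun i => M (σ i) i) (fun _ => e) (fun i _ => hM _ _)
  simpa using this

/-- coefficientwise filtration -/
def AC (A : ℕ → AddSubgroup R) (e : ℕ) : AddSubgroup (MvPolynomial (Fin 2) R) where
  carrier := {F | ∀ m, coeff m F ∈ A e}
  zero_mem' m := by rw [coeff_zero]; exact (A e).zero_mem
  add_mem' ha hb m := by rw [coeff_add]; exact (A e).add_mem (ha m) (hb m)
  neg_mem' ha m := by rw [coeff_neg]; exact (A e).neg_mem (ha m)

theorem mem_AC {e : ℕ} {F : MvPolynomial (Fin 2) R} : F ∈ AC A e ↔ ∀ m, coeff m F ∈ A e := Iff.rfl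

theorem AC_monomial {e : ℕ} (m : Fin 2 →₀ ℕ) {c : R} (hc : c ∈ A e) : monomial m c ∈ AC A e := by
  classical
  intro m'
  rw [coeff_monomial]
  split_ifs
  · exact hc
  · exact (A e).zero_mem

theorem AC_C {e : ℕ} {c : R} (hc : c ∈ A e) : (C c : MvPolynomial (Fin 2) R) ∈ AC A e := AC_monomial 0 hc

theorem Filt.AC (h : Filt A) : Filt (AC A) where
  one := AC_C h.one
  mul ha hb m := by
    classical
    rw [coeff_mul]
    exact AddSubgroup.sum_mem _ (fun x _ => h.mul (ha _) (hb _))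
  mono i j hij F hF m := h.mono hij (hF m)

theorem AC_pderiv {e : ℕ} {F : MvPolynomial (Fin 2) R} (hF : F ∈ AC A e) (i : Fin 2) :
    pderiv i F ∈ AC A e := by
  intro m
  rw [coeff_pderiv]
  have : coeff (m + Finsupp.single i 1) F * ((m i : R) + 1) = (m i + 1) • coeff (m + Finsupp.single i 1) F := by
    rw [nsmul_eq_mul]; push_cast; ring
  rw [this]
  exact AddSubgroup.nsmul_mem _ (hF _) _

/-- Gram determinant of the Ruppert matrix. -/
noncomputable def gram (d : ℕ) (F : MvPolynomial (Fin 2) R) : Matrix (Col d) (Col d) R :=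
  (RM d F).transpose * RM d F

theorem gram_map {S : Type*} [CommRing S] (φ : R →+* S) (d : ℕ) (F : MvPolynomial (Fin 2) R) :
    (gram d F).map φ = gram d (map φ F) := by
  rw [gram, gram, ← RM_map, Matrix.map_mul, Matrix.transpose_map]

theorem gram_det_map {S : Type*} [CommRing S] (φ : R →+* S) (d : ℕ) (F : MvPolynomial (Fin 2) R) :
    φ (gram d F).det = (gram d (map φ F)).det := by
  rw [← gram_map, RingHom.map_det]; rfl

theorem Filt.RM (h : Filt A) {d e : ℕ} {F : MvPolynomial (Fin 2) R} (hF : F ∈ AuxPoly.AC A e)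
    (r : Row d) (c : Col d) : AuxPoly.RM d F r c ∈ A e := by
  have key : ∀ a b : MvPolynomial (Fin 2) R, a ∈ AuxPoly.AC A 0 → b ∈ AuxPoly.AC A 0 →
      rup F (a, b) ∈ AuxPoly.AC A e := by
    intro a b ha hb
    rw [rup_apply]
    refine AddSubgroup.sub_mem _ (AddSubgroup.sub_mem _ ?_ ?_) (AddSubgroup.sub_mem _ ?_ ?_)
    · exact h.AC.mul hF (AC_pderiv ha 1)
    · have := h.AC.mul ha (AC_pderiv hF 1)
      rwa [zero_add] at this
    · exact h.AC.mul hF (AC_pderiv hb 0)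
    · have := h.AC.mul hb (AC_pderiv hF 0)
      rwa [zero_add] at this
  rcases c with c | c
  · exact key _ _ (AC_monomial _ h.one) (AddSubgroup.zero_mem _) _
  · exact key _ _ (AddSubgroup.zero_mem _) (AC_monomial _ h.one) _

theorem card_Col (d : ℕ) : Fintype.card (Col d) ≤ 2 * d ^ 2 := by
  rw [Fintype.card_sum]
  have := Fintype.card_subtype_le (fun a : Fin d × Fin d => ¬ ((a.1 : ℕ) = d - 1 ∧ (a.2 : ℕ) = 0))
  rw [Fintype.card_prod, Fintype.card_fin] at *
  nlinarith

theorem Filt.gram (h : Filt A) {d e : ℕ} {F : MvPolynomial (Fin 2) R} (hF : F ∈ AuxPoly.AC A e) :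
    (gram d F).det ∈ A (4 * d ^ 2 * e) := by
  have h1 := h.det (AuxPoly.gram d F) (e + e) (by
    intro i j
    rw [AuxPoly.gram, Matrix.mul_apply]
    exact AddSubgroup.sum_mem _ (fun x _ => h.mul (h.RM hF _ _) (h.RM hF _ _)))
  refine h.mono ?_ h1
  calc _ ≤ (2 * d ^ 2) * (e + e) := Nat.mul_le_mul_right _ (card_Col d)
    _ = _ := by ring

/-! ## homogenised evaluation -/

section hom
variable {R0 S S' : Type*} [CommRing R0] [CommRing S] [Algebra R0 S] [CommRing S'] [Algebra R0 S'] {n : ℕ}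

noncomputable def hom (d : ℕ) (f : MvPolynomial (Fin n) R0) (ρ : S) (z : Fin n → S) : S :=
  ∑ m ∈ f.support, algebraMap R0 S (coeff m f) * (ρ ^ (d - ∑ i, m i) * ∏ i, z i ^ m i)

theorem hom_map (φ : S →ₐ[R0] S') (d : ℕ) (f : MvPolynomial (Fin n) R0) (ρ : S) (z : Fin n → S) :
    φ (hom d f ρ z) = hom d f (φ ρ) (fun i => φ (z i)) := by
  simp [hom]

theorem hom_unit {d : ℕ} {f : MvPolynomial (Fin n) R0} (hf : f.totalDegree ≤ d) {ρ c : S}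
    (hc : ρ * c = 1) (z : Fin n → S) : hom d f ρ z = ρ ^ d * aeval (fun i => c * z i) f := by
  rw [hom, aeval_def, eval₂_eq', Finset.mul_sum]
  refine Finset.sum_congr rfl (fun m hm => ?_)
  have h1 : ∑ i, m i ≤ d := by
    have := le_totalDegree hm
    rw [fsum_fintype] at this
    omega
  simp only [mul_pow]
  rw [Finset.prod_mul_distrib, Finset.prod_pow_eq_pow_sum]
  have : ρ ^ d * c ^ (∑ i, m i) = ρ ^ (d - ∑ i, m i) := by
    conv_lhs => rw [← Nat.sub_add_cancel h1, pow_add, mul_assoc, ← mul_pow, hc, one_pow, mul_one]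
  rw [← this]; ring

theorem hom_zero {d : ℕ} {f : MvPolynomial (Fin n) R0} (hf : f.totalDegree ≤ d) (z : Fin n → S) :
    hom d f 0 z = aeval z (homogeneousComponent d f) := by
  rw [hom, homogeneousComponent_apply, map_sum, Finset.sum_filter]
  refine Finset.sum_congr rfl (fun m hm => ?_)
  have h1 : ∑ i, m i ≤ d := by
    have := le_totalDegree hm
    rw [fsum_fintype] at this
    omega
  have h2 : m.degree = ∑ i, m i := by
    rw [← fsum_fintype]; rfl
  rw [h2]
  split_ifs with h
  · rw [aeval_monomial, h, Nat.sub_self, pow_zero, one_mul, Finsupp.prod_fintype]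
    intro i; exact pow_zero _
  · rw [zero_pow (by omega), zero_mul, mul_zero]

theorem Filt.hom {A : ℕ → AddSubgroup S} (h : Filt A) {d : ℕ} {f : MvPolynomial (Fin n) R0}
    (hf : f.totalDegree ≤ d) {ρ : S} {z : Fin n → S} (h0 : ∀ c : R0, algebraMap R0 S c ∈ A 0)
    (hρ : ρ ∈ A 1) (hz : ∀ i, z i ∈ A 1) : hom d f ρ z ∈ A d := by
  rw [AuxPoly.hom]
  refine AddSubgroup.sum_mem _ (fun m hm => ?_)
  have h1 : ∑ i, m i ≤ d := by
    have := le_totalDegree hm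
    rw [fsum_fintype] at this
    omega
  have h2 := h.mul (h0 (coeff m f)) (h.mul (h.pow hρ (d - ∑ i, m i))
    (h.prod Finset.univ (fun i => z i ^ m i) (fun i => m i * 1) (fun i _ => h.pow (hz i) _)))
  refine h.mono ?_ h2
  simp only [mul_one]
  omega

/-- the generic plane `(X, v + t β)`. -/
noncomputable def line {S : Type*} [CommRing S] {r : ℕ} (v β : Fin r → S) :
    Fin (r + 1) → MvPolynomial (Fin 2) S :=
  Fin.cons (X 0) (fun i => C (v i) + C (β i) * X 1)

theorem line_map {S S' : Type*} [CommRing S] [CommRing S'] (φ : S →+* S') {r : ℕ} (v β : Fin r → S)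
    (i : Fin (r + 1)) : map φ (line v β i) = line (fun i => φ (v i)) (fun i => φ (β i)) i := by
  refine Fin.cases ?_ (fun i => ?_) i <;> simp [line]

theorem Filt.line {A : ℕ → AddSubgroup S} (h : Filt A) {r : ℕ} {v β : Fin r → S} (hv : ∀ i, v i ∈ A 1)
    (hβ : ∀ i, β i ∈ A 1) (i : Fin (r + 1)) : line v β i ∈ AuxPoly.AC A 1 := by
  have hX : ∀ j, (X j : MvPolynomial (Fin 2) S) ∈ AuxPoly.AC A 0 := fun j => AC_monomial _ h.one
  refine Fin.cases ?_ (fun i => ?_) i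
  · exact h.AC.mono (Nat.zero_le 1) (hX 0)
  · exact AddSubgroup.add_mem _ (AC_C (hv i)) (h.AC.mul (AC_C (hβ i)) (hX 1))

end hom

end Filt
end AuxPoly

end

section

open MvPolynomial

namespace AuxPoly

section secLemmas
variable {R : Type*} [CommRing R]

theorem tdeg_map_le {σ S : Type*} [CommRing S] (φ : R →+* S) (f : MvPolynomial σ R) :
    (map φ f).totalDegree ≤ f.totalDegree :=
  Finset.sup_mono (support_map_subset _ _)

theorem sec_C {n : ℕ} (a : R) (y : Fin n → R) : sec (C a) y = Polynomial.C a := by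
  rw [sec, finSuccEquiv_apply]; simp

theorem sec_X_zero {n : ℕ} (y : Fin n → R) : sec (X 0) y = Polynomial.X := by
  rw [sec, finSuccEquiv_apply]; simp

theorem sec_X_succ {n : ℕ} (y : Fin n → R) (i : Fin n) : sec (X i.succ) y = Polynomial.C (y i) := by
  rw [sec, finSuccEquiv_apply]; simp

theorem sec_add {n : ℕ} (a b : MvPolynomial (Fin (n + 1)) R) (y : Fin n → R) :
    sec (a + b) y = sec a y + sec b y := by simp [sec]

theorem sec_map {S : Type*} [CommRing S] (φ : R →+* S) {n : ℕ} (h : MvPolynomial (Fin (n + 1)) R)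
    (y : Fin n → R) : sec (map φ h) (fun i => φ (y i)) = (sec h y).map φ := by
  induction h using MvPolynomial.induction_on with
  | C a => rw [map_C, sec_C, sec_C, Polynomial.map_C]
  | add a b ha hb =>
    rw [map_add, sec_add, sec_add, ha, hb, Polynomial.map_add]
  | mul_X a i ha =>
    rw [map_mul, sec_mul, ha, sec_mul, Polynomial.map_mul]
    congr 1
    refine Fin.cases ?_ (fun i => ?_) i
    · rw [map_X, sec_X_zero, sec_X_zero, Polynomial.map_X]
    · rw [map_X, sec_X_succ, sec_X_succ, Polynomial.map_C]

theorem sec_eq_aeval {n : ℕ} (h : MvPolynomial (Fin (n + 1)) R) (y : Fin n → R) :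
    sec h y = aeval (Fin.cons Polynomial.X (fun i => Polynomial.C (y i)) : Fin (n + 1) → Polynomial R) h := by
  induction h using MvPolynomial.induction_on with
  | C a => rw [sec_C, aeval_C]; rfl
  | add a b ha hb => rw [map_add, ← ha, ← hb, sec_add]
  | mul_X a i ha =>
    rw [sec_mul, ha, map_mul, aeval_X]
    congr 1
    refine Fin.cases ?_ (fun i => ?_) i
    · rw [sec_X_zero, Fin.cons_zero]
    · rw [sec_X_succ, Fin.cons_succ]

theorem hom_map' {R0 S S' : Type*} [CommRing R0] [CommRing S] [Algebra R0 S] [CommRing S']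
    [Algebra R0 S'] {n : ℕ} (φ : S →+* S') (hφ : ∀ c : R0, φ (algebraMap R0 S c) = algebraMap R0 S' c)
    (d : ℕ) (f : MvPolynomial (Fin n) R0) (ρ : S) (z : Fin n → S) :
    φ (hom d f ρ z) = hom d f (φ ρ) (fun i => φ (z i)) := by
  simp [hom, hφ]

/-- total degree filtration -/
noncomputable def TD (σ R : Type*) [CommRing R] (e : ℕ) : AddSubgroup (MvPolynomial σ R) :=
  (restrictTotalDegree σ R e).toAddSubgroup

theorem mem_TD {σ : Type*} {e : ℕ} {F : MvPolynomial σ R} : F ∈ TD σ R e ↔ F.totalDegree ≤ e := by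
  rw [TD, Submodule.mem_toAddSubgroup, mem_restrictTotalDegree]

theorem filt_TD (σ : Type*) : Filt (TD σ R) where
  one := by rw [mem_TD, totalDegree_one]
  mul ha hb := by
    rw [mem_TD] at *
    exact (totalDegree_mul _ _).trans (add_le_add ha hb)
  mono i j hij F hF := by
    rw [mem_TD] at *
    exact hF.trans hij

/-- degree filtration -/
noncomputable def PD (R : Type*) [CommRing R] (e : ℕ) : AddSubgroup (Polynomial R) where
  carrier := {q | q.natDegree ≤ e}
  zero_mem' := by simp
  add_mem' ha hb := (Polynomial.natDegree_add_le _ _).trans (max_le ha hb)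
  neg_mem' ha := by
    change (-_ : Polynomial R).natDegree ≤ e
    rw [Polynomial.natDegree_neg]; exact ha

theorem filt_PD : Filt (PD R) where
  one := by change (1 : Polynomial R).natDegree ≤ 0; simp
  mul ha hb := Polynomial.natDegree_mul_le.trans (add_le_add ha hb)
  mono i j hij F hF := le_trans (α := ℕ) hF hij

theorem line_TD {r : ℕ} (v β : Fin r → R) (i : Fin (r + 1)) : line v β i ∈ TD (Fin 2) R 1 := by
  rw [mem_TD]
  have hX : ∀ j : Fin 2, (X j : MvPolynomial (Fin 2) R).totalDegree ≤ 1 := by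
    intro j
    refine (totalDegree_monomial_le _ _).trans ?_
    rw [Finsupp.sum_single_index] <;> simp
  refine Fin.cases ?_ (fun i => ?_) i
  · exact hX 0
  · simp only [line, Fin.cons_succ]
    refine (totalDegree_add _ _).trans (max_le (by simp) ?_)
    refine (totalDegree_mul _ _).trans ?_
    have := hX 1
    rw [totalDegree_C]; omega

theorem hom_line_totalDegree {R0 : Type*} [CommRing R0] [Algebra R0 R] {r d : ℕ}
    {f : MvPolynomial (Fin (r + 1)) R0} (hf : f.totalDegree ≤ d) (ρ : R) (v β : Fin r → R) :
    (hom d f (C ρ) (line v β)).totalDegree ≤ d := by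
  rw [← mem_TD]
  refine (filt_TD (Fin 2)).hom hf ?_ ?_ (line_TD v β)
  · intro c
    rw [mem_TD, MvPolynomial.algebraMap_apply, totalDegree_C]
  · rw [mem_TD, totalDegree_C]; omega

end secLemmas

section count
variable {p : ℕ} [Fact p.Prime] {r d : ℕ}

theorem sec_hom_line {K : Type*} [Field K] {f : MvPolynomial (Fin (r + 1)) K} (hf : f.totalDegree ≤ d)
    (w v β : Fin r → K) (c : K) (hc : c ≠ 0) (t : K) :
    sec (hom d f (C c⁻¹) (line (fun i => c⁻¹ * w i + v i) β)) (fun _ => t) =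
      Polynomial.C (c⁻¹ ^ d) *
        (sec f (fun i => w i + c * (v i + t * β i))).comp (Polynomial.C c * Polynomial.X) := by
  have h1 : (C c⁻¹ : MvPolynomial (Fin 2) K) * C c = 1 := by rw [← C_mul, inv_mul_cancel₀ hc, C_1]
  rw [hom_unit hf h1, sec_mul, ← C_pow]
  rw [sec_C]
  congr 1
  rw [sec_eq_aeval, sec_eq_aeval, Polynomial.comp_eq_aeval,
    comp_aeval_apply, comp_aeval_apply]
  have e : ∀ i, (aeval (Fin.cons Polynomial.X (fun _ : Fin 1 => Polynomial.C t) : Fin 2 → Polynomial K))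
        (C c * line (fun i => c⁻¹ * w i + v i) β i) =
      Polynomial.aeval (Polynomial.C c * Polynomial.X)
        ((Fin.cons Polynomial.X (fun i => Polynomial.C (w i + c * (v i + t * β i))) :
          Fin (r + 1) → Polynomial K) i) := by
    intro i
    refine Fin.cases ?_ (fun i => ?_) i
    · simp [line]
    · have h1 : (Fin.cons Polynomial.X (fun _ : Fin 1 => Polynomial.C t) : Fin 2 → Polynomial K) 1 =
        Polynomial.C t := rfl
      simp only [line, Fin.cons_succ, map_mul, map_add, aeval_X, aeval_C, Polynomial.aeval_C, h1]
      simp only [Polynomial.algebraMap_eq]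
      have h2 : (Polynomial.C c * Polynomial.C c⁻¹ : Polynomial K) = 1 := by
        rw [← Polynomial.C_mul, mul_inv_cancel₀ hc, Polynomial.C_1]
      linear_combination Polynomial.C (w i) * h2
  exact congrArg (fun g => aeval g f) (funext e)

theorem rootMult_comp {K : Type*} [Field K] (P : Polynomial K) (hP : P ≠ 0) (c u x : K) (hc : c ≠ 0)
    (hu : u ≠ 0) : P.rootMultiplicity (c * x) ≤
      (Polynomial.C u * P.comp (Polynomial.C c * Polynomial.X)).rootMultiplicity x := by
  have hcomp : P.comp (Polynomial.C c * Polynomial.X) ≠ 0 := by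
    intro h
    apply hP
    have := congrArg (fun q => Polynomial.comp q (Polynomial.C c⁻¹ * Polynomial.X)) h
    simp only [Polynomial.comp_assoc] at this
    simpa [← mul_assoc, ← Polynomial.C_mul, hc] using this
  have h0 : Polynomial.C u * P.comp (Polynomial.C c * Polynomial.X) ≠ 0 :=
    mul_ne_zero (by simpa using hu) hcomp
  rw [Polynomial.le_rootMultiplicity_iff h0]
  apply Dvd.dvd.mul_left
  obtain ⟨Q, hQ⟩ := Polynomial.pow_rootMultiplicity_dvd P (c * x)
  set m := P.rootMultiplicity (c * x)
  rw [hQ, Polynomial.mul_comp, Polynomial.pow_comp]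
  apply Dvd.dvd.mul_right
  apply pow_dvd_pow_of_dvd
  refine ⟨Polynomial.C c, ?_⟩
  simp only [Polynomial.sub_comp, Polynomial.X_comp, Polynomial.C_comp]
  rw [Polynomial.C_mul]
  ring

/-- number of roots (with multiplicity) on a fibre -/
noncomputable def fib (f : MvPolynomial (Fin (r + 1)) (ZMod p)) (y : Fin r → ZMod p) : ℕ :=
  ∑ x, (sec f y).rootMultiplicity x

theorem fib_le {f : MvPolynomial (Fin (r + 1)) (ZMod p)} (H : Reg d f) (y : Fin r → ZMod p) :
    fib f y ≤ d := by
  classical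
  rw [fib, ← H.sec_natDegree y]
  refine le_trans ?_ (Polynomial.card_roots' _)
  simp_rw [← Polynomial.count_roots]
  rw [Multiset.sum_count_eq_card]
  intro a _; exact Finset.mem_univ _

noncomputable def nstar (f : MvPolynomial (Fin (r + 1)) (ZMod p)) : ℕ := ∑ y : Fin r → ZMod p, fib f y

/-- the specialised plane section -/
noncomputable def Gsp (d : ℕ) (f : MvPolynomial (Fin (r + 1)) (ZMod p)) (w v β : Fin r → ZMod p)
    (ρ : ZMod p) : MvPolynomial (Fin 2) (ZMod p) :=
  hom d f (C ρ) (line (fun i => ρ * w i + v i) β)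

theorem Gsp_reg {f : MvPolynomial (Fin (r + 1)) (ZMod p)} (H : Reg d f) (w v β : Fin r → ZMod p)
    {c : ZMod p} (hc : c ≠ 0) : Reg d (Gsp d f w v β c⁻¹) := by
  have h1 := hom_line_totalDegree H.1 c⁻¹ (fun i => c⁻¹ * w i + v i) β
  refine ⟨h1, ?_⟩
  rw [Gsp, ← sec_coeff_top h1 (fun _ => 0), sec_hom_line H.1 w v β c hc 0, Polynomial.coeff_C_mul]
  apply mul_ne_zero (pow_ne_zero _ (inv_ne_zero hc))
  rw [Polynomial.comp_C_mul_X_coeff]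
  apply mul_ne_zero _ (pow_ne_zero _ hc)
  rw [sec_coeff_top H.1]
  exact H.2

theorem fib_le_nu (κ : Type*) [Field κ] [Algebra (ZMod p) κ]
    {f : MvPolynomial (Fin (r + 1)) (ZMod p)} (H : Reg d f) (w v β : Fin r → ZMod p)
    {c : ZMod p} (hc : c ≠ 0) (t : ZMod p) :
    fib f (fun i => w i + c * (v i + t * β i)) ≤
      ∑ x : ZMod p, nu (map (algebraMap (ZMod p) κ) (Gsp d f w v β c⁻¹)) x t := by
  rw [fib, ← Equiv.sum_comp (Equiv.mulLeft₀ c hc)]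
  refine Finset.sum_le_sum (fun x _ => ?_)
  rw [nu]
  have e := sec_map (algebraMap (ZMod p) κ) (Gsp d f w v β c⁻¹) (fun _ => t)
  rw [e, ← Polynomial.eq_rootMultiplicity_map (algebraMap (ZMod p) κ).injective, Gsp, sec_hom_line H.1 w v β c hc t]
  exact rootMult_comp _ (H.sec_ne_zero _) c _ x hc (pow_ne_zero _ (inv_ne_zero hc))

/-- the family of plane sections -/
noncomputable def Gfam (κ : Type*) [Field κ] [Algebra (ZMod p) κ] (d : ℕ)
    (f : MvPolynomial (Fin (r + 1)) (ZMod p)) (w v β : Fin r → ZMod p) :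
    MvPolynomial (Fin 2) (Polynomial κ) :=
  hom d f (C Polynomial.X) (line (fun i => Polynomial.X * Polynomial.C (algebraMap (ZMod p) κ (w i)) +
    Polynomial.C (algebraMap (ZMod p) κ (v i))) (fun i => Polynomial.C (algebraMap (ZMod p) κ (β i))))

theorem Gfam_eval (κ : Type*) [Field κ] [Algebra (ZMod p) κ] (f : MvPolynomial (Fin (r + 1)) (ZMod p))
    (w v β : Fin r → ZMod p) (ρ : ZMod p) :
    map (Polynomial.evalRingHom (algebraMap (ZMod p) κ ρ)) (Gfam κ d f w v β) =
      map (algebraMap (ZMod p) κ) (Gsp d f w v β ρ) := by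
  rw [Gfam, Gsp, hom_map', hom_map']
  · congr 1
    · simp
    · funext i
      rw [line_map, line_map]
      congr 1
      · funext i; simp only [map_add, map_mul, Polynomial.coe_evalRingHom, Polynomial.eval_X, Polynomial.eval_C]
      · funext i; simp
  · intro c
    rw [MvPolynomial.algebraMap_apply, MvPolynomial.algebraMap_apply, map_C]; rfl
  · intro c
    rw [MvPolynomial.algebraMap_apply, MvPolynomial.algebraMap_apply, map_C,
      Polynomial.algebraMap_apply]
    simp

theorem Gsp_zero {f : MvPolynomial (Fin (r + 1)) (ZMod p)} (hf : f.totalDegree ≤ d)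
    (w v β : Fin r → ZMod p) :
    Gsp d f w v β 0 = aeval (line v β) (homogeneousComponent d f) := by
  rw [Gsp, C_0, hom_zero hf]
  simp

theorem Gfam_degree (κ : Type*) [Field κ] [Algebra (ZMod p) κ] {f : MvPolynomial (Fin (r + 1)) (ZMod p)}
    (hf : f.totalDegree ≤ d) (w v β : Fin r → ZMod p) :
    (gram d (Gfam κ d f w v β)).det.natDegree ≤ 4 * d ^ 3 := by
  have hP : Filt (PD κ) := filt_PD
  have h1 : Gfam κ d f w v β ∈ AC (PD κ) d := by
    refine hP.AC.hom hf ?_ ?_ ?_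
    · intro c
      rw [MvPolynomial.algebraMap_apply, Polynomial.algebraMap_apply]
      refine AC_C ?_
      change Polynomial.natDegree _ ≤ 0
      simp
    · refine AC_C ?_
      change Polynomial.natDegree _ ≤ 1
      simp
    · refine hP.line ?_ ?_
      · intro i
        change Polynomial.natDegree _ ≤ 1
        compute_degree
      · intro i
        change Polynomial.natDegree _ ≤ 1
        simp
  have h2 : (gram d (Gfam κ d f w v β)).det.natDegree ≤ 4 * d ^ 2 * d := hP.gram (d := d) h1
  calc _ ≤ 4 * d ^ 2 * d := h2
    _ = _ := by ring

/-- total number of superfluous factors -/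
theorem sum_ker_Gsp (κ : Type*) [Field κ] [Algebra (ZMod p) κ] {f : MvPolynomial (Fin (r + 1)) (ZMod p)}
    (hf : f.totalDegree ≤ d) (w v β : Fin r → ZMod p)
    (hN : (gram d (aeval (line v β) (homogeneousComponent d f))).det ≠ 0) (S : Finset (ZMod p)) :
    ∑ ρ ∈ S, Module.finrank κ (LinearMap.ker
      (RM d (map (algebraMap (ZMod p) κ) (Gsp d f w v β ρ))).mulVecLin) ≤ 4 * d ^ 3 := by
  classical
  set M := gram d (Gfam κ d f w v β) with hM
  have h0 : M.det ≠ 0 := by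
    intro h
    have h1 := gram_det_map (Polynomial.evalRingHom (algebraMap (ZMod p) κ 0)) d (Gfam κ d f w v β)
    rw [← hM, h, map_zero, Gfam_eval, Gsp_zero hf, ← gram_det_map] at h1
    rw [eq_comm, map_eq_zero_iff _ (algebraMap (ZMod p) κ).injective] at h1
    exact hN h1
  refine le_trans ?_ (Gfam_degree κ hf w v β)
  refine le_trans ?_ (sum_ker_le M h0 (S.image (algebraMap (ZMod p) κ)))
  rw [Finset.sum_image (fun a _ b _ h => (algebraMap (ZMod p) κ).injective h)]
  refine Finset.sum_le_sum (fun ρ _ => ?_)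
  have e : M.map (Polynomial.eval (algebraMap (ZMod p) κ ρ)) =
      gram d (map (algebraMap (ZMod p) κ) (Gsp d f w v β ρ)) := by
    rw [← Gfam_eval, ← gram_map]; rfl
  rw [e]
  apply Submodule.finrank_mono
  intro x hx
  rw [LinearMap.mem_ker, Matrix.mulVecLin_apply] at hx ⊢
  rw [gram, ← Matrix.mulVec_mulVec, hx, Matrix.mulVec_zero]

theorem plane_count {f : MvPolynomial (Fin (r + 1)) (ZMod p)} (hd : 1 ≤ d) (H : Reg d f)
    (hdp : 100 * d ^ 4 ≤ p) (w v β : Fin r → ZMod p)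
    (hN : (gram d (aeval (line v β) (homogeneousComponent d f))).det ≠ 0) :
    ((∑ c : ZMod p, ∑ t : ZMod p, fib f (fun i => w i + c * (v i + t * β i)) : ℕ) : ℝ) ≤
      p ^ 2 + 9 * d ^ 2 * √p * p + 4 * d ^ 3 * p + d * p := by
  classical
  have hpp : p.Prime := Fact.out
  set κ := AlgebraicClosure (ZMod p)
  have : CharP κ p := charP_of_injective_algebraMap (algebraMap (ZMod p) κ).injective p
  have hch : ∀ j, 1 ≤ j → j ≤ d → (j : κ) ≠ 0 := by
    intro j h1 h2 h3
    rw [CharP.cast_eq_zero_iff κ p j] at h3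
    have h4 := Nat.le_of_dvd (by omega) h3
    have h5 : d ≤ d ^ 4 := Nat.le_self_pow (by norm_num) d
    omega
  set m : ZMod p → ℕ := fun ρ => Module.finrank κ (LinearMap.ker
      (RM d (map (algebraMap (ZMod p) κ) (Gsp d f w v β ρ))).mulVecLin) with hm
  have hc : ∀ c : ZMod p, c ≠ 0 →
      ((∑ t : ZMod p, fib f (fun i => w i + c * (v i + t * β i)) : ℕ) : ℝ) ≤
        (m c⁻¹ + 1) * p + 9 * d ^ 2 * √p := by
    intro c hc
    set F := map (algebraMap (ZMod p) κ) (Gsp d f w v β c⁻¹) with hF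
    have HF : Reg d F := by
      have := Gsp_reg H w v β hc
      refine ⟨(tdeg_map_le _ _).trans this.1, ?_⟩
      rw [hF, coeff_map]
      intro h
      rw [map_eq_zero_iff _ (algebraMap (ZMod p) κ).injective] at h
      exact this.2 h
    have h1 : ∑ t : ZMod p, fib f (fun i => w i + c * (v i + t * β i)) ≤
        ∑ xt : ZMod p × ZMod p, nu F xt.1 xt.2 := by
      rw [Fintype.sum_prod_type_right]
      exact Finset.sum_le_sum (fun t _ => fib_le_nu κ H w v β hc t)
    have h2 := nu_sum_le (p := p) F HF hdp
    have h3 : ((UniqueFactorizationMonoid.factors F).card : ℝ) ≤ m c⁻¹ + 1 := by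
      exact_mod_cast ruppert_easy hd HF hch
    have h1' : ((∑ t : ZMod p, fib f (fun i => w i + c * (v i + t * β i)) : ℕ) : ℝ) ≤
      ((∑ xt : ZMod p × ZMod p, nu F xt.1 xt.2 : ℕ) : ℝ) := by exact_mod_cast h1
    refine h1'.trans (h2.trans ?_)
    gcongr
  have h0 : ∑ t : ZMod p, fib f (fun i => w i + 0 * (v i + t * β i)) ≤ p * d := by
    calc _ ≤ ∑ t : ZMod p, d := Finset.sum_le_sum (fun t _ => fib_le H _)
      _ = p * d := by simp [ZMod.card]
  have h0' : ((∑ t : ZMod p, fib f (fun i => w i + 0 * (v i + t * β i)) : ℕ) : ℝ) ≤ p * d := by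
    exact_mod_cast h0
  have hsum : ∑ c ∈ Finset.univ.erase (0 : ZMod p), m c⁻¹ ≤ 4 * d ^ 3 := by
    have := sum_ker_Gsp κ H.1 w v β hN ((Finset.univ.erase (0 : ZMod p)).image (fun c => c⁻¹))
    rwa [Finset.sum_image (fun a _ b _ h => inv_injective h)] at this
  have hsum' : ∑ c ∈ Finset.univ.erase (0 : ZMod p), (m c⁻¹ : ℝ) ≤ 4 * d ^ 3 := by exact_mod_cast hsum
  rw [← Finset.add_sum_erase Finset.univ _ (Finset.mem_univ (0 : ZMod p)), Nat.cast_add]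
  have hb : ∑ c ∈ Finset.univ.erase (0 : ZMod p),
      ((∑ t : ZMod p, fib f (fun i => w i + c * (v i + t * β i)) : ℕ) : ℝ) ≤
      ∑ c ∈ Finset.univ.erase (0 : ZMod p), ((m c⁻¹ : ℝ) * p + (p + 9 * d ^ 2 * √p)) := by
    refine Finset.sum_le_sum (fun c hc' => ?_)
    refine (hc c (Finset.ne_of_mem_erase hc')).trans (le_of_eq ?_)
    ring
  rw [Finset.sum_add_distrib, ← Finset.sum_mul, Finset.sum_const, nsmul_eq_mul, ← Nat.cast_sum] at hb
  have hcard : ((Finset.univ.erase (0 : ZMod p)).card : ℝ) ≤ p := by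
    have := Finset.card_erase_le (s := Finset.univ) (a := (0 : ZMod p))
    rw [Finset.card_univ, ZMod.card] at this
    exact_mod_cast this
  have hpp0 : (0 : ℝ) ≤ p := Nat.cast_nonneg p
  have e1 := mul_le_mul_of_nonneg_right hsum' hpp0
  have e2 := mul_le_mul_of_nonneg_right hcard (by positivity : (0 : ℝ) ≤ p + 9 * d ^ 2 * √p)
  linarith

theorem nstar_le {f : MvPolynomial (Fin (r + 1)) (ZMod p)} (hd : 1 ≤ d) (H : Reg d f)
    (hdp : 100 * d ^ 4 ≤ p) (v β : Fin r → ZMod p)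
    (hN : (gram d (aeval (line v β) (homogeneousComponent d f))).det ≠ 0) :
    (nstar f : ℝ) ≤ p ^ r * (1 + 10 * d ^ 2 / √p) := by
  classical
  have hpp : p.Prime := Fact.out
  have key : ∑ w : Fin r → ZMod p, ∑ c : ZMod p, ∑ t : ZMod p,
      fib f (fun i => w i + c * (v i + t * β i)) = p ^ 2 * nstar f := by
    rw [Finset.sum_comm]
    have : ∀ c : ZMod p, ∑ w : Fin r → ZMod p, ∑ t : ZMod p,
        fib f (fun i => w i + c * (v i + t * β i)) = p * nstar f := by
      intro c
      rw [Finset.sum_comm]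
      have h2 : ∀ t : ZMod p, ∑ w : Fin r → ZMod p,
        fib f (fun i => w i + c * (v i + t * β i)) = nstar f := by
        intro t
        exact Equiv.sum_comp (Equiv.addRight (fun i => c * (v i + t * β i))) (fib f)
      simp_rw [h2]
      simp [ZMod.card]
    simp_rw [this]
    simp [ZMod.card]
    ring
  have h1 : ((p ^ 2 * nstar f : ℕ) : ℝ) ≤
      ∑ w : Fin r → ZMod p, ((p : ℝ) ^ 2 + 9 * d ^ 2 * √p * p + 4 * d ^ 3 * p + d * p) := by
    rw [← key, Nat.cast_sum]
    exact Finset.sum_le_sum (fun w _ => plane_count hd H hdp w v β hN)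
  rw [Finset.sum_const, Finset.card_univ, Fintype.card_fun, Fintype.card_fin, ZMod.card, nsmul_eq_mul] at h1
  push_cast at h1
  have hp0 : (0 : ℝ) < p := by exact_mod_cast hpp.pos
  set q := √(p : ℝ) with hq
  have hq0 : 0 < q := Real.sqrt_pos.2 hp0
  have hqq : q * q = p := Real.mul_self_sqrt hp0.le
  have hd1 : (1 : ℝ) ≤ d := by exact_mod_cast hd
  have hq10 : 10 * (d : ℝ) ^ 2 ≤ q := by
    rw [hq]
    apply Real.le_sqrt_of_sq_le
    have : (100 * (d : ℝ) ^ 4) ≤ p := by exact_mod_cast hdp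
    nlinarith
  have h2 : (p : ℝ) ^ 2 + 9 * d ^ 2 * q * p + 4 * d ^ 3 * p + d * p ≤ p ^ 2 * (1 + 10 * d ^ 2 / q) := by
    have e1 : (p : ℝ) ^ 2 * (1 + 10 * d ^ 2 / q) = p ^ 2 + 10 * d ^ 2 * q * p := by
      field_simp
      rw [← hqq]; ring
    rw [e1]
    have e2 : 4 * (d : ℝ) ^ 3 + d ≤ d ^ 2 * q := by
      have : (d : ℝ) ^ 2 * (10 * d ^ 2) ≤ d ^ 2 * q := by gcongr
      have e3 : (d : ℝ) ^ 3 ≤ d ^ 4 := pow_le_pow_right₀ hd1 (by norm_num)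
      have e4 : (d : ℝ) ≤ d ^ 4 := le_self_pow₀ hd1 (by norm_num)
      nlinarith
    have := mul_le_mul_of_nonneg_right e2 hp0.le
    linarith
  have h3 := h1.trans (mul_le_mul_of_nonneg_left h2 (by positivity : (0 : ℝ) ≤ (p : ℝ) ^ r))
  have hp2 : (0 : ℝ) < (p : ℝ) ^ 2 := by positivity
  rw [show (p : ℝ) ^ r * (p ^ 2 * (1 + 10 * d ^ 2 / q)) = p ^ 2 * (p ^ r * (1 + 10 * d ^ 2 / q)) by ring] at h3
  exact le_of_mul_le_mul_left h3 hp2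

end count
end AuxPoly

end

section

open MvPolynomial

namespace AuxPoly
set_option linter.unusedSectionVars false

section localexp
variable {r : ℕ} (p : ℕ) [Fact p.Prime]

/-- reduction to one variable mod p -/
noncomputable def psi : MvPolynomial (Fin (r + 1)) ℤ →+* Polynomial (ZMod p) :=
  eval₂Hom (Int.castRingHom (Polynomial (ZMod p))) (Fin.cons Polynomial.X (fun _ => 0))

noncomputable def Jid (r : ℕ) : Ideal (MvPolynomial (Fin (r + 1)) ℤ) :=
  Ideal.span ({C (p : ℤ)} ∪ Set.range (fun i : Fin r => X i.succ))

theorem Jp : (C (p : ℤ) : MvPolynomial (Fin (r + 1)) ℤ) ∈ Jid p r :=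
  Ideal.subset_span (Or.inl rfl)

theorem JX (i : Fin r) : (X i.succ : MvPolynomial (Fin (r + 1)) ℤ) ∈ Jid p r :=
  Ideal.subset_span (Or.inr ⟨i, rfl⟩)

theorem exists_uni (q : MvPolynomial (Fin (r + 1)) ℤ) :
    ∃ P : Polynomial ℤ, q - Polynomial.aeval (X 0) P ∈ Jid p r := by
  induction q using MvPolynomial.induction_on with
  | C a =>
    refine ⟨Polynomial.C a, ?_⟩
    rw [Polynomial.aeval_C]
    simp
  | add a b ha hb =>
    obtain ⟨P, hP⟩ := ha
    obtain ⟨Q, hQ⟩ := hb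
    refine ⟨P + Q, ?_⟩
    rw [map_add]
    convert add_mem hP hQ using 1
    ring
  | mul_X a i ha =>
    obtain ⟨P, hP⟩ := ha
    refine Fin.cases ?_ (fun i => ?_) i
    · refine ⟨P * Polynomial.X, ?_⟩
      rw [map_mul, Polynomial.aeval_X, ← sub_mul]
      exact Ideal.mul_mem_right _ _ hP
    · refine ⟨0, ?_⟩
      rw [map_zero, sub_zero]
      exact Ideal.mul_mem_left _ _ (JX p i)

theorem psi_uni (P : Polynomial ℤ) :
    psi (r := r) p (Polynomial.aeval (X 0) P) = P.map (Int.castRingHom (ZMod p)) := by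
  induction P using Polynomial.induction_on' with
  | add a b ha hb => rw [map_add, map_add, ha, hb, Polynomial.map_add]
  | monomial n a =>
    rw [Polynomial.aeval_monomial, map_mul, map_pow]
    simp [psi]
    rw [← Polynomial.C_mul_X_pow_eq_monomial]
    simp

theorem J_le_ker : Jid p r ≤ RingHom.ker (psi (r := r) p) := by
  rw [Jid, Ideal.span_le]
  rintro x (rfl | ⟨i, rfl⟩)
  · simp [psi, RingHom.mem_ker]
  · simp [psi, RingHom.mem_ker]

theorem ker_psi {q : MvPolynomial (Fin (r + 1)) ℤ} (h : psi p q = 0) : q ∈ Jid p r := by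
  obtain ⟨P, hP⟩ := exists_uni p q
  have h1 := J_le_ker p hP
  rw [RingHom.mem_ker, map_sub, h, psi_uni, zero_sub, neg_eq_zero] at h1
  have h2 : Polynomial.C (p : ℤ) ∣ P := by
    rw [Polynomial.C_dvd_iff_dvd_coeff]
    intro i
    have := congrArg (fun q => q.coeff i) h1
    simp only [Polynomial.coeff_map, Polynomial.coeff_zero, eq_intCast] at this
    rwa [ZMod.intCast_zmod_eq_zero_iff_dvd] at this
  obtain ⟨Q, rfl⟩ := h2
  have : q = (q - Polynomial.aeval (X 0) (Polynomial.C (p : ℤ) * Q)) +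
    C (p : ℤ) * Polynomial.aeval (X 0) Q := by
    rw [map_mul, Polynomial.aeval_C]
    simp
  rw [this]
  exact add_mem hP (Ideal.mul_mem_right _ _ (Jp p))

/-- polynomials vanishing mod p^E on points of the zero set of F divisible by p -/
noncomputable def Nid (E : ℕ) (F : MvPolynomial (Fin (r + 1)) ℤ) : Ideal (MvPolynomial (Fin (r + 1)) ℤ) where
  carrier := {q | ∀ z : Fin (r + 1) → ℤ, (∀ i, (p : ℤ) ∣ z i) → eval z F = 0 → (p : ℤ) ^ E ∣ eval z q}
  zero_mem' := by intro z _ _; simp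
  add_mem' ha hb := by
    intro z h1 h2
    rw [map_add]
    exact dvd_add (ha z h1 h2) (hb z h1 h2)
  smul_mem' c x hx := by
    intro z h1 h2
    rw [smul_eq_mul, map_mul]
    exact Dvd.dvd.mul_left (hx z h1 h2) _

theorem mem_Nid {E : ℕ} {F q : MvPolynomial (Fin (r + 1)) ℤ} : q ∈ Nid p E F ↔
    ∀ z : Fin (r + 1) → ℤ, (∀ i, (p : ℤ) ∣ z i) → eval z F = 0 → (p : ℤ) ^ E ∣ eval z q := Iff.rfl

theorem psi_surj : Function.Surjective (psi (r := r) p) := by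
  intro P
  obtain ⟨Q, hQ⟩ := Polynomial.map_surjective (Int.castRingHom (ZMod p))
    (ZMod.ringHom_surjective _) P
  exact ⟨_, (psi_uni p Q).trans hQ⟩

variable {p}
theorem X0pow_mem {E e : ℕ} {F : MvPolynomial (Fin (r + 1)) ℤ} {v : Polynomial (ZMod p)}
    (h : psi p F = Polynomial.X ^ e * v) (hv : v.coeff 0 ≠ 0) :
    (X 0 ^ e : MvPolynomial (Fin (r + 1)) ℤ) ∈ Jid p r ⊔ Nid p E F := by
  have hc : IsCoprime v (Polynomial.X ^ E) := by
    apply IsCoprime.pow_right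
    rw [isCoprime_comm, Polynomial.irreducible_X.coprime_iff_not_dvd, Polynomial.X_dvd_iff]
    exact hv
  obtain ⟨w, t, hwt⟩ := hc
  obtain ⟨w', hw'⟩ := psi_surj (r := r) p w
  obtain ⟨t', ht'⟩ := psi_surj (r := r) p t
  have h0 : psi (r := r) p (X 0) = Polynomial.X := by simp [psi]
  have h1 : (X 0 ^ e - (w' * F + t' * X 0 ^ e * X 0 ^ E) : MvPolynomial (Fin (r + 1)) ℤ) ∈ Jid p r := by
    apply ker_psi
    rw [map_sub, map_add, map_mul, map_mul, map_mul, map_pow, map_pow, h0, h, hw', ht']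
    linear_combination -Polynomial.X ^ e * hwt
  have h2 : (w' * F + t' * X 0 ^ e * X 0 ^ E : MvPolynomial (Fin (r + 1)) ℤ) ∈ Nid p E F := by
    apply add_mem
    · apply Ideal.mul_mem_left
      intro z _ hz
      rw [hz]; exact dvd_zero _
    · apply Ideal.mul_mem_left
      intro z hz _
      rw [map_pow, eval_X]
      exact pow_dvd_pow_of_dvd (hz 0) _
  have := Submodule.add_mem_sup h1 h2
  rwa [sub_add_cancel] at this

theorem decomp {E e : ℕ} {F : MvPolynomial (Fin (r + 1)) ℤ} {v : Polynomial (ZMod p)}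
    (h : psi p F = Polynomial.X ^ e * v) (hv : v.coeff 0 ≠ 0) (q : MvPolynomial (Fin (r + 1)) ℤ) :
    ∃ c : ℕ → ℤ, ∃ y ∈ Jid p r, ∃ ν ∈ Nid p E F,
      q = ∑ j ∈ Finset.range e, c j • (X 0 ^ j : MvPolynomial (Fin (r + 1)) ℤ) + y + ν := by
  obtain ⟨P, hP⟩ := exists_uni p q
  have h1 : q - ∑ j ∈ Finset.range e, P.coeff j • (X 0 ^ j : MvPolynomial (Fin (r + 1)) ℤ) ∈
      Jid p r ⊔ Nid p E F := by
    have e1 := Polynomial.aeval_eq_sum_range' (p := P) (n := e + (P.natDegree + 1)) (by omega)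
      (X 0 : MvPolynomial (Fin (r + 1)) ℤ)
    rw [Finset.sum_range_add] at e1
    have : q - ∑ j ∈ Finset.range e, P.coeff j • (X 0 ^ j : MvPolynomial (Fin (r + 1)) ℤ) =
      (q - Polynomial.aeval (X 0) P) +
        ∑ j ∈ Finset.range (P.natDegree + 1), P.coeff (e + j) • (X 0 ^ (e + j) : MvPolynomial (Fin (r + 1)) ℤ) := by
      rw [e1]; ring
    rw [this]
    apply add_mem (Ideal.mem_sup_left hP)
    apply sum_mem
    intro j _
    apply zsmul_mem
    rw [pow_add]
    exact Ideal.mul_mem_right _ _ (X0pow_mem h hv)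
  obtain ⟨y, hy, ν, hν, hyν⟩ := Submodule.mem_sup.1 h1
  exact ⟨_, y, hy, ν, hν, by rw [add_assoc, hyν]; ring⟩

noncomputable def tail (γ : Fin r → ℕ) : MvPolynomial (Fin (r + 1)) ℤ := ∏ i, X i.succ ^ γ i

noncomputable def mon0 (E e : ℕ) (jγ : Fin e × (Fin r → Fin E)) : MvPolynomial (Fin (r + 1)) ℤ :=
  tail (fun i => (jγ.2 i : ℕ)) * X 0 ^ (jγ.1 : ℕ)

theorem tail_dvd (γ : Fin r → ℕ) (z : Fin (r + 1) → ℤ) (hz : ∀ i, (p : ℤ) ∣ z i) :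
    (p : ℤ) ^ (∑ i, γ i) ∣ eval z (tail γ) := by
  rw [tail, map_prod, ← Finset.prod_pow_eq_pow_sum]
  apply Finset.prod_dvd_prod_of_dvd
  intro i _
  rw [map_pow, eval_X]
  exact pow_dvd_pow_of_dvd (hz _) _

theorem local_mem {E e : ℕ} {F : MvPolynomial (Fin (r + 1)) ℤ} {v : Polynomial (ZMod p)}
    (h : psi p F = Polynomial.X ^ e * v) (hv : v.coeff 0 ≠ 0) (t : ℕ) :
    ∀ (a : ℕ) (γ : Fin r → ℕ) (q : MvPolynomial (Fin (r + 1)) ℤ), E ≤ a + ∑ i, γ i + t →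
      C (p : ℤ) ^ a * tail γ * q ∈
        Submodule.span ℤ (Set.range (mon0 (r := r) E e)) ⊔ (Nid p E F).restrictScalars ℤ := by
  induction t with
  | zero =>
    intro a γ q hE
    apply Submodule.mem_sup_right
    rw [Submodule.restrictScalars_mem]
    apply Ideal.mul_mem_right
    intro z hz _
    rw [map_mul, map_pow, eval_C]
    refine (pow_dvd_pow _ hE).trans ?_
    rw [add_zero, pow_add]
    exact mul_dvd_mul_left _ (tail_dvd γ z hz)
  | succ t ih =>
    intro a γ q hE
    by_cases hlt : E ≤ a + ∑ i, γ i + t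
    · exact ih a γ q hlt
    obtain ⟨c, y, hy, ν, hν, hq⟩ := decomp (E := E) h hv q
    rw [hq, mul_add, mul_add]
    refine add_mem (add_mem ?_ ?_) ?_
    · rw [Finset.mul_sum]
      apply sum_mem
      intro j hj
      apply Submodule.mem_sup_left
      have hγ : ∀ i, γ i < E := by
        intro i
        have := Finset.single_le_sum (f := γ) (fun i _ => Nat.zero_le _) (Finset.mem_univ i)
        omega
      have : C (p : ℤ) ^ a * tail γ * c j • (X 0 ^ j : MvPolynomial (Fin (r + 1)) ℤ) =
        ((p : ℤ) ^ a * c j) • mon0 E e (⟨j, Finset.mem_range.1 hj⟩, fun i => ⟨γ i, hγ i⟩) := by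
        simp only [mon0, zsmul_eq_mul]
        push_cast
        simp
        ring
      rw [this]
      exact Submodule.smul_mem _ _ (Submodule.subset_span ⟨_, rfl⟩)
    · have : ∀ b : MvPolynomial (Fin (r + 1)) ℤ, C (p : ℤ) ^ a * tail γ * (b * y) ∈
        Submodule.span ℤ (Set.range (mon0 (r := r) E e)) ⊔ (Nid p E F).restrictScalars ℤ := by
        clear hq
        unfold Jid at hy
        induction hy using Submodule.span_induction with
        | mem x hx =>
          intro b
          rcases hx with hx | ⟨i, rfl⟩
          · rw [Set.mem_singleton_iff] at hx
            have := ih (a + 1) γ b (by omega)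
            convert this using 1
            rw [hx]; ring
          · have := ih a (γ + Pi.single i 1) b (by
              simp only [Pi.add_apply, Finset.sum_add_distrib, Finset.sum_pi_single', Finset.mem_univ, if_true]
              have : ∑ x, (Pi.single i 1 : Fin r → ℕ) x = 1 := by simp
              omega)
            convert this using 1
            have e2 : (tail (γ + Pi.single i 1) : MvPolynomial (Fin (r + 1)) ℤ) = tail γ * X i.succ := by
              simp only [tail, Pi.add_apply, pow_add, Finset.prod_mul_distrib]
              congr 1
              rw [Finset.prod_eq_single i]
              · simp
              · intro j _ hj; simp [hj]
              · simp
            rw [e2]; ring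
        | zero => intro b; simp
        | add x y _ _ hx hy => intro b; rw [mul_add, mul_add]; exact add_mem (hx b) (hy b)
        | smul c x _ hx => intro b; rw [smul_eq_mul, ← mul_assoc b]; exact hx _
      simpa using this 1
    · apply Submodule.mem_sup_right
      rw [Submodule.restrictScalars_mem]
      exact Ideal.mul_mem_left _ _ hν

theorem local_exp {E e : ℕ} {F : MvPolynomial (Fin (r + 1)) ℤ} {v : Polynomial (ZMod p)}
    (h : psi p F = Polynomial.X ^ e * v) (hv : v.coeff 0 ≠ 0) (q : MvPolynomial (Fin (r + 1)) ℤ) :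
    ∃ c : Fin e × (Fin r → Fin E) → ℤ, ∀ z : Fin (r + 1) → ℤ, (∀ i, (p : ℤ) ∣ z i) → eval z F = 0 →
      (p : ℤ) ^ E ∣ eval z q - ∑ g, eval z (mon0 E e g) * c g := by
  have h1 := local_mem (E := E) h hv E 0 (fun _ => 0) q (by omega)
  have e1 : (C (p : ℤ) ^ 0 * tail (fun _ => 0) * q : MvPolynomial (Fin (r + 1)) ℤ) = q := by simp [tail]
  rw [e1, Submodule.mem_sup] at h1
  obtain ⟨y, hy, ν, hν, hq⟩ := h1
  rw [Submodule.mem_span_range_iff_exists_fun] at hy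
  obtain ⟨c, hc⟩ := hy
  refine ⟨c, fun z hz hF => ?_⟩
  have := hν z hz hF
  convert this using 1
  rw [← hq, ← hc, map_add, map_sum]
  have : ∀ g, eval z (c g • mon0 E e g) = eval z (mon0 E e g) * c g := by
    intro g
    rw [zsmul_eq_mul, map_mul, map_intCast, mul_comm]; rfl
  simp_rw [this]
  ring

end localexp
end AuxPoly

end

section

open MvPolynomial

namespace AuxPoly
set_option linter.unusedSectionVars false

theorem sum_tr (E r k : ℕ) : ∑ γ : Fin r → Fin E, (k - ∑ i, (γ i : ℕ)) ≤ (k + r).choose (r + 1) := by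
  induction r generalizing k with
  | zero => simp
  | succ r ih =>
    rw [← (Fin.consEquiv (fun _ : Fin (r + 1) => Fin E)).sum_comp, Fintype.sum_prod_type]
    have : ∀ a : Fin E, ∑ γ : Fin r → Fin E,
        (k - ∑ i, (((Fin.consEquiv (fun _ : Fin (r + 1) => Fin E)) (a, γ) i : Fin E) : ℕ)) ≤
        (k - a + r).choose (r + 1) := by
      intro a
      refine le_trans (le_of_eq ?_) (ih (k - a))
      refine Finset.sum_congr rfl (fun γ _ => ?_)
      rw [Fin.sum_univ_succ]
      simp [Fin.consEquiv]
      omega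
    refine (Finset.sum_le_sum (fun a _ => this a)).trans ?_
    rw [Fin.sum_univ_eq_sum_range (fun a => (k - a + r).choose (r + 1)) E]
    clear this ih
    induction E generalizing k with
    | zero => simp
    | succ E ih =>
      rw [Finset.sum_range_succ']
      cases k with
      | zero => simp
      | succ k =>
        have h1 := ih k
        have h2 : ∀ i, k + 1 - (i + 1) = k - i := fun i => by omega
        simp_rw [h2]
        have h3 : (k + 1 + (r + 1)).choose (r + 1 + 1) = (k + (r + 1)).choose (r + 1) +
          (k + (r + 1)).choose (r + 1 + 1) := by
          rw [show k + 1 + (r + 1) = (k + (r + 1)) + 1 by ring, Nat.choose_succ_succ]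
        rw [h3, show k + 1 - 0 + r = k + (r + 1) by omega]
        omega

theorem det_mul_expand {ι G R : Type*} [Fintype ι] [DecidableEq ι] [Fintype G] [CommRing R]
    (U : Matrix ι G R) (V : Matrix G ι R) :
    (U * V).det = ∑ φ : ι → G, (∏ i, U i (φ i)) * (Matrix.of (fun i j => V (φ i) j)).det := by
  classical
  have h := (Matrix.detRowAlternating (R := R) (n := ι)).toMultilinearMap.map_sum
    (fun i (g : G) => U i g • V g)
  have h1 : (fun i => ∑ g, U i g • V g) = U * V := by
    funext i j
    simp [Matrix.mul_apply]
  have h2 : Matrix.det (U * V) = ∑ φ : ι → G, Matrix.det (fun i => U i (φ i) • V (φ i)) := by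
    rw [← h1]; exact h
  rw [h2]
  refine Finset.sum_congr rfl (fun φ _ => ?_)
  exact Matrix.det_mul_column (fun i => U i (φ i)) (Matrix.of (fun i j => V (φ i) j))

variable {r d p : ℕ} [Fact p.Prime]

theorem psi_C (c : ℤ) : psi (r := r) p (C c) = (c : Polynomial (ZMod p)) := by
  rw [psi, coe_eval₂Hom, eval₂_C]; rfl

theorem psi_trans (f : MvPolynomial (Fin (r + 1)) ℤ) (a : Fin (r + 1) → ℤ) :
    psi p (aeval (fun i => X i + C (a i)) f) =
      (sec (map (Int.castRingHom (ZMod p)) f) (fun i => (a i.succ : ZMod p))).comp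
        (Polynomial.X + Polynomial.C (a 0 : ZMod p)) := by
  induction f using MvPolynomial.induction_on with
  | C c => rw [map_C, sec_C]; simp [psi]
  | add f g hf hg => rw [map_add, map_add, map_add, sec_add, Polynomial.add_comp, hf, hg]
  | mul_X f i hf =>
    rw [map_mul, map_mul, map_mul, sec_mul, Polynomial.mul_comp, hf]
    congr 1
    refine Fin.cases ?_ (fun i => ?_) i
    · rw [map_X, sec_X_zero, aeval_X, map_add, psi_C]; simp [psi]
    · rw [map_X, sec_X_succ, aeval_X, map_add, psi_C]; simp [psi]

/-- multiplicity -/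
noncomputable def mult (f : MvPolynomial (Fin (r + 1)) ℤ) (P : (Fin r → ZMod p) × ZMod p) : ℕ :=
  (sec (map (Int.castRingHom (ZMod p)) f) P.1).rootMultiplicity P.2

/-- lift of a point -/
def lft (P : (Fin r → ZMod p) × ZMod p) : Fin (r + 1) → ℤ :=
  Fin.cons (P.2.val : ℤ) (fun i => ((P.1 i).val : ℤ))

theorem class_exp {f : MvPolynomial (Fin (r + 1)) ℤ} (H : Reg d (map (Int.castRingHom (ZMod p)) f))
    (E : ℕ) (P : (Fin r → ZMod p) × ZMod p) (q : MvPolynomial (Fin (r + 1)) ℤ) :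
    ∃ c : Fin (mult f P) × (Fin r → Fin E) → ℤ, ∀ x : Fin (r + 1) → ℤ, eval x f = 0 →
      (x 0 : ZMod p) = P.2 → (∀ i, (x (Fin.succ i) : ZMod p) = P.1 i) →
      (p : ℤ) ^ E ∣ eval x q - ∑ g, eval (x - lft P) (mon0 E (mult f P) g) * c g := by
  set F := aeval (fun i => X i + C (lft P i)) f with hF
  have h1 : psi p F = (sec (map (Int.castRingHom (ZMod p)) f) P.1).comp
        (Polynomial.X + Polynomial.C P.2) := by
    rw [hF, psi_trans]
    simp [lft]
  obtain ⟨v, hv1, hv2⟩ := Polynomial.exists_eq_pow_rootMultiplicity_mul_and_not_dvd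
    (sec (map (Int.castRingHom (ZMod p)) f) P.1) (H.sec_ne_zero _) P.2
  have h2 : psi p F = Polynomial.X ^ (mult f P) * v.comp (Polynomial.X + Polynomial.C P.2) := by
    rw [h1]
    conv_lhs => rw [hv1]
    rw [Polynomial.mul_comp, Polynomial.pow_comp]
    congr 2
    simp
  have h3 : (v.comp (Polynomial.X + Polynomial.C P.2)).coeff 0 ≠ 0 := by
    rw [Polynomial.coeff_zero_eq_eval_zero, Polynomial.eval_comp]
    intro h
    apply hv2
    rw [Polynomial.dvd_iff_isRoot, Polynomial.IsRoot]
    simpa using h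
  obtain ⟨c, hc⟩ := local_exp (E := E) h2 h3 (aeval (fun i => X i + C (lft P i)) q)
  have hev : ∀ (g : MvPolynomial (Fin (r + 1)) ℤ) (x : Fin (r + 1) → ℤ),
      eval (x - lft P) (aeval (fun i => X i + C (lft P i)) g) = eval x g := by
    intro g x
    have := comp_aeval_apply (fun i => X i + C (lft P i)) (aeval (x - lft P) : MvPolynomial (Fin (r+1)) ℤ →ₐ[ℤ] ℤ) g
    rw [← coe_aeval_eq_eval, ← coe_aeval_eq_eval]
    simp only [RingHom.coe_coe]
    rw [this]
    congr 2
    funext i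
    simp
  refine ⟨c, fun x hx h0 hi => ?_⟩
  have := hc (x - lft P) ?_ ?_
  · rwa [hev] at this
  · intro i
    rw [← ZMod.intCast_zmod_eq_zero_iff_dvd]
    refine Fin.cases ?_ (fun i => ?_) i
    · simp [lft, h0]
    · simp [lft, hi]
  · rw [hev, hx]

theorem pdet_dvd {f : MvPolynomial (Fin (r + 1)) ℤ} (H : Reg d (map (Int.castRingHom (ZMod p)) f))
    {ι : Type*} [Fintype ι] [DecidableEq ι] (x : ι → Fin (r + 1) → ℤ) (hx : ∀ i, eval (x i) f = 0)
    (q : ι → MvPolynomial (Fin (r + 1)) ℤ) (k : ℕ) :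
    (p : ℤ) ^ (k * Fintype.card ι - nstar (map (Int.castRingHom (ZMod p)) f) * (k + r).choose (r + 1)) ∣
      (Matrix.of (fun i j => eval (x i) (q j))).det := by
  classical
  set E := k * Fintype.card ι - nstar (map (Int.castRingHom (ZMod p)) f) * (k + r).choose (r + 1) with hE
  choose c hc using fun P j => class_exp H E P (q j)
  let 𝒢 := Σ P : (Fin r → ZMod p) × ZMod p, Fin (mult f P) × (Fin r → Fin E)
  let cl : ι → (Fin r → ZMod p) × ZMod p := fun i => (fun j => (x i (Fin.succ j) : ZMod p), (x i 0 : ZMod p))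
  let U : Matrix ι 𝒢 ℤ := fun i g => if g.1 = cl i then eval (x i - lft g.1) (mon0 E (mult f g.1) g.2) else 0
  let V : Matrix 𝒢 ι ℤ := fun g j => c g.1 j g.2
  have hUV : ∀ i j, (U * V) i j = ∑ g, eval (x i - lft (cl i)) (mon0 E (mult f (cl i)) g) * c (cl i) j g := by
    intro i j
    rw [Matrix.mul_apply, Fintype.sum_sigma, Finset.sum_eq_single (cl i)]
    · simp [U, V]
    · intro P _ hP
      apply Finset.sum_eq_zero
      intro g _
      simp [U, hP]
    · simp
  have hcong : (p : ℤ) ^ E ∣ (Matrix.of (fun i j => eval (x i) (q j))).det - (U * V).det := by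
    have key : ((Matrix.of (fun i j => eval (x i) (q j))).det : ZMod (p ^ E)) = ((U * V).det : ZMod (p ^ E)) := by
      rw [Int.cast_det, Int.cast_det]
      congr 1
      ext i j
      have := hc (cl i) j (x i) (hx i) rfl (fun _ => rfl)
      rw [← hUV] at this
      rw [← sub_eq_zero]
      simp only [Matrix.map_apply, Matrix.of_apply]
      have h2 := (ZMod.intCast_zmod_eq_zero_iff_dvd (eval (x i) (q j) - (U * V) i j) (p ^ E)).2 (by exact_mod_cast this)
      rw [← h2]; push_cast; rfl
    rw [← sub_eq_zero, ← Int.cast_sub, ZMod.intCast_zmod_eq_zero_iff_dvd] at key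
    exact_mod_cast key
  have hdet : (p : ℤ) ^ E ∣ (U * V).det := by
    rw [det_mul_expand]
    apply Finset.dvd_sum
    intro φ _
    by_cases hinj : Function.Injective φ
    · apply Dvd.dvd.mul_right
      have hU : (p : ℤ) ^ (∑ i, ∑ j, (((φ i).2.2 j : Fin E) : ℕ)) ∣ ∏ i, U i (φ i) := by
        rw [← Finset.prod_pow_eq_pow_sum]
        apply Finset.prod_dvd_prod_of_dvd
        intro i _
        simp only [U]
        split_ifs with hcl
        · rw [mon0, map_mul]
          apply Dvd.dvd.mul_right
          apply tail_dvd
          intro l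
          rw [← ZMod.intCast_zmod_eq_zero_iff_dvd]
          rw [hcl]
          refine Fin.cases ?_ (fun i => ?_) l
          · simp [lft, cl]
          · simp [lft, cl]
        · exact dvd_zero _
      refine (pow_dvd_pow _ ?_).trans hU
      have w1 : k * Fintype.card ι ≤ ∑ i, ∑ j, (((φ i).2.2 j : Fin E) : ℕ) +
          ∑ i, (k - ∑ j, (((φ i).2.2 j : Fin E) : ℕ)) := by
        rw [← Finset.sum_add_distrib, mul_comm, ← smul_eq_mul, ← Finset.card_univ, ← Finset.sum_const]
        exact Finset.sum_le_sum (fun i _ => by omega)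
      have w2 : ∑ i, (k - ∑ j, (((φ i).2.2 j : Fin E) : ℕ)) ≤ ∑ g : 𝒢, (k - ∑ j, ((g.2.2 j : Fin E) : ℕ)) := by
        rw [← Finset.sum_image (s := Finset.univ) (g := φ) (f := fun g : 𝒢 => (k - ∑ j, ((g.2.2 j : Fin E) : ℕ)))
          (fun a _ b _ h => hinj h)]
        exact Finset.sum_le_sum_of_subset (Finset.subset_univ _)
      have w3 : ∑ g : 𝒢, (k - ∑ j, ((g.2.2 j : Fin E) : ℕ)) ≤
          nstar (map (Int.castRingHom (ZMod p)) f) * (k + r).choose (r + 1) := by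
        rw [Fintype.sum_sigma]
        have : ∀ P : (Fin r → ZMod p) × ZMod p, ∑ g : Fin (mult f P) × (Fin r → Fin E),
            (k - ∑ j, ((g.2 j : Fin E) : ℕ)) ≤ mult f P * (k + r).choose (r + 1) := by
          intro P
          rw [Fintype.sum_prod_type]
          refine (Finset.sum_le_sum (fun a _ => sum_tr E r k)).trans ?_
          simp
        refine (Finset.sum_le_sum (fun P _ => this P)).trans ?_
        rw [← Finset.sum_mul, Fintype.sum_prod_type]
        exact le_of_eq rfl
      omega
    · have : (Matrix.of (fun i j => V (φ i) j)).det = 0 := by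
        rw [Function.Injective] at hinj
        push Not at hinj
        obtain ⟨a, b, hab, hne⟩ := hinj
        exact Matrix.det_zero_of_row_eq hne (by funext j; simp [hab])
      rw [this, mul_zero]
      exact dvd_zero _
  have := dvd_add hcong hdet
  rwa [sub_add_cancel] at this

end AuxPoly

end

section

open MvPolynomial

namespace AuxPoly
set_option linter.unusedSectionVars false

theorem split_inj {α β : Type*} [Fintype α] [Fintype β] (L : (α → ℤ) →ₗ[ℤ] (β → ℤ))
    (hL : Function.Injective L)
    (hs : ∀ (k : ℤ) (v : β → ℤ), k ≠ 0 → k • v ∈ LinearMap.range L → v ∈ LinearMap.range L) :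
    ∃ W : (β → ℤ) →ₗ[ℤ] (α → ℤ), W ∘ₗ L = LinearMap.id := by
  set N := LinearMap.range L
  have htf : Module.IsTorsionFree ℤ ((β → ℤ) ⧸ N) := by
    refine ⟨fun k hk => ?_⟩
    have hk0 : k ≠ 0 := hk.ne_zero
    intro a b hab
    obtain ⟨a, rfl⟩ := N.mkQ_surjective a
    obtain ⟨b, rfl⟩ := N.mkQ_surjective b
    simp only [← map_smul] at hab
    rw [← sub_eq_zero, ← map_sub, ← smul_sub, Submodule.mkQ_apply, Submodule.Quotient.mk_eq_zero] at hab
    rw [← sub_eq_zero, ← map_sub, Submodule.mkQ_apply, Submodule.Quotient.mk_eq_zero]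
    exact hs k _ hk0 hab
  obtain ⟨s, hsec⟩ := Module.projective_lifting_property N.mkQ (LinearMap.id) N.mkQ_surjective
  have hmem : ∀ v, (LinearMap.id - s ∘ₗ N.mkQ : (β → ℤ) →ₗ[ℤ] (β → ℤ)) v ∈ N := by
    intro v
    rw [← Submodule.Quotient.mk_eq_zero, ← Submodule.mkQ_apply]
    have := congrArg (fun g => g (N.mkQ v)) hsec
    simp only [LinearMap.comp_apply, LinearMap.id_apply] at this
    simp only [LinearMap.sub_apply, LinearMap.id_apply, LinearMap.comp_apply, map_sub, this, sub_self]
  refine ⟨(LinearEquiv.ofInjective L hL).symm.toLinearMap ∘ₗ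
    LinearMap.codRestrict N (LinearMap.id - s ∘ₗ N.mkQ) hmem, ?_⟩
  apply LinearMap.ext
  intro w
  rw [LinearMap.comp_apply, LinearMap.comp_apply, LinearEquiv.coe_coe, LinearEquiv.symm_apply_eq]
  apply Subtype.ext
  have : N.mkQ (L w) = 0 := by
    rw [Submodule.mkQ_apply, Submodule.Quotient.mk_eq_zero]; exact ⟨w, rfl⟩
  simp [this]

theorem prim_relPrime {σ : Type*} {f : MvPolynomial σ ℤ} (hf : Finset.gcd f.support f.coeff = 1)
    {k : ℤ} (hk : k ≠ 0) : IsRelPrime (C k) f := by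
  intro g h1 h2
  rw [dvd_C_iff_exists hk] at h1
  obtain ⟨c, -, rfl⟩ := h1
  rw [C_dvd_iff_dvd_coeff] at h2
  have : c ∣ 1 := by
    rw [← hf]
    exact Finset.dvd_gcd (fun m _ => h2 m)
  exact (isUnit_of_dvd_one this).map C

/-- monomials of degree at most D -/
abbrev TT (n D : ℕ) := {m : Fin n →₀ ℕ // m.degree ≤ D}

noncomputable instance (n D : ℕ) : Fintype (TT n D) := (Finsupp.finite_of_degree_le D).fintype

abbrev JJ (r d D : ℕ) := {m : TT (r + 1) D // m.1 0 < d}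

noncomputable instance (r d D : ℕ) : Fintype (JJ r d D) := Fintype.ofFinite _

section pol
variable {n D : ℕ} {R : Type*} [CommRing R]

noncomputable def pol (v : TT n D → R) : MvPolynomial (Fin n) R := ∑ m, monomial m.1 (v m)

theorem coeff_pol (v : TT n D → R) (m : TT n D) : (pol v).coeff m.1 = v m := by
  classical
  rw [pol, coeff_sum, Finset.sum_eq_single m]
  · simp
  · intro m' _ h
    rw [coeff_monomial, if_neg]
    exact fun h' => h (Subtype.ext h')
  · simp

theorem coeff_pol_zero (v : TT n D → R) (m : Fin n →₀ ℕ) (hm : ¬ m.degree ≤ D) : (pol v).coeff m = 0 := by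
  classical
  rw [pol, coeff_sum]
  apply Finset.sum_eq_zero
  intro m' _
  rw [coeff_monomial, if_neg]
  rintro rfl
  exact hm m'.2

theorem pol_totalDegree (v : TT n D → R) : (pol v).totalDegree ≤ D := by
  rw [pol]
  refine totalDegree_finsetSum_le (fun m _ => ?_)
  refine (totalDegree_monomial_le _ _).trans ?_
  exact m.2

theorem pol_coeff {q : MvPolynomial (Fin n) R} (hq : q.totalDegree ≤ D) :
    pol (fun m : TT n D => q.coeff m.1) = q := by
  ext m
  by_cases hm : m.degree ≤ D
  · exact coeff_pol _ ⟨m, hm⟩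
  · rw [coeff_pol_zero _ _ hm]
    symm
    by_contra h
    apply hm
    exact (le_totalDegree (mem_support_iff.2 h)).trans hq

theorem pol_smul (k : R) (v : TT n D → R) : pol (k • v) = C k * pol v := by
  ext m
  rw [coeff_C_mul]
  by_cases hm : m.degree ≤ D
  · rw [coeff_pol _ ⟨m, hm⟩, coeff_pol _ ⟨m, hm⟩]; rfl
  · rw [coeff_pol_zero _ _ hm, coeff_pol_zero _ _ hm, mul_zero]

theorem pol_add (v w : TT n D → R) : pol (v + w) = pol v + pol w := by
  simp [pol, Finset.sum_add_distrib]

theorem pol_inj : Function.Injective (pol : (TT n D → R) → _) := by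
  intro v w h
  funext m
  rw [← coeff_pol v, h, coeff_pol]

theorem eval_pol (x : Fin n → R) (v : TT n D → R) : eval x (pol v) = ∑ m, v m * eval x (monomial m.1 1) := by
  rw [pol, map_sum]
  refine Finset.sum_congr rfl (fun m _ => ?_)
  rw [eval_monomial, eval_monomial, one_mul]

end pol

section lattice
variable {r d D : ℕ}

/-- multiplication by f -/
noncomputable def mulf (f : MvPolynomial (Fin (r + 1)) ℤ) (D : ℕ) (D' : ℕ) :
    (TT (r + 1) D' → ℤ) →ₗ[ℤ] (TT (r + 1) D → ℤ) where
  toFun w m := (f * pol w).coeff m.1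
  map_add' v w := by
    funext m; rw [pol_add, mul_add, coeff_add]; rfl
  map_smul' k v := by
    funext m
    rw [pol_smul, mul_left_comm, coeff_C_mul]; rfl

theorem pol_mulf {f : MvPolynomial (Fin (r + 1)) ℤ} (hf : f.totalDegree ≤ d) (hD : d ≤ D)
    (w : TT (r + 1) (D - d) → ℤ) : pol (mulf f D (D - d) w) = f * pol w := by
  apply pol_coeff
  refine (totalDegree_mul _ _).trans ?_
  have := pol_totalDegree w
  omega

theorem mulf_split {f : MvPolynomial (Fin (r + 1)) ℤ} (H : Reg d f) (hD : d ≤ D)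
    (hprim : Finset.gcd f.support f.coeff = 1) :
    ∃ W : (TT (r + 1) D → ℤ) →ₗ[ℤ] (TT (r + 1) (D - d) → ℤ), W ∘ₗ mulf f D (D - d) = LinearMap.id := by
  apply split_inj
  · intro v w h
    have := congrArg pol h
    rw [pol_mulf H.1 hD, pol_mulf H.1 hD] at this
    exact pol_inj (mul_left_cancel₀ H.ne_zero this)
  · rintro k v hk ⟨w, hw⟩
    have h1 := congrArg pol hw
    rw [pol_mulf H.1 hD, pol_smul] at h1
    have h2 : C k ∣ pol w := (prim_relPrime hprim hk).dvd_of_dvd_mul_left ⟨_, h1⟩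
    have h3 : ∀ m, k ∣ w m := by
      intro m
      rw [← coeff_pol w]
      exact (C_dvd_iff_dvd_coeff _ _).1 h2 _
    choose u hu using h3
    refine ⟨u, ?_⟩
    apply pol_inj
    rw [pol_mulf H.1 hD]
    have h4 : pol w = C k * pol u := by
      rw [← pol_smul]; congr 1; funext m; exact hu m
    rw [h4, mul_left_comm] at h1
    have hCk : (C k : MvPolynomial (Fin (r + 1)) ℤ) ≠ 0 := by simpa using hk
    exact mul_left_cancel₀ hCk h1

noncomputable def sig (r : ℕ) {d D : ℕ} (hD : d ≤ D) : JJ r d D ⊕ TT (r + 1) (D - d) ≃ TT (r + 1) D :=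
  Equiv.ofBijective (Sum.elim (fun j => j.1) (fun m => ⟨m.1 + Finsupp.single 0 d, by
    have := m.2
    rw [map_add, Finsupp.degree_single]; omega⟩)) (by
    constructor
    · rintro (a | a) (b | b) h
      · simp only [Sum.elim_inl] at h; rw [Subtype.ext h]
      · exfalso
        have h0 := congrArg (fun m : TT (r + 1) D => m.1 0) h
        simp at h0
        have := a.2
        omega
      · exfalso
        have h0 := congrArg (fun m : TT (r + 1) D => m.1 0) h
        simp at h0
        have := b.2
        omega
      · simp only [Sum.elim_inr, Subtype.mk.injEq, add_left_inj] at h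
        rw [Subtype.ext h]
    · intro m
      by_cases hm : m.1 0 < d
      · exact ⟨Sum.inl ⟨m, hm⟩, rfl⟩
      · have hle : Finsupp.single 0 d ≤ m.1 := by
          rw [Finsupp.single_le_iff]; omega
        have e : m.1 - Finsupp.single 0 d + Finsupp.single 0 d = m.1 := tsub_add_cancel_of_le hle
        refine ⟨Sum.inr ⟨m.1 - Finsupp.single 0 d, ?_⟩, ?_⟩
        · have := congrArg Finsupp.degree e
          rw [map_add, Finsupp.degree_single] at this
          have := m.2
          omega
        · exact Subtype.ext e)

theorem sig_inl (hD : d ≤ D) (j : JJ r d D) : sig r hD (Sum.inl j) = j.1 := rfl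

theorem sig_inr (hD : d ≤ D) (m : TT (r + 1) (D - d)) :
    (sig r hD (Sum.inr m)).1 = m.1 + Finsupp.single 0 d := rfl

theorem tri_det {f : MvPolynomial (Fin (r + 1)) ℤ} (H : Reg d f) (D' : ℕ) [DecidableEq (TT (r + 1) D')] :
    (Matrix.of (fun m m' : TT (r + 1) D' =>
      (f * monomial m'.1 1).coeff (m.1 + Finsupp.single 0 d))).det =
      f.coeff (Finsupp.single 0 d) ^ Fintype.card (TT (r + 1) D') := by
  classical
  set M := Matrix.of (fun m m' : TT (r + 1) D' => (f * monomial m'.1 1).coeff (m.1 + Finsupp.single 0 d)) with hM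
  let key : TT (r + 1) D' → ℕ ×ₗ ℕ := fun m => toLex (m.1.degree, m.1 0)
  have h1 : ∀ m m', M m m' ≠ 0 → m'.1 ≤ m.1 + Finsupp.single 0 d ∧
      (m.1 + Finsupp.single 0 d - m'.1).degree ≤ d := by
    intro m m' h
    rw [hM, Matrix.of_apply, coeff_mul_monomial'] at h
    split_ifs at h with hle
    · refine ⟨hle, ?_⟩
      rw [mul_one] at h
      exact (le_totalDegree (mem_support_iff.2 h)).trans H.1
    · exact absurd rfl h
  have h2 : ∀ m m', M m m' ≠ 0 → key m < key m' ∨ m = m' := by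
    intro m m' h
    obtain ⟨a, b⟩ := h1 m m' h
    obtain ⟨u, hu⟩ := exists_add_of_le a
    rw [hu, add_tsub_cancel_left] at b
    have e1 := congrArg Finsupp.degree hu
    rw [map_add, map_add, Finsupp.degree_single] at e1
    have e2 := congrArg (fun w => w 0) hu
    simp only [Finsupp.add_apply, Finsupp.single_eq_same] at e2
    have e3 : u 0 ≤ u.degree := Finsupp.le_degree 0 u
    rcases lt_or_eq_of_le (show m.1.degree ≤ m'.1.degree by omega) with h3 | h3
    · left
      rw [Prod.Lex.lt_iff]; left; exact h3
    · rcases lt_or_eq_of_le (show m.1 0 ≤ m'.1 0 by omega) with h4 | h4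
      · left
        rw [Prod.Lex.lt_iff]; right; exact ⟨h3, h4⟩
      · right
        have hu' : u = Finsupp.single 0 d := by
          have hd1 : u.degree = d := by omega
          have hd0 : u 0 = d := by omega
          have hle : Finsupp.single 0 d ≤ u := by rw [Finsupp.single_le_iff]; omega
          obtain ⟨w, hw⟩ := exists_add_of_le hle
          have := congrArg Finsupp.degree hw
          rw [map_add, Finsupp.degree_single] at this
          have hw0 : w.degree = 0 := by omega
          rw [Finsupp.degree_eq_zero_iff] at hw0
          rw [hw, hw0, add_zero]
        rw [hu'] at hu
        exact Subtype.ext (add_right_cancel hu)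
  have htri : M.BlockTriangular key := by
    intro i j hij
    by_contra h
    rcases h2 i j h with h3 | h3
    · exact absurd hij (not_lt.2 h3.le)
    · rw [h3] at hij; exact lt_irrefl _ hij
  have hdiag : ∀ m, M m m = f.coeff (Finsupp.single 0 d) := by
    intro m
    rw [hM, Matrix.of_apply, add_comm m.1, coeff_mul_monomial, mul_one]
  rw [htri.det]
  have hb : ∀ a, (M.toSquareBlock key a).det = f.coeff (Finsupp.single 0 d) ^ (Finset.univ.filter (fun m => key m = a)).card := by
    intro a
    have : M.toSquareBlock key a = Matrix.diagonal (fun _ => f.coeff (Finsupp.single 0 d)) := by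
      ext i j
      rw [Matrix.toSquareBlock_def]
      by_cases hij : i = j
      · rw [hij, Matrix.diagonal_apply_eq]; exact hdiag _
      · rw [Matrix.diagonal_apply_ne _ hij]
        by_contra h
        rcases h2 _ _ h with h3 | h3
        · rw [i.2, j.2] at h3; exact lt_irrefl _ h3
        · exact hij (Subtype.ext h3)
    rw [this, Matrix.det_diagonal, Finset.prod_const, Finset.card_univ, Fintype.card_subtype]
  simp_rw [hb]
  rw [Finset.prod_pow_eq_pow_sum, ← Finset.card_eq_sum_card_image, Finset.card_univ]

theorem bR_dvd {f : MvPolynomial (Fin (r + 1)) ℤ} (H : Reg d f) (hD : d ≤ D)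
    (hprim : Finset.gcd f.support f.coeff = 1) [DecidableEq (JJ r d D)] (x : JJ r d D → Fin (r + 1) → ℤ)
    (hx : ∀ i, eval (x i) f = 0) :
    f.coeff (Finsupp.single 0 d) ^ Fintype.card (TT (r + 1) (D - d)) ∣
      (Matrix.of (fun i j : JJ r d D => eval (x i) (monomial j.1.1 1))).det := by
  classical
  obtain ⟨W, hW⟩ := mulf_split H hD hprim
  let A : Matrix (JJ r d D ⊕ TT (r + 1) (D - d)) (TT (r + 1) D) ℤ :=
    Matrix.fromRows (Matrix.of (fun i m => eval (x i) (monomial m.1 1))) (LinearMap.toMatrix' W)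
  let B : Matrix (TT (r + 1) D) (JJ r d D ⊕ TT (r + 1) (D - d)) ℤ :=
    Matrix.fromCols (Matrix.of (fun m j => if m = j.1 then 1 else 0)) (LinearMap.toMatrix' (mulf f D (D - d)))
  have hF : ∀ m m', LinearMap.toMatrix' (mulf f D (D - d)) m m' = (f * monomial m'.1 1).coeff m.1 := by
    intro m m'
    rw [LinearMap.toMatrix'_apply]
    have e : pol (fun j' : TT (r + 1) (D - d) => if j' = m' then (1 : ℤ) else 0) = monomial m'.1 1 := by
      rw [pol, Finset.sum_eq_single m']
      · simp
      · intro b _ hb; simp [hb]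
      · simp
    change (f * pol _).coeff m.1 = _
    rw [← e]
    congr 3
    funext j'
    simp [Pi.single_apply]
  have hAB : A * B = Matrix.fromBlocks (Matrix.of (fun i j : JJ r d D => eval (x i) (monomial j.1.1 1))) 0
      (LinearMap.toMatrix' W * (Matrix.of (fun (m : TT (r + 1) D) (j : JJ r d D) => if m = j.1 then (1 : ℤ) else 0))) 1 := by
    rw [Matrix.fromRows_mul_fromCols]
    congr 1
    · ext i j
      simp [Matrix.mul_apply]
    · ext i m'
      simp only [Matrix.mul_apply, Matrix.of_apply, Matrix.zero_apply]
      have h1 : eval (x i) (pol (mulf f D (D - d) (Pi.single m' 1))) = 0 := by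
        rw [pol_mulf H.1 hD, map_mul, hx, zero_mul]
      rw [eval_pol] at h1
      rw [← h1]
      refine Finset.sum_congr rfl (fun m _ => ?_)
      rw [LinearMap.toMatrix'_apply, mul_comm]
    · exact (by rw [← LinearMap.toMatrix'_comp, hW, LinearMap.toMatrix'_id])
  have hdet : (A.submatrix id (sig r hD) * B.submatrix (sig r hD) id).det =
      (Matrix.of (fun i j : JJ r d D => eval (x i) (monomial j.1.1 1))).det := by
    rw [Matrix.submatrix_mul_equiv, hAB, Matrix.submatrix_id_id, Matrix.det_fromBlocks_zero₁₂, Matrix.det_one, mul_one]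
  have hB : (B.submatrix (sig r hD) id).det = f.coeff (Finsupp.single 0 d) ^ Fintype.card (TT (r + 1) (D - d)) := by
    rw [← tri_det H (D - d)]
    have : B.submatrix (sig r hD) id = Matrix.fromBlocks 1
      (Matrix.of (fun (j : JJ r d D) (m' : TT (r + 1) (D - d)) => (f * monomial m'.1 1).coeff j.1.1)) 0
      (Matrix.of (fun m m' : TT (r + 1) (D - d) => (f * monomial m'.1 1).coeff (m.1 + Finsupp.single 0 d))) := by
      ext i j
      rcases i with i | i <;> rcases j with j | j
      · simp [B, sig_inl, Matrix.one_apply, Subtype.ext_iff]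
      · simp only [B, Matrix.submatrix_apply, id, Matrix.fromCols_apply_inr, hF, Matrix.fromBlocks_apply₁₂]; rfl
      · simp only [B, Matrix.submatrix_apply, id, Matrix.fromCols_apply_inl, Matrix.fromBlocks_apply₂₁, Matrix.of_apply, Matrix.zero_apply]
        rw [if_neg]
        intro h
        have h0 := congrArg (fun m : TT (r + 1) D => m.1 0) h
        simp only [sig_inr, Finsupp.add_apply, Finsupp.single_eq_same] at h0
        have := j.2
        omega
      · simp only [B, Matrix.submatrix_apply, id, Matrix.fromCols_apply_inr, hF, Matrix.fromBlocks_apply₂₂]; rfl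
    rw [this, Matrix.det_fromBlocks_zero₂₁, Matrix.det_one, one_mul]
  rw [← hdet, Matrix.det_mul, hB]
  exact dvd_mul_left _ _

theorem exists_pts {f : MvPolynomial (Fin (r + 1)) ℤ} (H : Reg d f) (Z : Set (Fin (r + 1) → ℤ))
    (hZ : ∀ g : MvPolynomial (Fin (r + 1)) ℤ, g.totalDegree ≤ D → (∀ x ∈ Z, eval x g = 0) → f ∣ g)
    [DecidableEq (JJ r d D)] :
    ∃ x : JJ r d D → Fin (r + 1) → ℤ, (∀ i, x i ∈ Z) ∧
      (Matrix.of (fun i j : JJ r d D => eval (x i) (monomial j.1.1 (1 : ℤ)))).det ≠ 0 := by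
  classical
  let ev : (Fin (r + 1) → ℤ) → (JJ r d D → ℚ) := fun x j => ((eval x (monomial j.1.1 (1 : ℤ)) : ℤ) : ℚ)
  have hspan : Submodule.span ℚ (ev '' Z) = ⊤ := by
    by_contra hne
    obtain ⟨φ, hφ0, hφ⟩ := Submodule.exists_le_ker_of_lt_top _ (lt_top_iff_ne_top.2 hne)
    let a : JJ r d D → ℚ := fun j => φ (Pi.single j 1)
    have hφa : ∀ v, φ v = ∑ j, v j * a j := by
      intro v
      conv_lhs => rw [← Finset.univ_sum_single v]
      rw [map_sum]
      refine Finset.sum_congr rfl (fun j _ => ?_)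
      rw [← mul_one (v j), ← smul_eq_mul (v j) 1, Pi.single_smul, map_smul]; simp [a]
    obtain ⟨N, hN⟩ := IsLocalization.exist_integer_multiples_of_finite (nonZeroDivisors ℤ) a
    choose c hc using hN
    have hN0 : ((N : ℤ) : ℚ) ≠ 0 := by
      exact_mod_cast nonZeroDivisors.coe_ne_zero N
    have hc' : ∀ j, (c j : ℚ) = (N : ℤ) * a j := by
      intro j
      have := hc j
      simpa [Algebra.smul_def] using this
    let g : MvPolynomial (Fin (r + 1)) ℤ := ∑ j : JJ r d D, monomial j.1.1 (c j)
    have hg1 : g.totalDegree ≤ D := by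
      refine totalDegree_finsetSum_le (fun j _ => ?_)
      exact (totalDegree_monomial_le _ _).trans j.1.2
    have hgc : ∀ j : JJ r d D, g.coeff j.1.1 = c j := by
      intro j
      simp only [g]
      rw [coeff_sum, Finset.sum_eq_single j]
      · simp
      · intro j' _ h
        rw [coeff_monomial, if_neg]
        exact fun h' => h (Subtype.ext (Subtype.ext h'))
      · simp
    have hgv : ∀ x ∈ Z, eval x g = 0 := by
      intro x hx
      have h1 : φ (ev x) = 0 := hφ (Submodule.subset_span ⟨x, hx, rfl⟩)
      rw [hφa] at h1
      have h2 : ((eval x g : ℤ) : ℚ) = (N : ℤ) * ∑ j, ev x j * a j := by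
        simp only [g]
        rw [map_sum, Finset.mul_sum, Int.cast_sum]
        refine Finset.sum_congr rfl (fun j _ => ?_)
        rw [mul_left_comm, ← hc']
        simp only [ev]
        rw [eval_monomial, eval_monomial]
        push_cast; ring
      rw [h1, mul_zero] at h2
      exact_mod_cast h2
    have hfg := hZ g hg1 hgv
    have hg0 : g = 0 := by
      by_contra hg0
      obtain ⟨q, hq⟩ := hfg
      have hq0 : q ≠ 0 := by rintro rfl; exact hg0 (by rw [hq, mul_zero])
      have h3 : g.degreeOf 0 = d + q.degreeOf 0 := by
        rw [hq, degreeOf_mul_eq H.ne_zero hq0, H.degreeOf]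
      have h5 : g ≠ 0 := hg0
      have h4 : ∀ m ∈ g.support, m 0 < d := by
        intro m hm
        obtain ⟨j, -, hj⟩ := Finset.mem_biUnion.1 (support_sum hm)
        have := support_monomial_subset hj
        rw [Finset.mem_singleton] at this
        rw [this]; exact j.2
      obtain ⟨m, hm⟩ := support_nonempty.2 hg0
      have hd0 : 0 < d := lt_of_le_of_lt (Nat.zero_le _) (h4 m hm)
      have := (degreeOf_lt_iff hd0).2 h4
      omega
    apply hφ0
    apply LinearMap.ext
    intro v
    rw [hφa]
    apply Finset.sum_eq_zero
    intro j _
    have h1 := hgc j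
    rw [hg0, coeff_zero] at h1
    have h2 := hc' j
    rw [← h1] at h2
    have : a j = 0 := by
      rcases mul_eq_zero.1 h2.symm with h | h
      · exact absurd h hN0
      · exact h
    rw [this, mul_zero]
  obtain ⟨b, hb1, hb2, hb3⟩ := exists_linearIndependent ℚ (ev '' Z)
  rw [hspan] at hb2
  let Bs := Module.Basis.mk hb3 (by rw [Subtype.range_coe]; exact hb2.ge)
  have : Fintype b := FiniteDimensional.fintypeBasisIndex Bs
  have hcard : Fintype.card (JJ r d D) = Fintype.card b := by
    rw [← Module.finrank_eq_card_basis Bs, Module.finrank_fintype_fun_eq_card]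
  let e : JJ r d D ≃ b := Fintype.equivOfCardEq hcard
  have hmem : ∀ i : JJ r d D, ∃ x ∈ Z, ev x = (e i : JJ r d D → ℚ) := fun i => hb1 (e i).2
  choose x hx1 hx2 using hmem
  refine ⟨x, hx1, ?_⟩
  have hli : LinearIndependent ℚ (fun i => ev (x i)) := by
    have : (fun i => ev (x i)) = (fun y : b => (y : JJ r d D → ℚ)) ∘ e := by funext i; exact hx2 i
    rw [this]
    exact hb3.comp _ e.injective
  have hunit := (Matrix.linearIndependent_rows_iff_isUnit (A := Matrix.of (fun i => ev (x i)))).1 hli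
  rw [Matrix.isUnit_iff_isUnit_det, isUnit_iff_ne_zero] at hunit
  intro h0
  apply hunit
  have := Int.cast_det (R := ℚ) (Matrix.of (fun i j : JJ r d D => eval (x i) (monomial j.1.1 (1 : ℤ))))
  rw [h0, Int.cast_zero] at this
  rw [this]
  rfl

end lattice
end AuxPoly

end

section

open MvPolynomial

namespace AuxPoly
section Bertini

theorem Reg.not_dvd' {k : Type*} [Field k] {n d : ℕ} {h G : MvPolynomial (Fin (n + 1)) k} (H : Reg d h) (hG : G ≠ 0)
    (hlt : G.degreeOf 0 < d) : ¬ h ∣ G := by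
  rintro ⟨c, rfl⟩
  have hc : c ≠ 0 := right_ne_zero_of_mul hG
  rw [degreeOf_mul_eq H.ne_zero hc, H.degreeOf] at hlt
  omega

theorem smooth_point {r d : ℕ} {G : MvPolynomial (Fin (r + 1)) ℂ} (H : Reg d G) (hd : 1 ≤ d)
    (hp : Prime G) : ∃ (x0 : ℂ) (v0 : Fin r → ℂ), (sec G v0).eval x0 = 0 ∧
      (Polynomial.derivative (sec G v0)).eval x0 ≠ 0 := by
  have hdk : (d : ℂ) ≠ 0 := by exact_mod_cast (by omega : d ≠ 0)
  have h1 : ¬ G ∣ pderiv 0 G := H.not_dvd' (H.pderiv_ne hd hdk) (degreeOf_pderiv_lt H.1 hd 0)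
  have hprime : (Ideal.span {G}).IsPrime := (Ideal.span_singleton_prime hp.ne_zero).2 hp
  have h2 := IsPrime.vanishingIdeal_zeroLocus (K := ℂ) (Ideal.span {G})
  rw [← Ideal.mem_span_singleton, ← h2, mem_vanishingIdeal_iff] at h1
  push Not at h1
  obtain ⟨z, hz, hz2⟩ := h1
  rw [mem_zeroLocus_iff] at hz
  have hz1 := hz G (Ideal.mem_span_singleton_self G)
  refine ⟨z 0, fun i => z i.succ, ?_, ?_⟩
  · have hcz : (Fin.cons (z 0) (fun i => z i.succ) : Fin (r + 1) → ℂ) = z := Fin.cons_self_tail z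
    rw [sec_eval, hcz]
    simpa [aeval_eq_eval] using hz1
  · have hcz : (Fin.cons (z 0) (fun i => z i.succ) : Fin (r + 1) → ℂ) = z := Fin.cons_self_tail z
    rw [← sec_derivative, sec_eval, hcz]
    simpa [aeval_eq_eval] using hz2

theorem sec_line {K R : Type*} [CommRing K] [CommRing R] [Algebra K R] {r : ℕ} (v : Fin r → K) (β : Fin r → R)
    (G : MvPolynomial (Fin (r + 1)) K) :
    sec (aeval (line (fun i => algebraMap K R (v i)) β) G) (fun _ => 0) =
      (sec G v).map (algebraMap K R) := by
  induction G using MvPolynomial.induction_on with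
  | C a => rw [aeval_C, IsScalarTower.algebraMap_apply K R (MvPolynomial (Fin 2) R), MvPolynomial.algebraMap_eq, sec_C, sec_C, Polynomial.map_C]
  | add a b ha hb => rw [map_add, sec_add, sec_add, ha, hb, Polynomial.map_add]
  | mul_X a i ha =>
    rw [map_mul, sec_mul, sec_mul, ha, Polynomial.map_mul, aeval_X]
    congr 1
    refine Fin.cases ?_ (fun i => ?_) i
    · simp [line, sec_X_zero]
    · have : (1 : Fin 2) = Fin.succ 0 := rfl
      rw [line, Fin.cons_succ, sec_add, sec_mul, sec_C, sec_C, this, sec_X_succ, sec_X_succ]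
      simp

theorem aeval_line_totalDegree {K R : Type*} [CommRing K] [CommRing R] [Algebra K R] {r d : ℕ} (v β : Fin r → R)
    {G : MvPolynomial (Fin (r + 1)) K} (hG : G.totalDegree ≤ d) :
    (aeval (line v β) G).totalDegree ≤ d := by
  rw [← mem_TD, aeval_def, eval₂_eq']
  refine AddSubgroup.sum_mem _ (fun m hm => ?_)
  have h1 : ∑ i, m i ≤ d := by
    have := le_totalDegree hm
    rw [fsum_fintype] at this
    omega
  have hT := filt_TD (R := R) (Fin 2)
  have hC : algebraMap K (MvPolynomial (Fin 2) R) (coeff m G) ∈ TD (Fin 2) R 0 := by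
    rw [mem_TD, IsScalarTower.algebraMap_apply K R (MvPolynomial (Fin 2) R), MvPolynomial.algebraMap_eq, totalDegree_C]
  exact hT.mono (by simpa using h1) (hT.mul hC
    (hT.prod Finset.univ _ (fun i => m i * 1) (fun i _ => hT.pow (line_TD v β i) _)))

theorem aeval_line_coeff {K R : Type*} [CommRing K] [CommRing R] [Algebra K R] {r d : ℕ} (v : Fin r → K) (β : Fin r → R)
    {G : MvPolynomial (Fin (r + 1)) K} (hG : G.totalDegree ≤ d) :
    (aeval (line (fun i => algebraMap K R (v i)) β) G).coeff (Finsupp.single 0 d) =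
      algebraMap K R (G.coeff (Finsupp.single 0 d)) := by
  rw [← sec_coeff_top (aeval_line_totalDegree _ _ hG) (fun _ => 0), sec_line, Polynomial.coeff_map, sec_coeff_top hG]

theorem sec_eps {r : ℕ} (v0 : Fin r → ℂ)
    (ε : MvPolynomial (Fin 2) (MvPolynomial (Fin r) ℂ) →+* MvPolynomial (Fin (r + 1)) ℂ)
    (hC : ∀ a, ε (C a) = aeval (fun i => X i.succ - C (v0 i)) a) (h0 : ε (X 0) = X 0) (h1 : ε (X 1) = 1)
    (F : MvPolynomial (Fin 2) (MvPolynomial (Fin r) ℂ)) :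
    sec (ε F) v0 = sec (map (eval (fun _ => 0)) F) (fun _ => 1) := by
  induction F using MvPolynomial.induction_on with
  | C a =>
    rw [hC, map_C, sec_C]
    induction a using MvPolynomial.induction_on with
    | C a => rw [aeval_C, MvPolynomial.algebraMap_eq, sec_C, eval_C]
    | add a b ha hb => rw [map_add, map_add, sec_add, ha, hb, Polynomial.C_add]
    | mul_X a i ha =>
      have : sec (X i.succ - C (v0 i)) v0 = 0 := by
        rw [sub_eq_add_neg, ← C_neg, sec_add, sec_C, sec_X_succ]; simp
      rw [map_mul, map_mul, sec_mul, ha, aeval_X, this, eval_X]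
      simp
  | add a b ha hb => rw [map_add, map_add, sec_add, sec_add, ha, hb]
  | mul_X a i ha =>
    rw [map_mul, map_mul, sec_mul, sec_mul, ha, map_X]
    refine congrArg (fun z => sec (map (eval (fun _ => 0)) a) (fun _ => 1) * z) ?_
    have h3 : (1 : Fin 2) = Fin.succ 0 := rfl
    have h2 : sec (1 : MvPolynomial (Fin (r+1)) ℂ) v0 = 1 := by rw [← C_1, sec_C, Polynomial.C_1]
    rcases (by omega : i = 0 ∨ i = 1) with rfl | rfl
    · rw [h0, sec_X_zero, sec_X_zero]
    · rw [h1, h2, h3, sec_X_succ, Polynomial.C_1]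

theorem hat_unit {r d : ℕ} {G : MvPolynomial (Fin (r + 1)) ℂ} (H : Reg d G) (v0 : Fin r → ℂ)
    {A B : MvPolynomial (Fin 2) (MvPolynomial (Fin r) ℂ)}
    (hAB : aeval (line (fun i => algebraMap ℂ (MvPolynomial (Fin r) ℂ) (v0 i)) X) G = A * B)
    (ε : MvPolynomial (Fin 2) (MvPolynomial (Fin r) ℂ) →+* MvPolynomial (Fin (r + 1)) ℂ)
    (hC : ∀ a, ε (C a) = aeval (fun i => X i.succ - C (v0 i)) a) (h0 : ε (X 0) = X 0) (h1 : ε (X 1) = 1)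
    (hu : IsUnit (ε A)) : IsUnit A := by
  have hc := aeval_line_coeff v0 (X : Fin r → MvPolynomial (Fin r) ℂ) H.1
  have ht := aeval_line_totalDegree (fun i => algebraMap ℂ (MvPolynomial (Fin r) ℂ) (v0 i)) (X : Fin r → MvPolynomial (Fin r) ℂ) H.1
  have HR : Reg d (A * B) := by
    rw [← hAB]
    refine ⟨ht, ?_⟩
    rw [hc]
    simpa using H.2
  have HA := reg_of_mul HR
  have HB := reg_of_mul (mul_comm A B ▸ HR)
  have hdeg : A.totalDegree + B.totalDegree = d := by
    rw [← totalDegree_mul_of_isDomain HA.ne_zero HB.ne_zero, HR.totalDegree]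
  have hlead : A.coeff (Finsupp.single 0 A.totalDegree) * B.coeff (Finsupp.single 0 B.totalDegree) =
      algebraMap ℂ _ (G.coeff (Finsupp.single 0 d)) := by
    rw [← hc, hAB, ← sec_coeff_top HA.1 (fun _ => 0), ← sec_coeff_top HB.1 (fun _ => 0), ← sec_coeff_top HR.1 (fun _ => 0),
      sec_mul, ← hdeg, Polynomial.coeff_mul_add_eq_of_natDegree_le (sec_natDegree_le HA.1 _) (sec_natDegree_le HB.1 _)]
  have hα : IsUnit (A.coeff (Finsupp.single 0 A.totalDegree)) := by
    refine isUnit_of_mul_isUnit_left (y := B.coeff (Finsupp.single 0 B.totalDegree)) ?_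
    rw [hlead]
    exact (isUnit_iff_ne_zero.2 H.2).map _
  have hδ := fun F => sec_eps v0 ε hC h0 h1 F
  have hu2 : IsUnit (sec (ε A) v0) := by
    rw [sec]
    exact (hu.map (finSuccEquiv ℂ r)).map (Polynomial.mapRingHom (eval v0))
  rw [hδ] at hu2
  have h4 := sec_coeff_top ((tdeg_map_le (eval (fun _ : Fin r => (0 : ℂ))) A).trans HA.1) (fun _ => 1)
  rw [coeff_map] at h4
  have h5 : A.totalDegree = 0 := by
    have := Polynomial.natDegree_eq_zero_of_isUnit hu2
    by_contra hne
    rw [Polynomial.coeff_eq_zero_of_natDegree_lt (by omega)] at h4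
    exact (hα.map (eval (fun _ : Fin r => (0 : ℂ)))).ne_zero h4.symm
  rw [totalDegree_eq_zero_iff_eq_C.1 h5]
  rw [h5, Finsupp.single_zero] at hα
  exact hα.map C

theorem hat_prime {r d : ℕ} {G : MvPolynomial (Fin (r + 1)) ℂ} (H : Reg d G) (hp : Prime G) (v0 : Fin r → ℂ) :
    Prime (aeval (line (fun i => algebraMap ℂ (MvPolynomial (Fin r) ℂ) (v0 i)) X) G) := by
  obtain ⟨ε, hC, h0, h1⟩ : ∃ ε : MvPolynomial (Fin 2) (MvPolynomial (Fin r) ℂ) →+* MvPolynomial (Fin (r + 1)) ℂ,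
      (∀ a, ε (C a) = aeval (fun i => X i.succ - C (v0 i)) a) ∧ ε (X 0) = X 0 ∧ ε (X 1) = 1 := by
    refine ⟨eval₂Hom (aeval (fun i => X i.succ - C (v0 i)) : MvPolynomial (Fin r) ℂ →ₐ[ℂ] MvPolynomial (Fin (r+1)) ℂ).toRingHom ![X 0, 1], ?_, ?_, ?_⟩
    · intro a; rw [coe_eval₂Hom, eval₂_C]; rfl
    · rw [coe_eval₂Hom, eval₂_X]; rfl
    · rw [coe_eval₂Hom, eval₂_X]; rfl
  have hεG : ε (aeval (line (fun i => algebraMap ℂ (MvPolynomial (Fin r) ℂ) (v0 i)) X) G) = G := by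
    clear hp H
    induction G using MvPolynomial.induction_on with
    | C a =>
      rw [aeval_C, IsScalarTower.algebraMap_apply ℂ (MvPolynomial (Fin r) ℂ) (MvPolynomial (Fin 2) (MvPolynomial (Fin r) ℂ)), MvPolynomial.algebraMap_eq, hC, MvPolynomial.algebraMap_eq, aeval_C, MvPolynomial.algebraMap_eq]
    | add a b ha hb => rw [map_add, map_add, ha, hb]
    | mul_X a i ha =>
      rw [map_mul, map_mul, ha, aeval_X]
      congr 1
      refine Fin.cases ?_ (fun i => ?_) i
      · simp [line, h0]
      · simp [line, hC, h1, MvPolynomial.algebraMap_eq]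
  refine Irreducible.prime ⟨?_, ?_⟩
  · intro hu
    exact hp.not_isUnit (hεG ▸ hu.map ε)
  · intro A B hAB
    have h2 : G = ε A * ε B := by rw [← map_mul, ← hAB, hεG]
    rcases hp.irreducible.isUnit_or_isUnit h2 with h | h
    · exact Or.inl (hat_unit H v0 hAB ε hC h0 h1 h)
    · exact Or.inr (hat_unit H v0 (hAB.trans (mul_comm A B)) ε hC h0 h1 h)

attribute [local instance] algebraMvPolynomial in
theorem prime_frac {S : Type*} [CommRing S] [IsDomain S] {F : MvPolynomial (Fin 2) S} (hF : Prime F)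
    (hdeg : F.totalDegree ≠ 0) : Prime (map (algebraMap S (FractionRing S)) F) := by
  have hI : (Ideal.span {F}).IsPrime := (Ideal.span_singleton_prime hF.ne_zero).2 hF
  have h1 := IsLocalization.isPrime_of_isPrime_disjoint ((nonZeroDivisors S).map (C (σ := Fin 2)))
    (MvPolynomial (Fin 2) (FractionRing S)) (Ideal.span {F}) hI (by
      rw [Set.disjoint_left]
      rintro x ⟨s, hs, rfl⟩ hx
      rw [SetLike.mem_coe, Ideal.mem_span_singleton] at hx
      have hs0 : s ≠ 0 := nonZeroDivisors.ne_zero hs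
      obtain ⟨c, hc⟩ := hx
      change C s = F * c at hc
      have hc0 : c ≠ 0 := by
        rintro rfl
        rw [mul_zero, C_eq_zero] at hc; exact hs0 hc
      have := congrArg totalDegree hc
      rw [totalDegree_C, totalDegree_mul_of_isDomain hF.ne_zero hc0] at this
      omega)
  rw [Ideal.map_span, Set.image_singleton, Ideal.span_singleton_prime] at h1
  · exact h1
  · intro h0
    have : map (algebraMap S (FractionRing S)) F = 0 := h0
    rw [← map_zero (map (algebraMap S (FractionRing S)))] at this
    exact hF.ne_zero (map_injective _ (IsFractionRing.injective S _) this)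

end Bertini
end AuxPoly

end

section

open MvPolynomial

namespace AuxPoly
section Bertini2

theorem exists_minor {K : Type*} [Field K] {m n : Type*} [Fintype m] [Fintype n] [DecidableEq m] [DecidableEq n]
    (M : Matrix m n K) (hM : ∀ v, M.mulVec v = 0 → v = 0) : ∃ φ : n → m, (Matrix.of (fun i j => M (φ i) j)).det ≠ 0 := by
  have h1 : LinearMap.ker M.mulVecLin = ⊥ := by
    rw [LinearMap.ker_eq_bot']
    intro v hv
    exact hM v hv
  obtain ⟨g, hg⟩ := LinearMap.exists_leftInverse_of_injective M.mulVecLin h1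
  have h2 : LinearMap.toMatrix' g * M = 1 := by
    rw [← LinearMap.toMatrix'_id, ← hg, LinearMap.toMatrix'_comp, ← Matrix.toLin'_apply', LinearMap.toMatrix'_toLin']
  by_contra hcon
  push Not at hcon
  have h3 := det_mul_expand (LinearMap.toMatrix' g) M
  rw [h2, Matrix.det_one, Finset.sum_eq_zero] at h3
  · exact one_ne_zero h3
  · intro φ _
    rw [hcon φ, mul_zero]

theorem minor_dom {S : Type*} [CommRing S] [IsDomain S] [Algebra ℂ S] {d : ℕ} (hd : 1 ≤ d)
    {F : MvPolynomial (Fin 2) S} (HF : Reg d F) (hp : Prime F) (q : Polynomial ℂ)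
    (hs : sec F (fun _ => 0) = q.map (algebraMap ℂ S)) (x0 : ℂ) (hx1 : q.eval x0 = 0)
    (hx2 : (Polynomial.derivative q).eval x0 ≠ 0) :
    ∃ φ : Col d → Row d, (Matrix.of (fun i j => RM d F (φ i) j)).det ≠ 0 := by
  classical
  have hinj := IsFractionRing.injective S (FractionRing S)
  have hpk := prime_frac hp (by rw [HF.totalDegree]; omega)
  have hcz : CharZero (FractionRing S) :=
    charZero_of_injective_algebraMap (R := ℂ) (algebraMap ℂ (FractionRing S)).injective
  have HFk : Reg d (map (algebraMap S (FractionRing S)) F) := by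
    refine ⟨(tdeg_map_le _ F).trans HF.1, ?_⟩
    rw [coeff_map]
    exact fun h => HF.2 ((map_eq_zero_iff _ hinj).1 h)
  have hsk : sec (map (algebraMap S (FractionRing S)) F) (fun _ => 0) = q.map (algebraMap ℂ (FractionRing S)) := by
    have := sec_map (algebraMap S (FractionRing S)) F (fun _ => 0)
    simp only [map_zero] at this
    rw [this, hs, Polynomial.map_map, ← IsScalarTower.algebraMap_eq]
  obtain ⟨φ, hφ⟩ := exists_minor (RM d (map (algebraMap S (FractionRing S)) F))
    (fun v hv => ruppert_hard hd HFk hpk (Fin.cons (algebraMap ℂ (FractionRing S) x0) (fun _ => 0)) (by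
      rw [← sec_eval, hsk, Polynomial.eval_map_algebraMap, Polynomial.aeval_algebraMap_apply]
      simp [hx1]) (by
      rw [← sec_eval, sec_derivative, hsk, Polynomial.derivative_map, Polynomial.eval_map_algebraMap,
        Polynomial.aeval_algebraMap_apply]
      simpa using hx2) v hv)
  refine ⟨φ, fun h => hφ ?_⟩
  rw [← RM_map, ← map_zero (algebraMap S (FractionRing S)), ← h, RingHom.map_det]
  rfl

theorem gen_minor {r d : ℕ} {G : MvPolynomial (Fin (r + 1)) ℂ} (H : Reg d G) (hd : 1 ≤ d) (hp : Prime G) :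
    ∃ (v0 : Fin r → ℂ) (φ : Col d → Row d), (Matrix.of (fun i j => RM d
      (aeval (line (fun i => algebraMap ℂ (MvPolynomial (Fin r) ℂ) (v0 i)) X) G) (φ i) j)).det ≠ 0 := by
  classical
  obtain ⟨x0, v0, hx1, hx2⟩ := smooth_point H hd hp
  have hpr := hat_prime H hp v0
  have hc := aeval_line_coeff v0 (X : Fin r → MvPolynomial (Fin r) ℂ) H.1
  have ht := aeval_line_totalDegree (fun i => algebraMap ℂ (MvPolynomial (Fin r) ℂ) (v0 i)) (X : Fin r → MvPolynomial (Fin r) ℂ) H.1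
  have hs := sec_line v0 (X : Fin r → MvPolynomial (Fin r) ℂ) G
  refine ⟨v0, minor_dom hd ⟨ht, ?_⟩ hpr (sec G v0) hs x0 hx1 hx2⟩
  rw [hc]
  simpa using H.2

theorem aeval_line_map {R S : Type*} [CommRing R] [CommRing S] (φ : R →+* S) {r : ℕ} (v β : Fin r → R)
    (g : MvPolynomial (Fin (r + 1)) ℤ) :
    map φ (aeval (line v β) g) = aeval (line (fun i => φ (v i)) (fun i => φ (β i))) g := by
  induction g using MvPolynomial.induction_on with
  | C a => simp
  | add a b ha hb => rw [map_add, map_add, map_add, ha, hb]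
  | mul_X a i ha => rw [map_mul, map_mul, map_mul, ha, aeval_X, aeval_X, line_map]

theorem Filt.aeval_line {R : Type*} [CommRing R] {A : ℕ → AddSubgroup R} (hA : Filt A) {r d : ℕ}
    {v β : Fin r → R} (hv : ∀ i, v i ∈ A 1) (hβ : ∀ i, β i ∈ A 1)
    {g : MvPolynomial (Fin (r + 1)) ℤ} (hg : g.totalDegree ≤ d) : aeval (AuxPoly.line v β) g ∈ AuxPoly.AC A d := by
  rw [aeval_def, eval₂_eq']
  refine AddSubgroup.sum_mem _ (fun m hm => ?_)
  have h1 : ∑ i, m i ≤ d := by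
    have := le_totalDegree hm
    rw [fsum_fintype] at this
    omega
  have hC : algebraMap ℤ (MvPolynomial (Fin 2) R) (coeff m g) ∈ AuxPoly.AC A 0 := by
    have : algebraMap ℤ (MvPolynomial (Fin 2) R) (coeff m g) = (coeff m g) • (1 : MvPolynomial (Fin 2) R) := by simp
    rw [this]
    exact AddSubgroup.zsmul_mem _ hA.AC.one _
  exact hA.AC.mono (by simpa using h1) (hA.AC.mul hC
    (hA.AC.prod Finset.univ _ (fun i => m i * 1) (fun i _ => hA.AC.pow (hA.line hv hβ i) _)))

theorem bertini {r d : ℕ} (hd : 1 ≤ d) {g : MvPolynomial (Fin (r + 1)) ℤ} (H : Reg d g)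
    (hirr : Irreducible (map (Int.castRingHom ℂ) g)) :
    ∃ v β : Fin r → ℤ, (∀ i, 0 ≤ v i ∧ v i ≤ 2 * d ^ 3) ∧ (∀ i, 0 ≤ β i ∧ β i ≤ 2 * d ^ 3) ∧
      (gram d (aeval (line v β) g)).det ≠ 0 := by
  classical
  have HG : Reg d (map (Int.castRingHom ℂ) g) := by
    refine ⟨(tdeg_map_le _ g).trans H.1, ?_⟩
    rw [coeff_map]
    simpa using H.2
  obtain ⟨v0, φ, hφ⟩ := gen_minor HG hd hirr.prime
  set U : MvPolynomial (Fin 2) (MvPolynomial (Fin r ⊕ Fin r) ℤ) :=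
    aeval (line (fun i => X (Sum.inl i)) (fun i => X (Sum.inr i))) g with hU
  set μ := (Matrix.of (fun i j => RM d U (φ i) j)).det with hμ
  have hspec : ∀ {S : Type} [CommRing S] (χ : MvPolynomial (Fin r ⊕ Fin r) ℤ →+* S),
      χ μ = (Matrix.of (fun i j => RM d (aeval (line (fun i => χ (X (Sum.inl i))) (fun i => χ (X (Sum.inr i)))) g) (φ i) j)).det := by
    intro S _ χ
    rw [hμ, RingHom.map_det, ← aeval_line_map, ← RM_map]
    rfl
  have hμ0 : μ ≠ 0 := by
    intro h0
    apply hφ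
    have := hspec (aeval (Sum.elim (fun i => algebraMap ℂ (MvPolynomial (Fin r) ℂ) (v0 i)) X) :
      MvPolynomial (Fin r ⊕ Fin r) ℤ →ₐ[ℤ] MvPolynomial (Fin r) ℂ).toRingHom
    rw [h0, map_zero] at this
    rw [this]
    simp only [AlgHom.toRingHom_eq_coe, RingHom.coe_coe, aeval_X, Sum.elim_inl, Sum.elim_inr]
    rw [← algebraMap_int_eq, aeval_map_algebraMap]
    rfl
  have hμd : μ.totalDegree ≤ 2 * d ^ 3 := by
    have hT := filt_TD (R := ℤ) (Fin r ⊕ Fin r)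
    have hX : ∀ i, (X i : MvPolynomial (Fin r ⊕ Fin r) ℤ) ∈ TD (Fin r ⊕ Fin r) ℤ 1 := by
      intro i; rw [mem_TD, totalDegree_X]
    have hUA := hT.aeval_line (fun i => hX (Sum.inl i)) (fun i => hX (Sum.inr i)) H.1
    have h1 := hT.det (Matrix.of (fun i j => RM d U (φ i) j)) d (fun i j => hT.RM hUA (φ i) j)
    rw [mem_TD] at h1
    refine h1.trans ?_
    calc _ ≤ 2 * d ^ 2 * d := Nat.mul_le_mul_right _ (card_Col d)
      _ = _ := by ring
  have hex : ∃ z : Fin r ⊕ Fin r → ℤ, (∀ i, z i ∈ Finset.Icc (0:ℤ) (2 * d ^ 3)) ∧ eval z μ ≠ 0 := by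
    by_contra hcon
    push Not at hcon
    refine hμ0 (eq_zero_of_eval_zero_at_prod_finset μ (fun _ => Finset.Icc (0:ℤ) (2 * d ^ 3)) (fun i => ?_) hcon)
    have := (degreeOf_le_totalDegree μ i).trans hμd
    rw [Int.card_Icc]
    have e : ((2 * (d:ℤ) ^ 3 + 1 - 0).toNat) = 2 * d ^ 3 + 1 := by
      rw [sub_zero]; exact_mod_cast Int.toNat_natCast (2 * d ^ 3 + 1)
    omega
  obtain ⟨z, hz, hz2⟩ := hex
  refine ⟨fun i => z (Sum.inl i), fun i => z (Sum.inr i), fun i => by simpa using hz (Sum.inl i),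
    fun i => by simpa using hz (Sum.inr i), ?_⟩
  intro hdet
  rw [hspec (eval z)] at hz2
  simp only [eval_X] at hz2
  obtain ⟨w, hw, hw2⟩ := Matrix.exists_mulVec_eq_zero_iff.2 hdet
  have h1 : (RM d (aeval (line (fun i => z (Sum.inl i)) (fun i => z (Sum.inr i))) g)).mulVec w = 0 := by
    rw [← dotProduct_self_eq_zero, Matrix.dotProduct_mulVec, ← Matrix.mulVec_transpose, Matrix.mulVec_mulVec]
    rw [gram] at hw2
    rw [hw2, zero_dotProduct]
  refine hz2 (Matrix.exists_mulVec_eq_zero_iff.1 ⟨w, hw, ?_⟩)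
  ext i
  exact congrFun h1 (φ i)

end Bertini2
end AuxPoly

end

section

open MvPolynomial

namespace AuxPoly
section L1

variable {σ : Type*} {R : Type*} [CommRing R] [LinearOrder R] [IsStrictOrderedRing R]

/-- sum of absolute values of the coefficients -/
noncomputable def l1 (F : MvPolynomial σ R) : R := ∑ m ∈ F.support, |coeff m F|

theorem l1_eq {F : MvPolynomial σ R} {s : Finset (σ →₀ ℕ)} (hs : F.support ⊆ s) : l1 F = ∑ m ∈ s, |coeff m F| := by
  refine Finset.sum_subset hs (fun m _ hm => ?_)
  rw [notMem_support_iff.1 hm, abs_zero]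

theorem l1_nonneg (F : MvPolynomial σ R) : 0 ≤ l1 F := Finset.sum_nonneg (fun _ _ => abs_nonneg _)

theorem coeff_le_l1 (F : MvPolynomial σ R) (m : σ →₀ ℕ) : |coeff m F| ≤ l1 F := by
  classical
  by_cases hm : m ∈ F.support
  · exact Finset.single_le_sum (f := fun m => |coeff m F|) (fun _ _ => abs_nonneg _) hm
  · rw [notMem_support_iff.1 hm, abs_zero]; exact l1_nonneg F

theorem l1_add (F G : MvPolynomial σ R) : l1 (F + G) ≤ l1 F + l1 G := by
  classical
  rw [l1_eq (F := F + G) (s := F.support ∪ G.support) support_add, l1_eq (F := F) Finset.subset_union_left,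
    l1_eq (F := G) (Finset.subset_union_right (s₁ := F.support)), ← Finset.sum_add_distrib]
  exact Finset.sum_le_sum (fun m _ => by rw [coeff_add]; exact abs_add_le _ _)

theorem l1_neg (F : MvPolynomial σ R) : l1 (-F) = l1 F := by
  simp [l1, support_neg]

theorem l1_sub (F G : MvPolynomial σ R) : l1 (F - G) ≤ l1 F + l1 G := by
  rw [sub_eq_add_neg, ← l1_neg G]; exact l1_add _ _

theorem l1_zero : l1 (0 : MvPolynomial σ R) = 0 := by simp [l1]

theorem l1_sum {ι : Type*} (s : Finset ι) (F : ι → MvPolynomial σ R) : l1 (∑ i ∈ s, F i) ≤ ∑ i ∈ s, l1 (F i) := by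
  classical
  induction s using Finset.induction_on with
  | empty => simp [l1_zero]
  | insert i s hi ih =>
    rw [Finset.sum_insert hi, Finset.sum_insert hi]
    exact (l1_add _ _).trans (by linarith)

theorem l1_monomial (m : σ →₀ ℕ) (a : R) : l1 (monomial m a) = |a| := by
  classical
  rw [l1_eq support_monomial_subset]; simp

theorem l1_C (a : R) : l1 (C a : MvPolynomial σ R) = |a| := l1_monomial 0 a
theorem l1_X (i : σ) : l1 (X i : MvPolynomial σ R) = 1 := by rw [X, l1_monomial, abs_one]

theorem l1_mul (F G : MvPolynomial σ R) : l1 (F * G) ≤ l1 F * l1 G := by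
  have h : F * G = ∑ m ∈ F.support, ∑ n ∈ G.support, monomial (m + n) (coeff m F * coeff n G) := by
    conv_lhs => rw [F.as_sum, G.as_sum, Finset.sum_mul_sum]
    simp [monomial_mul]
  rw [h, l1.eq_1 F, l1.eq_1 G, Finset.sum_mul_sum]
  refine (l1_sum _ _).trans (Finset.sum_le_sum (fun m _ => (l1_sum _ _).trans (Finset.sum_le_sum (fun n _ => ?_))))
  rw [l1_monomial, abs_mul]

theorem l1_pow (F : MvPolynomial σ R) (k : ℕ) : l1 (F ^ k) ≤ l1 F ^ k := by
  induction k with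
  | zero => rw [pow_zero, pow_zero, ← C_1, l1_C, abs_one]
  | succ k ih =>
    rw [pow_succ, pow_succ]
    exact (l1_mul _ _).trans (mul_le_mul_of_nonneg_right ih (l1_nonneg _))

theorem l1_prod {ι : Type*} (s : Finset ι) (F : ι → MvPolynomial σ R) : l1 (∏ i ∈ s, F i) ≤ ∏ i ∈ s, l1 (F i) := by
  classical
  induction s using Finset.induction_on with
  | empty => rw [Finset.prod_empty, Finset.prod_empty, ← C_1, l1_C, abs_one]
  | insert i s hi ih =>
    rw [Finset.prod_insert hi, Finset.prod_insert hi]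
    exact (l1_mul _ _).trans (mul_le_mul_of_nonneg_left ih (l1_nonneg _))

/-- substitution bound -/
theorem l1_aeval {τ : Type*} [Fintype τ] {g : MvPolynomial τ R} {d : ℕ} (hg : g.totalDegree ≤ d) (w : τ → MvPolynomial σ R) (B : R)
    (hB : 1 ≤ B) (hw : ∀ i, l1 (w i) ≤ B) : l1 (aeval w g) ≤ l1 g * B ^ d := by
  rw [aeval_def, eval₂_eq', l1.eq_1 g, Finset.sum_mul]
  refine (l1_sum _ _).trans (Finset.sum_le_sum (fun m hm => ?_))
  refine (l1_mul _ _).trans ?_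
  rw [MvPolynomial.algebraMap_eq, l1_C]
  refine mul_le_mul_of_nonneg_left ?_ (abs_nonneg _)
  have h1 : ∑ i, m i ≤ d := by
    have := (le_totalDegree hm).trans hg
    simpa [Finsupp.sum_fintype] using this
  calc _ ≤ ∏ i, l1 (w i ^ m i) := l1_prod _ _
    _ ≤ ∏ i, B ^ m i := Finset.prod_le_prod (fun _ _ => l1_nonneg _)
        (fun i _ => (l1_pow _ _).trans (pow_le_pow_left₀ (l1_nonneg _) (hw i) _))
    _ = B ^ ∑ i, m i := Finset.prod_pow_eq_pow_sum _ _ _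
    _ ≤ _ := pow_le_pow_right₀ hB h1

theorem l1_pderiv {n : ℕ} {F : MvPolynomial (Fin n) ℤ} {N : ℕ} (hF : F.totalDegree ≤ N) (i : Fin n) :
    l1 (pderiv i F) ≤ N * l1 F := by
  conv_lhs => rw [F.as_sum, map_sum]
  rw [l1.eq_1 F, Finset.mul_sum]
  refine (l1_sum _ _).trans (Finset.sum_le_sum (fun m hm => ?_))
  rw [pderiv_monomial, l1_monomial, abs_mul, mul_comm]
  refine mul_le_mul_of_nonneg_right ?_ (abs_nonneg _)
  rw [Nat.abs_cast]
  have := (monomial_le_degreeOf i hm).trans ((degreeOf_le_totalDegree F i).trans hF)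
  exact_mod_cast this

theorem l1_rup {F g h : MvPolynomial (Fin 2) ℤ} {d : ℕ} (hF : F.totalDegree ≤ d) (hg : g.totalDegree ≤ 2 * d) (hh : h.totalDegree ≤ 2 * d) :
    l1 (rup F (g, h)) ≤ 3 * d * l1 F * (l1 g + l1 h) := by
  rw [rup_apply]
  have h1 := l1_mul F (pderiv 1 g)
  have h2 := l1_mul g (pderiv 1 F)
  have h3 := l1_mul F (pderiv 0 h)
  have h4 := l1_mul h (pderiv 0 F)
  have k1 := mul_le_mul_of_nonneg_left (l1_pderiv hg 1) (l1_nonneg F)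
  have k2 := mul_le_mul_of_nonneg_left (l1_pderiv hF 1) (l1_nonneg g)
  have k3 := mul_le_mul_of_nonneg_left (l1_pderiv hh 0) (l1_nonneg F)
  have k4 := mul_le_mul_of_nonneg_left (l1_pderiv hF 0) (l1_nonneg h)
  have e1 := l1_sub (F * pderiv 1 g - g * pderiv 1 F) (F * pderiv 0 h - h * pderiv 0 F)
  have e2 := l1_sub (F * pderiv 1 g) (g * pderiv 1 F)
  have e3 := l1_sub (F * pderiv 0 h) (h * pderiv 0 F)
  push_cast at *
  linarith

theorem RM_bound {F : MvPolynomial (Fin 2) ℤ} {d : ℕ} (hF : F.totalDegree ≤ d) (i : Row d) (j : Col d) :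
    |RM d F i j| ≤ 3 * d * l1 F := by
  refine (coeff_le_l1 _ _).trans ?_
  have hm : ∀ a : Fin d × Fin d, (mono ℤ a).totalDegree ≤ 2 * d ∧ l1 (mono ℤ a) ≤ 1 := by
    intro a
    refine ⟨?_, ?_⟩
    · have := totalDegree_mono (k := ℤ) a
      omega
    · rw [mono, l1_monomial, abs_one]
  have h0 : 0 ≤ 3 * (d:ℤ) * l1 F := by have := l1_nonneg F; positivity
  rcases j with a | a
  · refine (l1_rup hF (hm a.1).1 (by simp)).trans ?_
    rw [l1_zero, add_zero]
    exact mul_le_of_le_one_right h0 (hm a.1).2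
  · refine (l1_rup hF (by simp) (hm a).1).trans ?_
    rw [l1_zero, zero_add]
    exact mul_le_of_le_one_right h0 (hm a).2

theorem gram_bound {F : MvPolynomial (Fin 2) ℤ} {d : ℕ} (hd : 1 ≤ d) (hF : F.totalDegree ≤ d) {L : ℤ} (hL : 1 ≤ L) (hFL : l1 F ≤ L) :
    |(gram d F).det| ≤ (72 * d ^ 6 * L ^ 2) ^ (2 * d ^ 2) := by
  have hd' : (1:ℤ) ≤ d := by exact_mod_cast hd
  have hRM : ∀ i j, |RM d F i j| ≤ 3 * d * L := fun i j =>
    (RM_bound hF i j).trans (mul_le_mul_of_nonneg_left hFL (by positivity))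
  have hg : ∀ i j, AbsoluteValue.abs (gram d F i j) ≤ 36 * d ^ 4 * L ^ 2 := by
    intro i j
    rw [AbsoluteValue.abs_apply, gram, Matrix.mul_apply]
    refine (Finset.abs_sum_le_sum_abs _ _).trans ?_
    calc _ ≤ ∑ x : Row d, (3 * d * L) * (3 * d * L) := by
          refine Finset.sum_le_sum (fun x _ => ?_)
          rw [abs_mul, Matrix.transpose_apply]
          exact mul_le_mul (hRM _ _) (hRM _ _) (abs_nonneg _) (by positivity)
      _ = _ := by
          rw [Finset.sum_const, Finset.card_univ, Fintype.card_prod, Fintype.card_fin, nsmul_eq_mul]; push_cast; ring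
  have h1 := Matrix.det_le hg
  rw [AbsoluteValue.abs_apply] at h1
  refine h1.trans ?_
  rw [nsmul_eq_mul]
  have hc := card_Col d
  have hb : (1:ℤ) ≤ 72 * d ^ 6 * L ^ 2 := by
    have h6 : (1:ℤ) ≤ d ^ 6 := one_le_pow₀ hd'
    have h7 : (1:ℤ) ≤ L ^ 2 := one_le_pow₀ hL
    nlinarith
  calc _ ≤ ((2 * d ^ 2 : ℕ) : ℤ) ^ (Fintype.card (Col d)) * (36 * d ^ 4 * L ^ 2) ^ (Fintype.card (Col d)) := by
        refine mul_le_mul_of_nonneg_right ?_ (by positivity)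
        have h8 := (Nat.factorial_le_pow (Fintype.card (Col d))).trans (Nat.pow_le_pow_left hc _)
        exact_mod_cast h8
    _ = (72 * d ^ 6 * L ^ 2) ^ (Fintype.card (Col d)) := by rw [← mul_pow]; congr 1; push_cast; ring
    _ ≤ _ := pow_le_pow_right₀ hb hc

/-- bound on the Gram determinant of a plane section -/
theorem section_bound {r d : ℕ} (hd : 1 ≤ d) {g : MvPolynomial (Fin (r + 1)) ℤ} (hg : g.totalDegree ≤ d) (hl : 1 ≤ l1 g)
    {v β : Fin r → ℤ} (hv : ∀ i, 0 ≤ v i ∧ v i ≤ 2 * d ^ 3) (hβ : ∀ i, 0 ≤ β i ∧ β i ≤ 2 * d ^ 3) :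
    |(gram d (aeval (line v β) g)).det| ≤ (72 * d ^ 6 * (l1 g * (4 * d ^ 3) ^ d) ^ 2) ^ (2 * d ^ 2) := by
  have hd' : (1:ℤ) ≤ d ^ 3 := one_le_pow₀ (by exact_mod_cast hd)
  have h4 : (1:ℤ) ≤ 4 * d ^ 3 := by linarith
  refine gram_bound hd (aeval_line_totalDegree v β hg) ?_ (l1_aeval hg _ (4 * d ^ 3) h4 (fun i => ?_))
  · have := one_le_pow₀ h4 (n := d)
    nlinarith
  · refine Fin.cases ?_ (fun i => ?_) i
    · rw [line, Fin.cons_zero, l1_X]; exact h4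
    · rw [line, Fin.cons_succ]
      refine (l1_add _ _).trans ?_
      have h1 := l1_mul (C (β i)) (X 1 : MvPolynomial (Fin 2) ℤ)
      rw [l1_C, l1_X, mul_one, abs_of_nonneg (hβ i).1] at h1
      rw [l1_C, abs_of_nonneg (hv i).1]
      linarith [(hβ i).2, (hv i).2]

end L1
end AuxPoly

end

section

open MvPolynomial

namespace AuxPoly
section Interp

/-- Lagrange factor at node `j` in the variable `i` -/
noncomputable def lagr (r d : ℕ) (j : ℕ) (i : Fin r) : MvPolynomial (Fin r) ℚ :=
  ∏ k ∈ (Finset.range (d + 1)).erase j, (C (((j : ℚ) - k)⁻¹) * (X i - C (k : ℚ)))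

theorem eval_lagr {r d j : ℕ} (i : Fin r) (z : Fin r → ℚ) (c : ℕ) (hc : c ≤ d) (hz : z i = c) :
    eval z (lagr r d j i) = if c = j then 1 else 0 := by
  rw [lagr, map_prod]
  split_ifs with h
  · subst h
    refine Finset.prod_eq_one (fun k hk => ?_)
    have : (c : ℚ) - k ≠ 0 := by
      rw [sub_ne_zero]; exact_mod_cast (Finset.ne_of_mem_erase hk).symm
    simp [hz, this]
  · apply Finset.prod_eq_zero (i := c)
    · rw [Finset.mem_erase, Finset.mem_range]; exact ⟨h, by omega⟩
    · simp [hz]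

theorem degreeOf_lagr {r d j : ℕ} (hj : j ≤ d) (i i' : Fin r) : (lagr r d j i).degreeOf i' ≤ if i = i' then d else 0 := by
  rw [lagr]
  refine (degreeOf_prod_le _ _ _).trans ?_
  have hk : ∀ k : ℕ, (C (((j : ℚ) - k)⁻¹) * (X i - C (k : ℚ))).degreeOf i' ≤ if i = i' then 1 else 0 := by
    intro k
    refine (degreeOf_C_mul_le _ _ _).trans ?_
    refine (degreeOf_sub_le _ _ _).trans ?_
    rw [degreeOf_C, degreeOf_X]
    split_ifs <;> simp_all
  refine (Finset.sum_le_sum (fun k _ => hk k)).trans ?_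
  rw [Finset.sum_const, Finset.card_erase_of_mem (by simp; omega), Finset.card_range]
  split_ifs <;> simp

theorem l1_lagr {r d j : ℕ} (hj : j ≤ d) (i : Fin r) : l1 (lagr r d j i) ≤ (d + 1) ^ d := by
  rw [lagr]
  refine (l1_prod _ _).trans ?_
  calc _ ≤ ∏ k ∈ (Finset.range (d + 1)).erase j, ((d : ℚ) + 1) := by
        refine Finset.prod_le_prod (fun _ _ => l1_nonneg _) (fun k hk => ?_)
        have h1 := l1_mul (C (((j : ℚ) - k)⁻¹)) (X i - C (k : ℚ))
        have h2 := l1_sub (X i) (C (k : ℚ))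
        rw [l1_X, l1_C, Nat.abs_cast] at h2
        rw [l1_C] at h1
        have h3 : |((j : ℚ) - k)⁻¹| ≤ 1 := by
          rw [abs_inv]
          apply inv_le_one_of_one_le₀
          have : (j : ℤ) - k ≠ 0 := by
            have := (Finset.ne_of_mem_erase hk); omega
          have := Int.one_le_abs this
          exact_mod_cast this
        have h4 : (k : ℚ) ≤ d := by
          have := Finset.mem_range.1 (Finset.mem_of_mem_erase hk)
          exact_mod_cast (by omega : k ≤ d)
        refine h1.trans ?_
        calc _ ≤ 1 * l1 (X i - C (k : ℚ)) := mul_le_mul_of_nonneg_right h3 (l1_nonneg _)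
          _ ≤ _ := by linarith
    _ = _ := by
        rw [Finset.prod_const, Finset.card_erase_of_mem (by simp; omega), Finset.card_range]
        simp

theorem interp_bound {r d : ℕ} {h : MvPolynomial (Fin r) ℚ} (hdeg : ∀ i, h.degreeOf i ≤ d) (B : ℚ)
    (hB : ∀ a : Fin r → Fin (d + 1), |eval (fun i => ((a i : ℕ) : ℚ)) h| ≤ B) :
    l1 h ≤ B * (d + 1) ^ (r * (d + 1)) := by
  classical
  have hB0 : 0 ≤ B := (abs_nonneg _).trans (hB 0)
  have key : h = ∑ a : Fin r → Fin (d + 1), C (eval (fun i => ((a i : ℕ) : ℚ)) h) * ∏ i, lagr r d (a i) i := by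
    rw [← sub_eq_zero]
    refine eq_zero_of_eval_zero_at_prod_finset _ (fun _ => (Finset.range (d + 1)).image (fun k : ℕ => (k : ℚ))) (fun i => ?_) ?_
    · rw [Finset.card_image_of_injective _ Nat.cast_injective, Finset.card_range, Nat.lt_succ_iff]
      refine (degreeOf_sub_le _ _ _).trans (max_le (hdeg i) ?_)
      refine (degreeOf_sum_le _ _ _).trans (Finset.sup_le (fun a _ => ?_))
      refine (degreeOf_C_mul_le _ _ _).trans ((degreeOf_prod_le _ _ _).trans ?_)
      refine (Finset.sum_le_sum (fun j _ => degreeOf_lagr (Nat.lt_succ_iff.1 (a j).2) j i)).trans ?_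
      simp
    · intro z hz
      have hz' : ∀ i, ∃ c : Fin (d + 1), ((c : ℕ) : ℚ) = z i := by
        intro i
        have := hz i
        rw [Finset.mem_image] at this
        obtain ⟨k, hk, hk2⟩ := this
        exact ⟨⟨k, Finset.mem_range.1 hk⟩, hk2⟩
      choose c hc using hz'
      have hzc : z = fun i => ((c i : ℕ) : ℚ) := funext (fun i => (hc i).symm)
      rw [map_sub, map_sum, Finset.sum_eq_single c]
      · rw [map_mul, eval_C, map_prod, Finset.prod_eq_one, mul_one, hzc, sub_self]
        intro i _
        rw [eval_lagr i z (c i) (Nat.lt_succ_iff.1 (c i).2) (hc i).symm, if_pos rfl]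
      · intro a _ ha
        obtain ⟨i, hi⟩ := Function.ne_iff.1 ha
        rw [map_mul, map_prod, Finset.prod_eq_zero (Finset.mem_univ i), mul_zero]
        rw [eval_lagr i z (c i) (Nat.lt_succ_iff.1 (c i).2) (hc i).symm, if_neg]
        exact fun h => hi (Fin.ext h.symm)
      · simp
  have h1 : l1 h ≤ ∑ a : Fin r → Fin (d + 1), B * ((d + 1) ^ d) ^ r := by
    conv_lhs => rw [key]
    refine (l1_sum _ _).trans (Finset.sum_le_sum (fun a _ => ?_))
    refine (l1_mul _ _).trans ?_
    rw [l1_C]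
    refine mul_le_mul (hB a) ?_ (l1_nonneg _) hB0
    refine (l1_prod _ _).trans ?_
    refine (Finset.prod_le_prod (fun _ _ => l1_nonneg _) (fun i _ => l1_lagr (Nat.lt_succ_iff.1 (a i).2) i)).trans ?_
    simp
  refine h1.trans (le_of_eq ?_)
  rw [Finset.sum_const, Finset.card_univ, Fintype.card_fun, Fintype.card_fin, Fintype.card_fin, nsmul_eq_mul]
  push_cast
  rw [← pow_mul, mul_left_comm, ← pow_add]
  congr 2
  ring

theorem l1_dehom {r d : ℕ} {g : MvPolynomial (Fin (r + 1)) ℤ} (hg : g.IsHomogeneous d) :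
    l1 g ≤ l1 (aeval (Fin.cons 1 X : Fin (r + 1) → MvPolynomial (Fin r) ℤ) g) := by
  classical
  set h := aeval (Fin.cons 1 X : Fin (r + 1) → MvPolynomial (Fin r) ℤ) g with hh
  have hdm : ∀ m ∈ g.support, m 0 + ∑ i : Fin r, m i.succ = d := by
    intro m hm
    rw [← Fin.sum_univ_succ (f := fun i => m i)]
    have := hg (mem_support_iff.1 hm)
    rw [Finsupp.weight_apply] at this
    simpa [Finsupp.sum_fintype] using this
  have hinj : ∀ m ∈ g.support, ∀ m' ∈ g.support, Finsupp.tail m' = Finsupp.tail m → m' = m := by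
    intro m hm m' hm' ht
    have h1 := hdm m hm
    have h2 := hdm m' hm'
    have h3 : ∀ i : Fin r, m' i.succ = m i.succ := fun i => DFunLike.congr_fun ht i
    simp_rw [h3] at h2
    ext i
    refine Fin.cases (by omega) h3 i
  have e : ∀ m : Fin (r + 1) →₀ ℕ, aeval (Fin.cons 1 X : Fin (r + 1) → MvPolynomial (Fin r) ℤ) (monomial m (coeff m g)) =
      monomial (Finsupp.tail m) (coeff m g) := by
    intro m
    rw [aeval_monomial, monomial_eq, Finsupp.prod_fintype _ _ (by simp), Finsupp.prod_fintype _ _ (by simp),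
      Fin.prod_univ_succ]
    simp [Finsupp.tail_apply, MvPolynomial.algebraMap_eq]
  have hcoeff : ∀ m ∈ g.support, coeff (Finsupp.tail m) h = coeff m g := by
    intro m hm
    have h5 : h = ∑ m ∈ g.support, monomial (Finsupp.tail m) (coeff m g) := by
      rw [hh]
      conv_lhs => rw [g.as_sum]
      rw [map_sum]
      exact Finset.sum_congr rfl (fun m _ => e m)
    rw [h5, coeff_sum, Finset.sum_eq_single m]
    · rw [coeff_monomial, if_pos rfl]
    · intro m' hm' hne
      rw [coeff_monomial, if_neg]
      exact fun ht => hne (hinj m hm m' hm' ht)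
    · intro h; exact absurd hm h
  rw [l1.eq_1 g, l1.eq_1 h]
  calc _ = ∑ m ∈ g.support, |coeff (Finsupp.tail m) h| :=
        Finset.sum_congr rfl (fun m hm => by rw [hcoeff m hm])
    _ = ∑ m ∈ g.support.image Finsupp.tail, |coeff m h| := by
        rw [Finset.sum_image]
        intro m hm m' hm' ht
        exact hinj m' hm' m hm ht
    _ ≤ _ := by
        refine Finset.sum_le_sum_of_subset_of_nonneg ?_ (fun _ _ _ => abs_nonneg _)
        intro m' hm'
        rw [Finset.mem_image] at hm'
        obtain ⟨m, hm, rfl⟩ := hm'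
        rw [mem_support_iff, hcoeff m hm]
        exact mem_support_iff.1 hm

theorem l1_map {σ : Type*} (F : MvPolynomial σ ℤ) : l1 (map (Int.castRingHom ℚ) F) = ((l1 F : ℤ) : ℚ) := by
  rw [l1_eq (support_map_subset _ _), l1.eq_1 F]
  push_cast
  simp [coeff_map]

/-- choice of the direction -/
theorem exists_dir {r d : ℕ} {g : MvPolynomial (Fin (r + 1)) ℤ} (hg : g.IsHomogeneous d) (hg0 : g ≠ 0) :
    ∃ a : Fin r → ℤ, (∀ i, 0 ≤ a i ∧ a i ≤ d) ∧ eval (Fin.cons 1 a : Fin (r + 1) → ℤ) g ≠ 0 ∧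
      l1 g ≤ |eval (Fin.cons 1 a : Fin (r + 1) → ℤ) g| * (d + 1) ^ (r * (d + 1)) := by
  classical
  obtain ⟨a, -, ha⟩ := Finset.exists_max_image (Finset.univ : Finset (Fin r → Fin (d + 1)))
    (fun a => |eval (Fin.cons 1 (fun i => ((a i : ℕ) : ℤ)) : Fin (r + 1) → ℤ) g|) ⟨0, Finset.mem_univ _⟩
  set h := aeval (Fin.cons 1 X : Fin (r + 1) → MvPolynomial (Fin r) ℤ) g with hh
  have hev : ∀ z : Fin r → ℤ, eval z h = eval (Fin.cons 1 z : Fin (r + 1) → ℤ) g := by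
    intro z
    rw [hh, ← coe_aeval_eq_eval, ← coe_aeval_eq_eval]
    change (aeval z) _ = (aeval _) _
    rw [comp_aeval_apply]
    congr 2
    ext i
    refine Fin.cases ?_ (fun i => ?_) i <;> simp
  have hhd : h.totalDegree ≤ d := by
    rw [← mem_TD, hh, aeval_def, eval₂_eq']
    refine AddSubgroup.sum_mem _ (fun m hm => ?_)
    have h1 : ∑ i, m i ≤ d := by
      have := (le_totalDegree hm).trans hg.totalDegree_le
      rw [fsum_fintype] at this
      omega
    have hT := filt_TD (R := ℤ) (Fin r)
    have hC : algebraMap ℤ (MvPolynomial (Fin r) ℤ) (coeff m g) ∈ TD (Fin r) ℤ 0 := by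
      rw [mem_TD, MvPolynomial.algebraMap_eq, totalDegree_C]
    refine hT.mono (by simpa using h1) (hT.mul hC
      (hT.prod Finset.univ _ (fun i => m i * 1) (fun i _ => hT.pow ?_ _)))
    rw [mem_TD]
    refine Fin.cases ?_ (fun i => ?_) i
    · simp
    · rw [Fin.cons_succ, totalDegree_X]
  have h1 := interp_bound (r := r) (d := d) (h := map (Int.castRingHom ℚ) h)
    (fun i => (degreeOf_le_totalDegree _ i).trans ((tdeg_map_le _ h).trans hhd))
    (|eval (Fin.cons 1 (fun i => ((a i : ℕ) : ℤ)) : Fin (r + 1) → ℤ) g| : ℤ) (by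
      intro a'
      have h2 := ha a' (Finset.mem_univ _)
      rw [← hev] at h2
      have h3 : eval (fun i => ((a' i : ℕ) : ℚ)) (map (Int.castRingHom ℚ) h) = (eval (fun i => ((a' i : ℕ) : ℤ)) h : ℤ) := by
        have := map_eval (Int.castRingHom ℚ) (fun i => ((a' i : ℕ) : ℤ)) h
        simp only [Function.comp_def, eq_intCast, Int.cast_natCast] at this
        rw [← this]
      rw [h3]
      exact_mod_cast h2)
  rw [l1_map] at h1
  have h2 : l1 h ≤ |eval (Fin.cons 1 (fun i => ((a i : ℕ) : ℤ)) : Fin (r + 1) → ℤ) g| * (d + 1) ^ (r * (d + 1)) := by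
    exact_mod_cast h1
  have h3 := (l1_dehom hg).trans h2
  refine ⟨fun i => ((a i : ℕ) : ℤ), fun i => ⟨by positivity, ?_⟩, ?_, h3⟩
  · change ((a i : ℕ) : ℤ) ≤ d
    exact_mod_cast Nat.lt_succ_iff.1 (a i).2
  · intro h0
    rw [h0, abs_zero, zero_mul] at h3
    apply hg0
    ext m
    have := (coeff_le_l1 g m).trans h3
    rw [coeff_zero]
    exact abs_nonpos_iff.1 this

end Interp
end AuxPoly

end

section

open MvPolynomial

namespace AuxPoly
section Shear

variable {R : Type*} [CommRing R] {r : ℕ}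

/-- images of the variables under the shear -/
noncomputable def shv (a : Fin r → R) : Fin (r + 1) → MvPolynomial (Fin (r + 1)) R :=
  Fin.cons (X 0) (fun i => X i.succ + C (a i) * X 0)

noncomputable def shear (a : Fin r → R) : MvPolynomial (Fin (r + 1)) R →ₐ[R] MvPolynomial (Fin (r + 1)) R :=
  aeval (shv a)

theorem shear_comp (a : Fin r → R) : (shear a).comp (shear (-a)) = AlgHom.id R _ := by
  apply algHom_ext
  intro i
  refine Fin.cases ?_ (fun i => ?_) i <;> simp [shear, shv]

noncomputable def shearE (a : Fin r → R) : MvPolynomial (Fin (r + 1)) R ≃ₐ[R] MvPolynomial (Fin (r + 1)) R :=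
  AlgEquiv.ofAlgHom (shear a) (shear (-a)) (shear_comp a) (by simpa using shear_comp (-a))

theorem shearE_apply (a : Fin r → R) (f : MvPolynomial (Fin (r + 1)) R) : shearE a f = shear a f := rfl

theorem shv_hom (a : Fin r → R) (i : Fin (r + 1)) : (shv a i).IsHomogeneous 1 := by
  refine Fin.cases ?_ (fun i => ?_) i
  · simpa [shv] using isHomogeneous_X R (0 : Fin (r + 1))
  · rw [shv, Fin.cons_succ]
    refine (isHomogeneous_X R _).add ?_
    simpa using (isHomogeneous_C (Fin (r + 1)) (a i)).mul (isHomogeneous_X R (0 : Fin (r + 1)))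

theorem shear_hom (a : Fin r → R) {g : MvPolynomial (Fin (r + 1)) R} {d : ℕ} (hg : g.IsHomogeneous d) :
    (shear a g).IsHomogeneous d := by
  have h := hg.aeval _ (shv_hom a)
  rw [one_mul] at h
  exact h

theorem shear_component (a : Fin r → R) (f : MvPolynomial (Fin (r + 1)) R) (d : ℕ) :
    homogeneousComponent d (shear a f) = shear a (homogeneousComponent d f) := by
  classical
  conv_lhs => rw [← sum_homogeneousComponent f, map_sum, map_sum]
  have h : ∀ i, homogeneousComponent d (shear a (homogeneousComponent i f)) = if i = d then shear a (homogeneousComponent i f) else 0 := by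
    intro i
    rw [homogeneousComponent_of_mem (shear_hom a (homogeneousComponent_isHomogeneous i f))]
    simp [eq_comm]
  simp_rw [h]
  rw [Finset.sum_ite_eq']
  split_ifs with hd
  · rfl
  · rw [Finset.mem_range, not_lt] at hd
    rw [homogeneousComponent_eq_zero _ _ (by omega), map_zero]

theorem shear_totalDegree (a : Fin r → R) {f : MvPolynomial (Fin (r + 1)) R} {d : ℕ} (hf : f.totalDegree ≤ d) :
    (shear a f).totalDegree ≤ d := by
  conv_lhs => rw [← sum_homogeneousComponent f, map_sum]
  refine totalDegree_finsetSum_le (fun i hi => ?_)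
  rw [Finset.mem_range] at hi
  exact (shear_hom a (homogeneousComponent_isHomogeneous i f)).totalDegree_le.trans (by omega)

theorem eval_e0 {g : MvPolynomial (Fin (r + 1)) R} {d : ℕ} (hg : g.IsHomogeneous d) :
    eval (Fin.cons 1 (fun _ => 0) : Fin (r + 1) → R) g = coeff (Finsupp.single 0 d) g := by
  classical
  rw [eval_eq', Finset.sum_eq_single (Finsupp.single 0 d)]
  · rw [Fin.prod_univ_succ]; simp
  · intro m hm hne
    have hd : m 0 + ∑ i : Fin r, m i.succ = d := by
      rw [← Fin.sum_univ_succ (f := fun i => m i)]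
      have := hg (mem_support_iff.1 hm)
      rw [Finsupp.weight_apply] at this
      simpa [Finsupp.sum_fintype] using this
    have hex : ∃ i : Fin r, m i.succ ≠ 0 := by
      by_contra hcon
      push Not at hcon
      apply hne
      ext i
      refine Fin.cases ?_ (fun i => ?_) i
      · simp [hcon] at hd; simp [hd]
      · rw [hcon i]; simp
    obtain ⟨i, hi⟩ := hex
    rw [Finset.prod_eq_zero (Finset.mem_univ i.succ), mul_zero]
    simp [hi]
  · intro h
    rw [notMem_support_iff.1 h, zero_mul]

theorem eval_shear (a : Fin r → R) (f : MvPolynomial (Fin (r + 1)) R) (y : Fin (r + 1) → R) :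
    eval y (shear a f) = eval (Fin.cons (y 0) (fun i => y i.succ + a i * y 0) : Fin (r + 1) → R) f := by
  rw [shear, ← coe_aeval_eq_eval, ← coe_aeval_eq_eval]
  change (aeval y) _ = (aeval _) _
  rw [comp_aeval_apply]
  congr 2
  ext i
  refine Fin.cases ?_ (fun i => ?_) i <;> simp [shv]

theorem coeff_shear (a : Fin r → R) {f : MvPolynomial (Fin (r + 1)) R} (d : ℕ) :
    coeff (Finsupp.single 0 d) (shear a f) = eval (Fin.cons 1 a : Fin (r + 1) → R) (homogeneousComponent d f) := by
  have h1 : coeff (Finsupp.single 0 d) (shear a f) = coeff (Finsupp.single 0 d) (homogeneousComponent d (shear a f)) := by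
    rw [coeff_homogeneousComponent, if_pos]
    simp
  rw [h1, shear_component, ← eval_e0 (shear_hom a (homogeneousComponent_isHomogeneous d f)), eval_shear]
  simp

theorem map_shear {S : Type*} [CommRing S] (φ : R →+* S) (a : Fin r → R) (f : MvPolynomial (Fin (r + 1)) R) :
    map φ (shear a f) = shear (fun i => φ (a i)) (map φ f) := by
  induction f using MvPolynomial.induction_on with
  | C c => simp [shear]
  | add p q hp hq => simp only [map_add, hp, hq]
  | mul_X p i hp =>
    simp only [map_mul, hp]
    congr 1
    refine Fin.cases ?_ (fun i => ?_) i <;> simp [shear, shv]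

theorem l1_shear {a : Fin r → ℤ} {d : ℕ} (ha : ∀ i, 0 ≤ a i ∧ a i ≤ d) {g : MvPolynomial (Fin (r + 1)) ℤ}
    (hg : g.totalDegree ≤ d) : l1 (shear a g) ≤ l1 g * (d + 1) ^ d := by
  refine l1_aeval hg _ _ (by omega) (fun i => ?_)
  refine Fin.cases ?_ (fun i => ?_) i
  · rw [shv, Fin.cons_zero, l1_X]; omega
  · rw [shv, Fin.cons_succ]
    have h1 := l1_add (X i.succ) (C (a i) * X 0 : MvPolynomial (Fin (r + 1)) ℤ)
    have h2 := l1_mul (C (a i)) (X 0 : MvPolynomial (Fin (r + 1)) ℤ)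
    rw [l1_C, l1_X, abs_of_nonneg (ha i).1] at h2
    rw [l1_X] at h1
    linarith [(ha i).2]

theorem prim_shear (a : Fin r → ℤ) {f : MvPolynomial (Fin (r + 1)) ℤ} (hf : Finset.gcd f.support f.coeff = 1) :
    Finset.gcd (shear a f).support (shear a f).coeff = 1 := by
  set c := Finset.gcd (shear a f).support (shear a f).coeff with hc
  have h1 : C c ∣ shear a f := by
    rw [C_dvd_iff_dvd_coeff]
    intro m
    by_cases hm : m ∈ (shear a f).support
    · exact Finset.gcd_dvd hm
    · rw [notMem_support_iff.1 hm]; exact dvd_zero _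
  have h2 : C c ∣ f := by
    have h3 := map_dvd (shear (-a)) h1
    have h4 := DFunLike.congr_fun (shear_comp (-a)) f
    simp only [neg_neg, AlgHom.comp_apply, AlgHom.id_apply] at h4
    rw [h4] at h3
    have h5 : shear (-a) (C c) = C c := by simp [shear]
    rwa [h5] at h3
  rw [C_dvd_iff_dvd_coeff] at h2
  have h3 : c ∣ 1 := by
    rw [← hf]
    exact Finset.dvd_gcd (fun m _ => h2 m)
  have h4 : normalize c = c := by rw [hc]; exact Finset.normalize_gcd
  rw [← h4]
  exact normalize_eq_one.2 (isUnit_of_dvd_one h3)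

/-- the conclusion after normalisation -/
def NormHyp (r d : ℕ) (f : MvPolynomial (Fin (r + 1)) ℤ) : Prop :=
  Reg d f ∧ Finset.gcd f.support f.coeff = 1 ∧ Irreducible (map (Int.castRingHom ℂ) (homogeneousComponent d f)) ∧
    l1 (homogeneousComponent d f) ≤ |coeff (Finsupp.single 0 d) f| * (d + 1) ^ ((2 * r + 1) * d)

theorem normalise {d : ℕ} (hd : 1 ≤ d) {f : MvPolynomial (Fin (r + 1)) ℤ} (hdf : d = f.totalDegree)
    (hprim : Finset.gcd f.support f.coeff = 1)
    (hirr : Irreducible (map (Int.castRingHom ℂ) (homogeneousComponent d f))) :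
    ∃ a : Fin r → ℤ, (∀ i, 0 ≤ a i ∧ a i ≤ d) ∧ NormHyp r d (shear a f) := by
  have hg := homogeneousComponent_isHomogeneous d f
  have hg0 : homogeneousComponent d f ≠ 0 := by
    intro h; rw [h, map_zero] at hirr; exact not_irreducible_zero hirr
  obtain ⟨a, ha, h1, h2⟩ := exists_dir hg hg0
  refine ⟨a, ha, ⟨shear_totalDegree a hdf.ge, ?_⟩, prim_shear a hprim, ?_, ?_⟩
  · rw [coeff_shear]; exact h1
  · rw [shear_component, map_shear]
    exact (MulEquiv.irreducible_iff (shearE (fun i => Int.castRingHom ℂ (a i)))).2 hirr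
  · rw [shear_component, coeff_shear]
    refine (l1_shear ha hg.totalDegree_le).trans ?_
    have hd1 : (1:ℤ) ≤ d + 1 := by omega
    calc _ ≤ |eval (Fin.cons 1 a : Fin (r + 1) → ℤ) (homogeneousComponent d f)| * (d + 1) ^ (r * (d + 1)) * (d + 1) ^ d :=
          mul_le_mul_of_nonneg_right h2 (by positivity)
      _ = |eval (Fin.cons 1 a : Fin (r + 1) → ℤ) (homogeneousComponent d f)| * (d + 1) ^ (r * (d + 1) + d) := by
          rw [mul_assoc, ← pow_add]
      _ ≤ _ := by
          refine mul_le_mul_of_nonneg_left (pow_le_pow_right₀ hd1 ?_) (abs_nonneg _)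
          nlinarith

end Shear
end AuxPoly

end

section

open MvPolynomial

namespace AuxPoly
section Counts

theorem card_TT (n D : ℕ) : Fintype.card (TT n D) = (D + n).choose n := by
  classical
  have h := Finset.card_finsuppAntidiag_nat_eq_choose (s := (Finset.univ : Finset (Fin (n + 1)))) D
  rw [Finset.card_univ, Fintype.card_fin] at h
  have h2 : (n + 1 + D - 1).choose D = (D + n).choose n := by
    rw [show n + 1 + D - 1 = D + n by omega]
    exact Nat.choose_symm_add
  rw [← h2, ← h, ← Finset.card_univ]
  have hdeg : ∀ m : Fin n →₀ ℕ, m.degree = ∑ i, m i := fun m => by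
    rw [Finsupp.degree_apply, ← Finsupp.sum_fintype m (fun _ a => a) (by simp)]; rfl
  refine Finset.card_nbij (fun m => Finsupp.cons (D - m.1.degree) m.1) ?_ ?_ ?_
  · intro m _
    have := m.2
    simp only [Finset.mem_coe, Finset.mem_finsuppAntidiag, Finset.subset_univ, and_true]
    rw [Fin.sum_univ_succ]
    simp only [Finsupp.cons_zero, Finsupp.cons_succ]
    rw [← hdeg]; omega
  · intro a _ b _ hab
    have := congrArg Finsupp.tail hab
    simp only [Finsupp.tail_cons] at this
    exact Subtype.ext this
  · intro m hm
    simp only [Finset.mem_coe, Finset.mem_finsuppAntidiag, Finset.subset_univ, and_true] at hm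
    rw [Fin.sum_univ_succ] at hm
    have e : (Finsupp.tail m).degree = ∑ i : Fin n, m i.succ := by
      rw [hdeg]; simp [Finsupp.tail_apply]
    refine ⟨⟨Finsupp.tail m, by omega⟩, by simp, ?_⟩
    simp only
    have e2 : D - (Finsupp.tail m).degree = m 0 := by omega
    rw [e2, Finsupp.cons_tail]

variable {r d D : ℕ}

theorem card_JJ (hD : d ≤ D) : Fintype.card (JJ r d D) + (D - d + (r + 1)).choose (r + 1) = (D + (r + 1)).choose (r + 1) := by
  rw [← card_TT, ← card_TT, ← Fintype.card_congr (sig r hD), Fintype.card_sum]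

theorem choose_step (r a d : ℕ) :
    (a + (r + 1)).choose (r + 1) + d * (a + r).choose r ≤ (a + d + (r + 1)).choose (r + 1) ∧
    (a + d + (r + 1)).choose (r + 1) ≤ (a + (r + 1)).choose (r + 1) + d * (a + d + r).choose r := by
  induction d with
  | zero => simp
  | succ d ih =>
    have h1 : (a + (d + 1) + (r + 1)).choose (r + 1) = (a + d + 1 + r).choose r + (a + d + (r + 1)).choose (r + 1) := by
      rw [show a + (d + 1) + (r + 1) = (a + d + 1 + r) + 1 by ring, Nat.choose_succ_succ']
      rw [show a + d + 1 + r = a + d + (r + 1) by ring]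
    have h2 : (a + r).choose r ≤ (a + d + 1 + r).choose r := Nat.choose_le_choose _ (by omega)
    have h3 : (a + d + r).choose r ≤ (a + d + 1 + r).choose r := Nat.choose_le_choose _ (by omega)
    rw [h1]
    have h4 : (a + (d + 1) + r) = a + d + 1 + r := by ring
    rw [h4]
    constructor <;> nlinarith [ih.1, ih.2]

theorem card_JJ_ge (hD : d ≤ D) : d * (D - d + r).choose r ≤ Fintype.card (JJ r d D) := by
  have h := (choose_step r (D - d) d).1
  rw [Nat.sub_add_cancel hD, ← card_JJ hD] at h
  omega

theorem card_JJ_le (hD : d ≤ D) : Fintype.card (JJ r d D) ≤ d * (D + r).choose r := by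
  have h := (choose_step r (D - d) d).2
  rw [Nat.sub_add_cancel hD, ← card_JJ hD] at h
  omega

theorem sum_deg_step (n D : ℕ) {D' : ℕ} (h : D' ≤ D) :
    ∑ m : TT n D, m.1.degree + D * Fintype.card (TT n D') ≤ ∑ m : TT n D', m.1.degree + D * Fintype.card (TT n D) := by
  classical
  have key : ∑ m : TT n D', (D - m.1.degree) ≤ ∑ m : TT n D, (D - m.1.degree) := by
    let e : TT n D' ↪ TT n D := ⟨fun m => ⟨m.1, m.2.trans h⟩, fun a b hab => Subtype.ext (congrArg (fun m : TT n D => m.1) hab)⟩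
    have := Finset.sum_map (Finset.univ : Finset (TT n D')) e (fun m => D - m.1.degree)
    calc _ = ∑ m ∈ (Finset.univ.map e), (D - m.1.degree) := this.symm
      _ ≤ _ := Finset.sum_le_sum_of_subset (Finset.subset_univ _)
  have h1 : ∑ m : TT n D', (D - m.1.degree) + ∑ m : TT n D', m.1.degree = D * Fintype.card (TT n D') := by
    rw [← Finset.sum_add_distrib, Finset.sum_congr rfl (fun m _ => Nat.sub_add_cancel (m.2.trans h))]
    simp [mul_comm]
  have h2 : ∑ m : TT n D, (D - m.1.degree) + ∑ m : TT n D, m.1.degree = D * Fintype.card (TT n D) := by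
    rw [← Finset.sum_add_distrib, Finset.sum_congr rfl (fun m _ => Nat.sub_add_cancel m.2)]
    simp [mul_comm]
  omega

theorem sum_JJ_le (hD : d ≤ D) :
    ∑ j : JJ r d D, j.1.1.degree + d * Fintype.card (TT (r + 1) (D - d)) ≤ D * Fintype.card (JJ r d D) := by
  have h1 := sum_deg_step (r + 1) D (Nat.sub_le D d)
  have h2 : ∑ m : TT (r + 1) D, m.1.degree = ∑ j : JJ r d D, j.1.1.degree + (∑ m : TT (r + 1) (D - d), m.1.degree + Fintype.card (TT (r + 1) (D - d)) * d) := by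
    rw [← (sig r hD).sum_comp, Fintype.sum_sum_type]
    congr 1
    rw [← smul_eq_mul, ← Finset.card_univ, ← Finset.sum_const, ← Finset.sum_add_distrib]
    refine Finset.sum_congr rfl (fun m _ => ?_)
    rw [sig_inr]
    simp
  have h3 : Fintype.card (TT (r + 1) D) = Fintype.card (JJ r d D) + Fintype.card (TT (r + 1) (D - d)) := by
    rw [← Fintype.card_congr (sig r hD), Fintype.card_sum]
  rw [h2, h3] at h1
  nlinarith

theorem eval_mono_le {n : ℕ} {B : ℝ} (x : Fin n → ℤ) (hx : ∀ i, |(x i : ℝ)| ≤ B) (m : Fin n →₀ ℕ) :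
    |((eval x (monomial m (1:ℤ)) : ℤ) : ℝ)| ≤ B ^ m.degree := by
  rw [eval_monomial, one_mul, Finsupp.prod, Finsupp.degree_apply, ← Finset.prod_pow_eq_pow_sum, Int.cast_prod, Finset.abs_prod]
  refine Finset.prod_le_prod (fun _ _ => abs_nonneg _) (fun i _ => ?_)
  rw [Int.cast_pow, abs_pow]
  exact pow_le_pow_left₀ (abs_nonneg _) (hx i) _

theorem det_ub {B : ℝ} [DecidableEq (JJ r d D)] (x : JJ r d D → Fin (r + 1) → ℤ)
    (hx : ∀ j i, |(x j i : ℝ)| ≤ B) :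
    |(((Matrix.of (fun i j : JJ r d D => eval (x i) (monomial j.1.1 (1:ℤ)))).det : ℤ) : ℝ)| ≤
      (Fintype.card (JJ r d D)).factorial * B ^ (∑ j : JJ r d D, j.1.1.degree) := by
  rw [Matrix.det_apply, Int.cast_sum]
  refine (Finset.abs_sum_le_sum_abs _ _).trans ?_
  rw [← Fintype.card_perm, ← Finset.card_univ, ← nsmul_eq_mul]
  refine Finset.sum_le_card_nsmul _ _ _ (fun σ _ => ?_)
  have h : |((Equiv.Perm.sign σ • ∏ i, (Matrix.of (fun i j : JJ r d D => eval (x i) (monomial j.1.1 (1:ℤ)))) (σ i) i : ℤ) : ℝ)|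
      = ∏ i, |((eval (x (σ i)) (monomial i.1.1 (1:ℤ)) : ℤ) : ℝ)| := by
    rcases Int.units_eq_one_or (Equiv.Perm.sign σ) with h | h <;> rw [h] <;>
      simp [Finset.abs_prod]
  rw [h, ← Finset.prod_pow_eq_pow_sum]
  exact Finset.prod_le_prod (fun _ _ => abs_nonneg _) (fun i _ => eval_mono_le _ (hx _) _)

end Counts
end AuxPoly

end

section

open MvPolynomial

namespace AuxPoly
section Prime

theorem vp_bound {r s nst : ℕ} {p x Q : ℝ} (hp : 0 < p) (hx : 0 ≤ x) (hQ : 0 ≤ Q)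
    (hr : 1 ≤ r) (hn : (nst : ℝ) ≤ p ^ r * (1 + x)) (hQs : Q ^ r = r.factorial * s) :
    ∃ k : ℕ, (r / (r + 1) * s * Q) * ((1 - x) / p) - (r + 1) * s ≤ ((k * s - nst * (k + r).choose (r + 1) : ℕ) : ℝ) := by
  set θ : ℝ := Q / p / (1 + x) with hθ
  have hθ0 : 0 ≤ θ := by positivity
  have h1x : (1 - x) ≤ 1 / (1 + x) := by
    rw [le_div_iff₀ (by positivity)]; nlinarith
  have hθ1 : Q * ((1 - x) / p) ≤ θ := by
    have : θ = Q / p * (1 / (1 + x)) := by rw [hθ]; ring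
    rw [this]
    calc Q * ((1 - x) / p) = Q / p * (1 - x) := by ring
      _ ≤ _ := mul_le_mul_of_nonneg_left h1x (by positivity)
  have hr0 : (0:ℝ) < r + 1 := by positivity
  have hrr : (0:ℝ) ≤ r / (r + 1) := by positivity
  have hL : (r / (r + 1) * s * Q) * ((1 - x) / p) - (r + 1) * s ≤ s * (r / (r + 1) * θ - (r + 1)) := by
    have := mul_le_mul_of_nonneg_left hθ1 (mul_nonneg hrr (Nat.cast_nonneg (α := ℝ) s))
    nlinarith
  have hnθ : (nst : ℝ) * θ ^ r ≤ r.factorial * s := by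
    have h2 : (1 + x) ≤ (1 + x) ^ r := le_self_pow₀ (by linarith) (by omega)
    calc (nst : ℝ) * θ ^ r ≤ p ^ r * (1 + x) * θ ^ r := mul_le_mul_of_nonneg_right hn (by positivity)
      _ ≤ p ^ r * (1 + x) ^ r * θ ^ r := by gcongr
      _ = (p * (1 + x) * θ) ^ r := by rw [mul_pow, mul_pow]
      _ = Q ^ r := by
        congr 1; rw [hθ]; field_simp
      _ = _ := hQs
  by_cases hc : ⌊θ⌋₊ < r
  · refine ⟨0, hL.trans (le_trans ?_ (Nat.cast_nonneg _))⟩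
    have h3 : θ < r := lt_of_lt_of_le (Nat.lt_floor_add_one θ) (by exact_mod_cast hc)
    have h4 : r / (r + 1) * θ ≤ 1 * θ := mul_le_mul_of_nonneg_right (by rw [div_le_one hr0]; linarith) hθ0
    apply mul_nonpos_of_nonneg_of_nonpos (Nat.cast_nonneg _)
    linarith
  · obtain ⟨k, hk⟩ := Nat.exists_eq_add_of_le (not_lt.1 hc)
    refine ⟨k, hL.trans ?_⟩
    have hkr : k + r = ⌊θ⌋₊ := by omega
    have h5 : ((k:ℝ) * s - nst * ((k + r).choose (r + 1) : ℕ)) ≤ ((k * s - nst * (k + r).choose (r + 1) : ℕ) : ℝ) := by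
      have h6 : k * s ≤ (k * s - nst * (k + r).choose (r + 1)) + nst * (k + r).choose (r + 1) := by omega
      have h7 : ((k * s : ℕ) : ℝ) ≤ (((k * s - nst * (k + r).choose (r + 1)) + nst * (k + r).choose (r + 1) : ℕ) : ℝ) := by
        exact_mod_cast h6
      push_cast at h7 ⊢
      linarith
    refine le_trans ?_ h5
    have h8 : (((k + r).choose (r + 1) : ℕ) : ℝ) ≤ θ ^ (r + 1) / (r + 1).factorial := by
      refine (Nat.choose_le_pow_div (r + 1) (k + r)).trans ?_
      gcongr
      rw [hkr]; exact Nat.floor_le hθ0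
    have h9 : (nst : ℝ) * ((k + r).choose (r + 1) : ℕ) ≤ s * θ / (r + 1) := by
      calc (nst : ℝ) * ((k + r).choose (r + 1) : ℕ) ≤ nst * (θ ^ (r + 1) / (r + 1).factorial) :=
            mul_le_mul_of_nonneg_left h8 (by positivity)
        _ = (nst * θ ^ r) * (θ / (r + 1).factorial) := by ring
        _ ≤ (r.factorial * s) * (θ / (r + 1).factorial) := mul_le_mul_of_nonneg_right hnθ (by positivity)
        _ = _ := by
          rw [Nat.factorial_succ]; push_cast
          have : (r.factorial : ℝ) ≠ 0 := by positivity
          field_simp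
    have h10 : θ - (r + 1) ≤ k := by
      have := Nat.lt_floor_add_one θ
      rw [← hkr] at this; push_cast at this; linarith
    have h11 : (s:ℝ) * (θ - (r + 1)) ≤ s * k := mul_le_mul_of_nonneg_left h10 (by positivity)
    have h12 : (s:ℝ) * (r / (r + 1) * θ - (r + 1)) = s * (θ - (r + 1)) - s * θ / (r + 1) := by
      field_simp; ring
    rw [h12]; nlinarith

theorem map_homComp {σ R S : Type*} [CommRing R] [CommRing S] (φ : R →+* S) (d : ℕ) (f : MvPolynomial σ R) :
    homogeneousComponent d (map φ f) = map φ (homogeneousComponent d f) := by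
  classical
  ext m
  rw [coeff_homogeneousComponent, coeff_map, coeff_map, coeff_homogeneousComponent]
  split_ifs <;> simp

theorem gram_section_mod {r d p : ℕ} {f : MvPolynomial (Fin (r + 1)) ℤ} [Fact p.Prime] {v β : Fin r → ℤ}
    (h : ¬ (p : ℤ) ∣ (gram d (aeval (line v β) (homogeneousComponent d f))).det) :
    (gram d (aeval (line (fun i => (v i : ZMod p)) (fun i => (β i : ZMod p)))
      (homogeneousComponent d (map (Int.castRingHom (ZMod p)) f)))).det ≠ 0 := by
  intro h0
  apply h
  rw [← ZMod.intCast_zmod_eq_zero_iff_dvd]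
  have h1 := gram_det_map (Int.castRingHom (ZMod p)) d (aeval (line v β) (homogeneousComponent d f))
  rw [aeval_line_map] at h1
  rw [map_homComp] at h0
  have h2 : (aeval (line (fun i => (v i : ZMod p)) (fun i => (β i : ZMod p)))) (map (Int.castRingHom (ZMod p)) (homogeneousComponent d f))
     = aeval (line (fun i => (v i : ZMod p)) (fun i => (β i : ZMod p))) (homogeneousComponent d f) := by
    exact aeval_map_algebraMap (ZMod p) _ _
  rw [h2] at h0
  rw [← eq_intCast (Int.castRingHom (ZMod p)), h1]
  exact h0

theorem log_det_lb {r d D : ℕ} (hr : 1 ≤ r) (hd : 1 ≤ d) (hD : d ≤ D) {f : MvPolynomial (Fin (r + 1)) ℤ} (H : Reg d f)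
    (hprim : Finset.gcd f.support f.coeff = 1) {v β : Fin r → ℤ} [DecidableEq (JJ r d D)]
    (x : JJ r d D → Fin (r + 1) → ℤ) (hx : ∀ i, eval (x i) f = 0)
    (hdet : (Matrix.of (fun i j : JJ r d D => eval (x i) (monomial j.1.1 (1:ℤ)))).det ≠ 0)
    (P : Finset ℕ) (hP : ∀ p ∈ P, p.Prime ∧ 100 * d ^ 4 ≤ p ∧ ¬ (p : ℤ) ∣ f.coeff (Finsupp.single 0 d) ∧
      ¬ (p : ℤ) ∣ (gram d (aeval (line v β) (homogeneousComponent d f))).det)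
    {Q : ℝ} (hQ : 0 ≤ Q) (hQs : Q ^ r = r.factorial * Fintype.card (JJ r d D)) :
    Fintype.card (TT (r + 1) (D - d)) * Real.log |((f.coeff (Finsupp.single 0 d) : ℤ) : ℝ)| +
      ∑ p ∈ P, ((r / (r + 1) * Fintype.card (JJ r d D) * Q) * ((1 - 10 * d ^ 2 / √p) / p) - (r + 1) * Fintype.card (JJ r d D)) * Real.log p
    ≤ Real.log |(((Matrix.of (fun i j : JJ r d D => eval (x i) (monomial j.1.1 (1:ℤ)))).det : ℤ) : ℝ)| := by
  classical
  set Δ := (Matrix.of (fun i j : JJ r d D => eval (x i) (monomial j.1.1 (1:ℤ)))).det with hΔ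
  set b := f.coeff (Finsupp.single 0 d) with hb
  set s := Fintype.card (JJ r d D) with hs
  have hb0 : b ≠ 0 := H.2
  have key : ∀ p ∈ P, ∃ e : ℕ, (r / (r + 1) * s * Q) * ((1 - 10 * d ^ 2 / √p) / p) - (r + 1) * s ≤ (e : ℝ) ∧ (p : ℤ) ^ e ∣ Δ := by
    intro p hp
    obtain ⟨hpp, hp4, hpb, hpN⟩ := hP p hp
    have : Fact p.Prime := ⟨hpp⟩
    have hR : Reg d (map (Int.castRingHom (ZMod p)) f) := by
      refine ⟨(tdeg_map_le _ f).trans H.1, ?_⟩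
      rw [coeff_map, eq_intCast, Ne, ZMod.intCast_zmod_eq_zero_iff_dvd]
      exact hpb
    have hn := nstar_le hd hR hp4 _ _ (gram_section_mod hpN)
    obtain ⟨k, hk⟩ := vp_bound (s := s) (Nat.cast_pos.2 hpp.pos) (by positivity) hQ hr hn hQs
    refine ⟨_, hk, ?_⟩
    exact pdet_dvd hR x hx (fun j => monomial j.1.1 (1:ℤ)) k
  choose! e he1 he2 using key
  have hbd : b ^ Fintype.card (TT (r + 1) (D - d)) ∣ Δ := bR_dvd H hD hprim x hx
  have hprod : ∏ p ∈ P, (p : ℤ) ^ e p ∣ Δ := by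
    refine Finset.prod_dvd_of_coprime ?_ (fun p hp => he2 p hp)
    intro p hp q hq hpq
    refine IsCoprime.pow ?_
    rw [Nat.isCoprime_iff_coprime]
    exact (Nat.coprime_primes (hP p hp).1 (hP q hq).1).2 hpq
  have hall : b ^ Fintype.card (TT (r + 1) (D - d)) * ∏ p ∈ P, (p : ℤ) ^ e p ∣ Δ := by
    refine IsCoprime.mul_dvd ?_ hbd hprod
    refine IsCoprime.prod_right (fun p hp => IsCoprime.pow ?_)
    exact ((Nat.prime_iff_prime_int.1 (hP p hp).1).coprime_iff_not_dvd.2 (hP p hp).2.2.1).symm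
  have hle : |(b : ℝ)| ^ Fintype.card (TT (r + 1) (D - d)) * ∏ p ∈ P, (p : ℝ) ^ e p ≤ |(Δ : ℝ)| := by
    have h1 := Int.le_of_dvd (abs_pos.2 hdet) ((dvd_abs _ _).2 ((abs_dvd _ _).2 hall))
    rw [abs_mul, abs_pow, Finset.abs_prod] at h1
    have h2 : ∏ p ∈ P, |(p : ℤ) ^ e p| = ∏ p ∈ P, (p : ℤ) ^ e p := by
      refine Finset.prod_congr rfl (fun p _ => abs_of_nonneg (by positivity))
    rw [h2] at h1
    exact_mod_cast h1
  have hbp : (0:ℝ) < |(b:ℝ)| := abs_pos.2 (by exact_mod_cast hb0)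
  have hpp : ∀ p ∈ P, (0:ℝ) < (p : ℝ) ^ e p := fun p hp => pow_pos (Nat.cast_pos.2 (hP p hp).1.pos) _
  have hlog := Real.log_le_log (mul_pos (pow_pos hbp _) (Finset.prod_pos hpp)) hle
  rw [Real.log_mul (pow_pos hbp _).ne' (Finset.prod_pos hpp).ne', Real.log_pow, Real.log_prod (fun p hp => (hpp p hp).ne')] at hlog
  refine le_trans ?_ hlog
  gcongr with p hp
  rw [Real.log_pow]
  exact mul_le_mul_of_nonneg_right (he1 p hp) (Real.log_natCast_nonneg p)

end Prime
end AuxPoly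

end

section

namespace AuxPoly
section Mertens

def pr (N : ℕ) : Finset ℕ := (Finset.range (N + 1)).filter Nat.Prime

theorem mem_pr {N p : ℕ} : p ∈ pr N ↔ p.Prime ∧ p ≤ N := by
  simp [pr, and_comm]

theorem theta_pr (N : ℕ) : ∑ p ∈ pr N, Real.log p ≤ 2 * N := by
  have h := Chebyshev.theta_le_log4_mul_x (Nat.cast_nonneg (α := ℝ) N)
  have h2 : Chebyshev.theta N = ∑ p ∈ pr N, Real.log p := by
    rw [Chebyshev.theta_eq_sum_Icc, Nat.floor_natCast]
    refine Finset.sum_congr ?_ (fun _ _ => rfl)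
    ext p
    rw [mem_pr, Finset.mem_filter, Finset.mem_Icc]
    constructor
    · rintro ⟨h1, h2⟩; exact ⟨h2, h1.2⟩
    · rintro ⟨h1, h2⟩; exact ⟨⟨Nat.zero_le _, h2⟩, h1⟩
  rw [← h2]
  refine h.trans (mul_le_mul_of_nonneg_right ?_ (Nat.cast_nonneg _))
  have : Real.log 4 = 2 * Real.log 2 := by
    rw [show (4:ℝ) = 2 ^ 2 by norm_num, Real.log_pow]; norm_num
  rw [this]; linarith [Real.log_two_lt_d9]

theorem log_fact (N : ℕ) : Real.log (N.factorial : ℝ) = ∑ p ∈ pr N, (N.factorial.factorization p : ℝ) * Real.log p := by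
  rw [Real.log_nat_eq_sum_factorization, Finsupp.sum]
  refine Finset.sum_subset ?_ ?_
  · intro p hp
    rw [Nat.support_factorization, Nat.mem_primeFactors] at hp
    exact mem_pr.2 ⟨hp.1, (hp.1.dvd_factorial).1 hp.2.1⟩
  · intro p _ hp
    rw [Finsupp.notMem_support_iff.1 hp]; simp

theorem mertens_upper {N : ℕ} (hN : 1 ≤ N) : ∑ p ∈ pr N, Real.log p / p ≤ Real.log N + 3 := by
  have hN0 : (0:ℝ) < N := by exact_mod_cast hN
  have h1 : ∀ p ∈ pr N, (N / p - 1 : ℝ) * Real.log p ≤ (N.factorial.factorization p : ℝ) * Real.log p := by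
    intro p hp
    have hpp := (mem_pr.1 hp).1
    refine mul_le_mul_of_nonneg_right ?_ (Real.log_natCast_nonneg p)
    have h2 : N / p ≤ N.factorial.factorization p := by
      rw [Nat.factorization_factorial hpp (Nat.lt_add_of_pos_right (n := Nat.log p N) (k := 2) (by omega))]
      have := Finset.single_le_sum (f := fun i => N / p ^ i) (s := Finset.Ico 1 (Nat.log p N + 2)) (fun _ _ => Nat.zero_le _)
        (Finset.mem_Ico.2 ⟨le_refl 1, by omega⟩)
      simpa using this
    have h3 : ((N / p : ℕ) : ℝ) ≤ N.factorial.factorization p := by exact_mod_cast h2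
    have h4 : (N / p : ℝ) < ((N / p : ℕ) : ℝ) + 1 := by
      have := Nat.lt_floor_add_one ((N:ℝ) / p)
      rwa [Nat.floor_div_eq_div] at this
    linarith
  have h5 := Finset.sum_le_sum h1
  rw [← log_fact] at h5
  have h6 : Real.log (N.factorial : ℝ) ≤ N * Real.log N := by
    rw [← Real.log_pow]
    refine Real.log_le_log (by exact_mod_cast Nat.factorial_pos N) ?_
    exact_mod_cast Nat.factorial_le_pow N
  have h7 : ∑ p ∈ pr N, (N / p - 1 : ℝ) * Real.log p = N * ∑ p ∈ pr N, Real.log p / p - ∑ p ∈ pr N, Real.log p := by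
    rw [Finset.mul_sum, ← Finset.sum_sub_distrib]
    refine Finset.sum_congr rfl (fun p _ => by ring)
  have h8 := theta_pr N
  have h9 : N * ∑ p ∈ pr N, Real.log p / p ≤ N * (Real.log N + 3) := by nlinarith
  exact le_of_mul_le_mul_left h9 hN0

theorem rpow_sum_le {δ : ℝ} (hδ : 0 < δ) : ∃ C : ℝ, 0 ≤ C ∧ ∀ s : Finset ℕ, ∑ m ∈ s, (m : ℝ) ^ (-1 - δ) ≤ C := by
  have h : Summable (fun m : ℕ => (m : ℝ) ^ (-1 - δ)) := Real.summable_nat_rpow.2 (by linarith)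
  refine ⟨∑' m : ℕ, (m : ℝ) ^ (-1 - δ), tsum_nonneg (fun _ => by positivity), fun s => ?_⟩
  exact h.sum_le_tsum s (fun _ _ => by positivity)

theorem mertens_lower : ∃ C : ℝ, 0 ≤ C ∧ ∀ N : ℕ, 1 ≤ N → Real.log N - C ≤ ∑ p ∈ pr N, Real.log p / p := by
  obtain ⟨C, hC, hs⟩ := rpow_sum_le (δ := 1 / 2) (by norm_num)
  refine ⟨4 * C + 1, by positivity, fun N hN => ?_⟩
  have hN0 : (0:ℝ) < N := by exact_mod_cast hN
  have h1 : ∀ p ∈ pr N, (N.factorial.factorization p : ℝ) * Real.log p ≤ N * (Real.log p / p) + N * (4 * (p : ℝ) ^ (-1 - 1 / 2 : ℝ)) := by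
    intro p hp
    have hpp := (mem_pr.1 hp).1
    have : Fact p.Prime := ⟨hpp⟩
    have h2 := sub_one_mul_padicValNat_factorial (p := p) N
    rw [← Nat.factorization_def _ hpp] at h2
    have h3 : (p - 1) * N.factorial.factorization p ≤ N := by omega
    have hp2 : (2:ℝ) ≤ p := by exact_mod_cast hpp.two_le
    have h4 : ((p:ℝ) - 1) * N.factorial.factorization p ≤ N := by
      have h5 : (((p - 1) * N.factorial.factorization p : ℕ) : ℝ) ≤ N := by exact_mod_cast h3
      rw [Nat.cast_mul, Nat.cast_sub hpp.one_le] at h5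
      simpa using h5
    have hl : Real.log p ≤ 2 * (p:ℝ) ^ (1 / 2 : ℝ) := by
      have := Real.log_le_rpow_div (x := p) (by positivity) (ε := 1 / 2) (by norm_num)
      linarith
    have hl0 := Real.log_natCast_nonneg p
    have h6 : (N.factorial.factorization p : ℝ) ≤ N / (p - 1) := by
      rw [le_div_iff₀ (by linarith)]; linarith
    have h7 : (N : ℝ) / (p - 1) * Real.log p ≤ N * (Real.log p / p) + N * (2 / p ^ 2 * Real.log p) := by
      have h8 : 1 / ((p:ℝ) - 1) ≤ 1 / p + 2 / p ^ 2 := by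
        rw [div_add_div _ _ (by positivity) (by positivity), div_le_div_iff₀ (by linarith) (by positivity)]
        nlinarith
      calc (N : ℝ) / (p - 1) * Real.log p = N * Real.log p * (1 / (p - 1)) := by ring
        _ ≤ N * Real.log p * (1 / p + 2 / p ^ 2) := mul_le_mul_of_nonneg_left h8 (by positivity)
        _ = _ := by ring
    have h9 : (p : ℝ) ^ (-1 - 1 / 2 : ℝ) = (p : ℝ) ^ (1 / 2 : ℝ) / p ^ 2 := by
      rw [← Real.rpow_natCast, ← Real.rpow_sub (by linarith)]; norm_num
    have h10 : 2 / (p:ℝ) ^ 2 * Real.log p ≤ 4 * (p : ℝ) ^ (-1 - 1 / 2 : ℝ) := by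
      rw [h9]
      calc 2 / (p:ℝ) ^ 2 * Real.log p ≤ 2 / (p:ℝ) ^ 2 * (2 * (p:ℝ) ^ (1 / 2 : ℝ)) := mul_le_mul_of_nonneg_left hl (by positivity)
        _ = _ := by ring
    calc (N.factorial.factorization p : ℝ) * Real.log p ≤ N / (p - 1) * Real.log p := mul_le_mul_of_nonneg_right h6 hl0
      _ ≤ _ := h7
      _ ≤ _ := by gcongr
  have h2 := Finset.sum_le_sum h1
  rw [← log_fact, Finset.sum_add_distrib, ← Finset.mul_sum, ← Finset.mul_sum, ← Finset.mul_sum] at h2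
  have h3 := hs (pr N)
  have h4 := Stirling.le_log_factorial_stirling (n := N) (by omega)
  have h5 : 0 ≤ Real.log (2 * Real.pi) := Real.log_nonneg (by linarith [Real.two_le_pi])
  have h6 := Real.log_natCast_nonneg N
  have h7 : N * (Real.log N - (4 * C + 1)) ≤ N * ∑ p ∈ pr N, Real.log p / p := by
    have h8 : (N:ℝ) * (4 * ∑ p ∈ pr N, (p : ℝ) ^ (-1 - 1 / 2 : ℝ)) ≤ N * (4 * C) :=
      mul_le_mul_of_nonneg_left (by linarith) hN0.le
    linarith
  exact le_of_mul_le_mul_left h7 hN0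

end Mertens
end AuxPoly

end

section

namespace AuxPoly
section PrimeSum

open Classical in
noncomputable def gp (W Q : ℝ) (B : ℕ) : Finset ℕ := (pr ⌊Q⌋₊).filter (fun p => W < p ∧ ¬ p ∣ B)

theorem err_term {η δ d p : ℝ} (hη : 0 < η) (hδ : δ = η / (4 * (4 + η))) (hd : 1 ≤ d) (hp : d ^ (4 + η) ≤ p) :
    10 * d ^ 2 / √p / p * Real.log p ≤ 10 / δ * p ^ (-1 - δ) := by
  have hδ0 : 0 < δ := by rw [hδ]; positivity
  have hp0 : 0 < p := lt_of_lt_of_le (Real.rpow_pos_of_pos (by linarith) _) hp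
  have hlog := Real.log_le_rpow_div hp0.le hδ0
  have h1 : d ^ 2 ≤ p ^ (1 / 2 - 2 * δ) := by
    have e : (1 / 2 - 2 * δ) = 2 / (4 + η) := by rw [hδ]; field_simp; ring
    rw [e]
    calc d ^ 2 = (d ^ (4 + η)) ^ (2 / (4 + η)) := by
          rw [← Real.rpow_mul (by linarith), mul_div_cancel₀ _ (by positivity)]; norm_num
      _ ≤ _ := Real.rpow_le_rpow (Real.rpow_nonneg (by linarith) _) hp (by positivity)
  have hs : √p = p ^ (1 / 2 : ℝ) := Real.sqrt_eq_rpow p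
  calc 10 * d ^ 2 / √p / p * Real.log p ≤ 10 * p ^ (1 / 2 - 2 * δ) / √p / p * (p ^ δ / δ) := by
        have hl0 : 0 ≤ Real.log p := Real.log_nonneg (le_trans (Real.one_le_rpow hd (by linarith)) hp)
        gcongr
    _ = 10 / δ * (p ^ (1 / 2 - 2 * δ) * p ^ δ / (p ^ (1 / 2 : ℝ) * p ^ (1:ℝ))) := by
        rw [hs, Real.rpow_one]; field_simp
    _ = _ := by
        rw [← Real.rpow_add hp0, ← Real.rpow_add hp0, ← Real.rpow_sub hp0]
        congr 2; ring

theorem prime_sum {η : ℝ} (hη : 0 < η) : ∃ C : ℝ, 0 ≤ C ∧ ∀ (d W Q : ℝ) (B : ℕ), 1 ≤ d → d ^ (4 + η) ≤ W →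
    B ≠ 0 → Real.log B ≤ W → 1 ≤ Q →
    Real.log Q - Real.log W - C ≤ ∑ p ∈ gp W Q B, (1 - 10 * d ^ 2 / √p) / p * Real.log p := by
  classical
  obtain ⟨C1, hC1, h1⟩ := mertens_lower
  set δ := η / (4 * (4 + η)) with hδ
  have hδ0 : 0 < δ := by positivity
  obtain ⟨C2, hC2, h2⟩ := rpow_sum_le hδ0
  refine ⟨C1 + 5 + 10 / δ * C2, by positivity, fun d W Q B hd hW hB hBW hQ => ?_⟩
  have hW1 : 1 ≤ W := le_trans (Real.one_le_rpow hd (by linarith)) hW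
  have hlogp : ∀ p : ℕ, 0 ≤ Real.log p / p := fun p => div_nonneg (Real.log_natCast_nonneg p) (Nat.cast_nonneg _)
  -- error
  have herr : ∑ p ∈ gp W Q B, 10 * d ^ 2 / √p / p * Real.log p ≤ 10 / δ * C2 := by
    calc _ ≤ ∑ p ∈ gp W Q B, 10 / δ * (p:ℝ) ^ (-1 - δ) := by
          refine Finset.sum_le_sum (fun p hp => err_term hη hδ hd (hW.trans ?_))
          rw [gp, Finset.mem_filter] at hp
          exact hp.2.1.le
      _ ≤ _ := by
          rw [← Finset.mul_sum]
          exact mul_le_mul_of_nonneg_left (h2 _) (by positivity)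
  -- main
  have hQf : 1 ≤ ⌊Q⌋₊ := (Nat.one_le_floor_iff Q).2 hQ
  have hmain := h1 _ hQf
  have hQl : Real.log Q - 1 ≤ Real.log ⌊Q⌋₊ := by
    have h3 : Q / 2 ≤ ⌊Q⌋₊ := by
      have := Nat.lt_floor_add_one Q
      have h4 : (1:ℝ) ≤ ⌊Q⌋₊ := by exact_mod_cast hQf
      linarith
    have h4 := Real.log_le_log (by positivity) h3
    rw [Real.log_div (by positivity) (by norm_num)] at h4
    linarith [Real.log_two_lt_d9]
  have hbad : ∑ p ∈ B.primeFactors.filter (fun p : ℕ => W < (p:ℝ)), Real.log p / p ≤ 1 := by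
    calc _ ≤ ∑ p ∈ B.primeFactors.filter (fun p : ℕ => W < (p:ℝ)), Real.log p / W := by
          refine Finset.sum_le_sum (fun p hp => ?_)
          rw [Finset.mem_filter] at hp
          exact div_le_div_of_nonneg_left (Real.log_natCast_nonneg p) (by linarith) hp.2.le
      _ ≤ ∑ p ∈ B.primeFactors, Real.log p / W :=
          Finset.sum_le_sum_of_subset_of_nonneg (Finset.filter_subset _ _) (fun p _ _ => div_nonneg (Real.log_natCast_nonneg p) (by linarith))
      _ = Real.log (∏ p ∈ B.primeFactors, p : ℕ) / W := by
          rw [← Finset.sum_div, Nat.cast_prod, Real.log_prod]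
          intro p hp; exact_mod_cast (Nat.prime_of_mem_primeFactors hp).ne_zero
      _ ≤ Real.log B / W := by
          refine div_le_div_of_nonneg_right (Real.log_le_log ?_ ?_) (by linarith)
          · exact_mod_cast Finset.prod_pos (fun p hp => (Nat.prime_of_mem_primeFactors hp).pos)
          · exact_mod_cast Nat.le_of_dvd (Nat.pos_of_ne_zero hB) (Nat.prod_primeFactors_dvd B)
      _ ≤ 1 := by rw [div_le_one (by linarith)]; exact hBW
  have hsm := mertens_upper ((Nat.one_le_floor_iff W).2 hW1)
  have hWl : Real.log ⌊W⌋₊ ≤ Real.log W := Real.log_le_log (by exact_mod_cast (Nat.one_le_floor_iff W).2 hW1) (Nat.floor_le (by linarith))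
  have hsub : pr ⌊Q⌋₊ ⊆ (gp W Q B ∪ pr ⌊W⌋₊) ∪ B.primeFactors.filter (fun p : ℕ => W < (p:ℝ)) := by
    intro p hp
    by_cases h3 : W < p
    · by_cases h4 : p ∣ B
      · exact Finset.mem_union_right _ (Finset.mem_filter.2 ⟨Nat.mem_primeFactors.2 ⟨(mem_pr.1 hp).1, h4, hB⟩, h3⟩)
      · exact Finset.mem_union_left _ (Finset.mem_union_left _ (Finset.mem_filter.2 ⟨hp, h3, h4⟩))
    · exact Finset.mem_union_left _ (Finset.mem_union_right _ (mem_pr.2 ⟨(mem_pr.1 hp).1, Nat.le_floor (not_lt.1 h3)⟩))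
  have hun : ∀ s t : Finset ℕ, ∑ p ∈ s ∪ t, Real.log p / p ≤ ∑ p ∈ s, Real.log p / p + ∑ p ∈ t, Real.log p / p := by
    intro s t
    rw [← Finset.sum_union_inter]
    have := Finset.sum_nonneg (s := s ∩ t) (fun p _ => hlogp p)
    linarith
  have htot : ∑ p ∈ pr ⌊Q⌋₊, Real.log p / p ≤ ∑ p ∈ gp W Q B, Real.log p / p + ∑ p ∈ pr ⌊W⌋₊, Real.log p / p +
      ∑ p ∈ B.primeFactors.filter (fun p : ℕ => W < (p:ℝ)), Real.log p / p := by
    refine (Finset.sum_le_sum_of_subset_of_nonneg hsub (fun p _ _ => hlogp p)).trans ?_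
    refine (hun _ _).trans ?_
    linarith [hun (gp W Q B) (pr ⌊W⌋₊)]
  have hsplit : ∑ p ∈ gp W Q B, (1 - 10 * d ^ 2 / √p) / p * Real.log p =
      ∑ p ∈ gp W Q B, Real.log p / p - ∑ p ∈ gp W Q B, 10 * d ^ 2 / √p / p * Real.log p := by
    rw [← Finset.sum_sub_distrib]
    refine Finset.sum_congr rfl (fun p _ => by ring)
  rw [hsplit]
  linarith

theorem gp_theta {W Q : ℝ} {B : ℕ} (hQ : 0 ≤ Q) : ∑ p ∈ gp W Q B, Real.log p ≤ 2 * Q := by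
  classical
  calc _ ≤ ∑ p ∈ pr ⌊Q⌋₊, Real.log p :=
        Finset.sum_le_sum_of_subset_of_nonneg (Finset.filter_subset _ _) (fun p _ _ => Real.log_natCast_nonneg p)
    _ ≤ 2 * ⌊Q⌋₊ := theta_pr _
    _ ≤ _ := by linarith [Nat.floor_le hQ]

end PrimeSum
end AuxPoly

end

section

open MvPolynomial

namespace AuxPoly
section SecLog

theorem sec_log {r d : ℕ} (hd : 1 ≤ d) {f : MvPolynomial (Fin (r + 1)) ℤ} (hf : NormHyp r d f) :
    ∃ v β : Fin r → ℤ, (gram d (aeval (line v β) (homogeneousComponent d f))).det ≠ 0 ∧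
      Real.log |((f.coeff (Finsupp.single 0 d) : ℤ) : ℝ)| +
      Real.log |((gram d (aeval (line v β) (homogeneousComponent d f))).det : ℝ)| ≤
        (8 * r + 46) * ((d:ℝ) ^ 2 * Real.log |((f.coeff (Finsupp.single 0 d) : ℤ) : ℝ)| + (d:ℝ) ^ 4) := by
  obtain ⟨hR, hprim, hirr, hl⟩ := hf
  set g := homogeneousComponent d f with hg
  have hgd : g.totalDegree ≤ d := (homogeneousComponent_isHomogeneous d f).totalDegree_le
  have hcoef : g.coeff (Finsupp.single 0 d) = f.coeff (Finsupp.single 0 d) := by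
    rw [hg, coeff_homogeneousComponent, if_pos]; simp
  have hgR : Reg d g := ⟨hgd, by rw [hcoef]; exact hR.2⟩
  obtain ⟨v, β, hv, hβ, hN⟩ := bertini hd hgR hirr
  refine ⟨v, β, hN, ?_⟩
  set b := f.coeff (Finsupp.single 0 d) with hb
  set N := (gram d (aeval (line v β) g)).det with hNdef
  have hb1 : 1 ≤ |b| := Int.one_le_abs hR.2
  have hl1 : 1 ≤ l1 g := by
    have := coeff_le_l1 g (Finsupp.single 0 d)
    rw [hcoef] at this
    omega
  have hbd := section_bound hd hgd hl1 hv hβ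
  have hbR : (1:ℝ) ≤ |(b:ℝ)| := by exact_mod_cast hb1
  have hlR : ((l1 g : ℤ) : ℝ) ≤ |(b:ℝ)| * (d + 1) ^ ((2 * r + 1) * d) := by exact_mod_cast hl
  have hl1R : (1:ℝ) ≤ ((l1 g : ℤ) : ℝ) := by exact_mod_cast hl1
  have hNR : |(N:ℝ)| ≤ (72 * (d:ℝ) ^ 6 * (((l1 g : ℤ) : ℝ) * (4 * (d:ℝ) ^ 3) ^ d) ^ 2) ^ (2 * d ^ 2) := by exact_mod_cast hbd
  have hN1 : (0:ℝ) < |(N:ℝ)| := abs_pos.2 (by exact_mod_cast hN)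
  have hdR : (1:ℝ) ≤ d := by exact_mod_cast hd
  have hlb : 0 ≤ Real.log |(b:ℝ)| := Real.log_nonneg hbR
  have h1 : Real.log ((l1 g : ℤ) : ℝ) ≤ Real.log |(b:ℝ)| + (2 * r + 1) * d ^ 2 := by
    have h2 := Real.log_le_log (by linarith) hlR
    rw [Real.log_mul (by positivity) (by positivity), Real.log_pow] at h2
    have h3 : Real.log ((d:ℝ) + 1) ≤ d := by
      have := Real.log_le_sub_one_of_pos (x := (d:ℝ) + 1) (by positivity); linarith
    have h4 := mul_le_mul_of_nonneg_left h3 (Nat.cast_nonneg (α := ℝ) ((2 * r + 1) * d))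
    push_cast at h2 h4
    nlinarith
  have hlogd : Real.log (d:ℝ) ≤ d := (Real.log_le_self (by positivity))
  have hlogd0 : 0 ≤ Real.log (d:ℝ) := Real.log_natCast_nonneg d
  have h72 : Real.log 72 ≤ 5 := by
    have : Real.log 72 ≤ Real.log (2 ^ 7) := Real.log_le_log (by norm_num) (by norm_num)
    rw [Real.log_pow] at this
    have h2 := Real.log_two_lt_d9
    norm_num at this; linarith
  have h4 : Real.log 4 ≤ 2 := by
    have : Real.log 4 = 2 * Real.log 2 := by
      rw [show (4:ℝ) = 2 ^ 2 by norm_num, Real.log_pow]; norm_num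
    linarith [Real.log_two_lt_d9]
  have h5 : Real.log |(N:ℝ)| ≤ 2 * d ^ 2 * (5 + 6 * d + 2 * (Real.log ((l1 g : ℤ) : ℝ) + d * (2 + 3 * d))) := by
    have h6 := Real.log_le_log hN1 hNR
    have hl0 : ((l1 g : ℤ) : ℝ) ≠ 0 := by positivity
    have hd0 : (d:ℝ) ≠ 0 := by positivity
    rw [Real.log_pow, Real.log_mul (by positivity) (by positivity), Real.log_mul (by norm_num) (by positivity), Real.log_pow, Real.log_pow,
      Real.log_mul hl0 (by positivity), Real.log_pow, Real.log_mul (by norm_num) (by positivity), Real.log_pow] at h6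
    refine h6.trans ?_
    push_cast
    have h7 : (d:ℝ) * (Real.log 4 + 3 * Real.log d) ≤ d * (2 + 3 * d) := mul_le_mul_of_nonneg_left (by linarith) (by positivity)
    refine mul_le_mul_of_nonneg_left ?_ (by positivity)
    linarith
  have hd2 : (d:ℝ) ≤ d ^ 2 := by nlinarith
  have hd21 : (1:ℝ) ≤ d ^ 2 := by nlinarith
  have h8 : Real.log |(N:ℝ)| ≤ 2 * d ^ 2 * (2 * Real.log |(b:ℝ)| + (4 * r + 23) * d ^ 2) := by
    refine h5.trans (mul_le_mul_of_nonneg_left ?_ (by positivity))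
    nlinarith
  have hr0 : (0:ℝ) ≤ r := Nat.cast_nonneg r
  have h9 : Real.log |(b:ℝ)| ≤ d ^ 2 * Real.log |(b:ℝ)| := by nlinarith
  have h10 : 0 ≤ (r:ℝ) * (d ^ 2 * Real.log |(b:ℝ)|) := by positivity
  nlinarith

end SecLog
end AuxPoly

end

section

namespace AuxPoly
section RealLemmas

theorem bern {d D : ℝ} {r : ℕ} (hd : 1 ≤ d) (hD : d ≤ D) (k : ℕ) :
    1 - k * ((d + r) / (D + r)) ≤ ((D - d) / (D + r)) ^ k := by
  have hDr : 0 < D + r := by have : (0:ℝ) ≤ r := Nat.cast_nonneg r; linarith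
  have e : (D - d) / (D + r) = 1 + (-((d + r) / (D + r))) := by field_simp; ring
  have h1 : (d + r) / (D + r) ≤ 1 := by rw [div_le_one hDr]; linarith
  rw [e]
  have := one_add_mul_le_pow (a := -((d + r) / (D + r))) (by linarith) k
  linarith

theorem countE {r : ℕ} {d D s R E : ℝ} (hr : 1 ≤ r) (hd : 1 ≤ d) (hD : d ≤ D) (hs0 : 0 ≤ s) (hR0 : 0 ≤ R)
    (hs : s * r.factorial ≤ d * (D + r) ^ r) (hR : (D - d) ^ (r + 1) ≤ (r + 1).factorial * R) (hE : E + d * R ≤ D * s) :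
    E ≤ r / (r + 1) * s * (D + (r + 2) * d) := by
  have hr0 : (1:ℝ) ≤ r := by exact_mod_cast hr
  have hDr : 0 < D + r := by linarith
  have hf : (0:ℝ) < r.factorial := by exact_mod_cast Nat.factorial_pos r
  have key : s * (D - d - r * (d + r)) ≤ (r + 1) * (d * R) := by
    rcases le_or_gt (D - d - r * (d + r)) 0 with h | h
    · exact (mul_nonpos_of_nonneg_of_nonpos hs0 h).trans (by positivity)
    · have h1 := bern (r := r) hd hD r
      have h2 : D - d - r * (d + r) ≤ (D - d) * ((D - d) / (D + r)) ^ r := by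
        refine le_trans ?_ (mul_le_mul_of_nonneg_left h1 (by linarith))
        have h3 : (D - d) * ((d + r) / (D + r)) ≤ d + r := by
          rw [mul_div_assoc', div_le_iff₀ hDr]; nlinarith
        have h4 := mul_le_mul_of_nonneg_left h3 (by linarith : (0:ℝ) ≤ r)
        linarith
      have h3 : (D - d) * ((D - d) / (D + r)) ^ r * (D + r) ^ r = (D - d) ^ (r + 1) := by
        rw [div_pow, mul_assoc, div_mul_cancel₀ _ (by positivity)]; ring
      rw [Nat.factorial_succ] at hR
      push_cast at hR
      have h4 : r.factorial * (s * (D - d - r * (d + r))) ≤ r.factorial * ((r + 1) * (d * R)) := by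
        calc r.factorial * (s * (D - d - r * (d + r))) = (s * r.factorial) * (D - d - r * (d + r)) := by ring
          _ ≤ (d * (D + r) ^ r) * (D - d - r * (d + r)) := mul_le_mul_of_nonneg_right hs h.le
          _ ≤ (d * (D + r) ^ r) * ((D - d) * ((D - d) / (D + r)) ^ r) := mul_le_mul_of_nonneg_left h2 (by positivity)
          _ = d * ((D - d) * ((D - d) / (D + r)) ^ r * (D + r) ^ r) := by ring
          _ = d * (D - d) ^ (r + 1) := by rw [h3]
          _ ≤ d * ((r + 1) * r.factorial * R) := mul_le_mul_of_nonneg_left hR (by linarith)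
          _ = _ := by ring
      exact le_of_mul_le_mul_left h4 hf
  have h5 : (r + 1) * E ≤ (r + 1) * (r / (r + 1) * s * (D + (r + 2) * d)) := by
    have e : ((r:ℝ) + 1) * (r / (r + 1) * s * (D + (r + 2) * d)) = s * (r * D + r * (r + 2) * d) := by field_simp
    rw [e]
    have h6 : d + r * (d + r) ≤ r * (r + 2) * d := by nlinarith [mul_nonneg (by positivity : (0:ℝ) ≤ (r:ℝ) * r) (by linarith : 0 ≤ d - 1)]
    have h7 := mul_le_mul_of_nonneg_left h6 hs0
    nlinarith
  exact le_of_mul_le_mul_left h5 (by linarith)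

theorem countS {r : ℕ} {d D s R Q δ : ℝ} (hr : 1 ≤ r) (hd : 1 ≤ d) (hD : 2 * (r + 1) * (d + r) ≤ D) (hs0 : 0 ≤ s) (hR0 : 0 ≤ R)
    (hs : s * r.factorial ≤ d * (D + r) ^ r) (hR : (D - d) ^ (r + 1) ≤ (r + 1).factorial * R)
    (hQ0 : 0 ≤ Q) (hQ : Q ≤ δ * (D + r)) (hδ0 : 0 ≤ δ) (hδ : δ ≤ d) :
    r / (r + 1) * s * Q ≤ 2 * r * d ^ 2 * R := by
  have hr0 : (1:ℝ) ≤ r := by exact_mod_cast hr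
  have hdD : d ≤ D := by nlinarith
  have hDr : 0 < D + r := by linarith
  have hf : (0:ℝ) < r.factorial := by exact_mod_cast Nat.factorial_pos r
  have h1 := bern (r := r) hd hdD (r + 1)
  have h2 : 1 / 2 ≤ ((D - d) / (D + r)) ^ (r + 1) := by
    refine le_trans ?_ h1
    have : ((r + 1 : ℕ) : ℝ) * ((d + r) / (D + r)) ≤ 1 / 2 := by
      rw [mul_div_assoc', div_le_iff₀ hDr]; push_cast; linarith
    linarith
  rw [div_pow, le_div_iff₀ (by positivity)] at h2
  rw [Nat.factorial_succ] at hR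
  push_cast at hR
  have h3 : (D + r) ^ (r + 1) ≤ 2 * ((r + 1) * r.factorial * R) := by linarith
  have h4 : r.factorial * ((r + 1) * (r / (r + 1) * s * Q)) ≤ r.factorial * ((r + 1) * (2 * r * d ^ 2 * R)) := by
    calc r.factorial * ((r + 1) * (r / (r + 1) * s * Q)) = r * (s * r.factorial) * Q := by field_simp
      _ ≤ r * (d * (D + r) ^ r) * (d * (D + r)) := by
        have : Q ≤ d * (D + r) := hQ.trans (mul_le_mul_of_nonneg_right hδ hDr.le)
        gcongr
      _ = r * d ^ 2 * (D + r) ^ (r + 1) := by ring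
      _ ≤ r * d ^ 2 * (2 * ((r + 1) * r.factorial * R)) := mul_le_mul_of_nonneg_left h3 (by positivity)
      _ = _ := by ring
  have h5 := le_of_mul_le_mul_left h4 hf
  exact le_of_mul_le_mul_left h5 (by linarith)

theorem log_one_add_le {y a : ℝ} (hy : 0 ≤ y) (ha : 1 ≤ a) : Real.log (1 + y) ≤ y / a + a := by
  have h1 := Real.log_le_sub_one_of_pos (x := (1 + y) / a) (by positivity)
  rw [Real.log_div (by positivity) (by positivity)] at h1
  have h2 := Real.log_le_sub_one_of_pos (x := a) (by positivity)
  have h3 : (1 + y) / a ≤ 1 + y / a := by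
    rw [add_div]; gcongr; rw [div_le_one (by positivity)]; exact ha
  linarith

theorem log_succ_div {r : ℕ} {d δ : ℝ} (hr : 1 ≤ r) (hd : 1 ≤ d) (hδ1 : 1 ≤ δ) (hδ : δ ^ r = d) :
    Real.log (d + 1) ≤ (r + 1) * δ := by
  have h1 : Real.log (d + 1) ≤ Real.log (2 * d) := Real.log_le_log (by linarith) (by linarith)
  rw [Real.log_mul (by norm_num) (by linarith), ← hδ, Real.log_pow] at h1
  have h2 : Real.log δ ≤ δ := Real.log_le_self (by linarith)
  have h3 := mul_le_mul_of_nonneg_left h2 (Nat.cast_nonneg (α := ℝ) r)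
  rw [hδ] at h1
  linarith [Real.log_two_lt_d9]

set_option maxHeartbeats 2000000 in
theorem final_alg {r : ℕ} {d D s R E Q δ W C1 C2 η lb h : ℝ} (hr : 1 ≤ r) (hd : 1 ≤ d)
    (hD : 2 * (r + 1) * (d + r) ≤ D) (hs0 : 0 < s) (hR0 : 0 ≤ R)
    (hs : s * r.factorial ≤ d * (D + r) ^ r) (hR : (D - d) ^ (r + 1) ≤ (r + 1).factorial * R) (hE : E + d * R ≤ D * s)
    (hQ1 : 1 ≤ Q) (hQ : Q ≤ δ * (D + r)) (hQl : δ * (D - d) ≤ Q) (hδ1 : 1 ≤ δ) (hδ : δ ^ r = d) (hsQ : s ≤ Q ^ r)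
    (hlb : 0 ≤ lb) (hh : 0 ≤ h) (hhD : d * h ≤ δ * D)
    (hW0 : 0 < W) (hη : 0 ≤ η) (hC2 : 1 ≤ C2) (hW : W ≤ C2 * (d ^ (4 + η) + d ^ 2 * lb))
    (main : R * lb + (r / (r + 1) * s * Q) * (Real.log Q - Real.log W - C1) - 2 * (r + 1) * s * Q ≤ s * Real.log s + E * (h + Real.log (d + 1))) :
    Real.log Q ≤ (4 + η) * Real.log d + h / δ + (Real.log C2 + C1 + 2 * r + 2 * (r + 1) ^ 2 + (r + 1) + 2 * (r + 3) + (2 * r + 7) * (r + 1)) := by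
  have hr0 : (1:ℝ) ≤ r := by exact_mod_cast hr
  have hdD2 : 2 * d ≤ D := by nlinarith
  have hδd : δ ≤ d := by rw [← hδ]; exact le_self_pow₀ hδ1 (by omega)
  set S := (r / (r + 1) * s * Q) with hS
  have hS0 : 0 < S := by positivity
  have hsQS : s * Q ≤ (r + 1) / r * S := by
    rw [hS]; apply le_of_eq; field_simp
  have hrr : ((r:ℝ) + 1) / r ≤ r + 1 := div_le_self (by linarith) hr0
  have hsQS' : s * Q ≤ (r + 1) * S := hsQS.trans (mul_le_mul_of_nonneg_right hrr hS0.le)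
  have h1 : 2 * (r + 1) * s * Q ≤ 2 * (r + 1) ^ 2 * S := by
    calc 2 * (r + 1) * s * Q = 2 * (r + 1) * (s * Q) := by ring
      _ ≤ 2 * (r + 1) * ((r + 1) * S) := mul_le_mul_of_nonneg_left hsQS' (by positivity)
      _ = _ := by ring
  have h2 : s * Real.log s ≤ (r + 1) * S := by
    have h3 : Real.log s ≤ r * Q := by
      have h4 := Real.log_le_log hs0 hsQ
      rw [Real.log_pow] at h4
      exact h4.trans (mul_le_mul_of_nonneg_left (Real.log_le_self (by linarith)) (by linarith))
    calc s * Real.log s ≤ s * (r * Q) := mul_le_mul_of_nonneg_left h3 hs0.le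
      _ = r * (s * Q) := by ring
      _ ≤ r * ((r + 1) / r * S) := mul_le_mul_of_nonneg_left hsQS (by linarith)
      _ = _ := by field_simp
  have hEb := countE hr hd (by linarith) hs0.le hR0 hs hR hE
  have hSR := countS hr hd hD hs0.le hR0 hs hR (by linarith) hQ (by linarith) hδd
  -- E bound
  have hDd : 0 < D - d := by linarith
  have hE2 : E * δ ≤ S * (1 + 2 * (r + 3) * (d / D)) := by
    have h3 : (D + (r + 2) * d) ≤ (1 + 2 * (r + 3) * (d / D)) * (D - d) := by
      have hD0 : 0 < D := by linarith
      have h4 : d / D * (D - d) ≥ d / 2 := by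
        rw [ge_iff_le, div_mul_eq_mul_div, le_div_iff₀ hD0]; nlinarith
      have h5 := mul_le_mul_of_nonneg_left h4 (by positivity : (0:ℝ) ≤ 2 * (r + 3))
      nlinarith
    have hx0 : (0:ℝ) ≤ 1 + 2 * (r + 3) * (d / D) := by
      have : 0 ≤ d / D := div_nonneg (by linarith) (by linarith)
      positivity
    calc E * δ ≤ (r / (r + 1) * s * (D + (r + 2) * d)) * δ := mul_le_mul_of_nonneg_right hEb (by linarith)
      _ ≤ (r / (r + 1) * s * ((1 + 2 * (r + 3) * (d / D)) * (D - d))) * δ := by gcongr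
      _ = r / (r + 1) * s * (1 + 2 * (r + 3) * (d / D)) * (δ * (D - d)) := by ring
      _ ≤ r / (r + 1) * s * (1 + 2 * (r + 3) * (d / D)) * Q := mul_le_mul_of_nonneg_left hQl (by positivity)
      _ = _ := by rw [hS]; ring
  have hl := log_succ_div hr hd hδ1 hδ
  have hl0 : 0 ≤ Real.log (d + 1) := Real.log_nonneg (by linarith)
  have hE3 : E * (h + Real.log (d + 1)) ≤ S * (h / δ + 2 * (r + 3) + (2 * r + 7) * (r + 1)) := by
    have hD0 : 0 < D := by linarith
    have e1 : E * (h + Real.log (d + 1)) = E * δ * ((h + Real.log (d + 1)) / δ) := by field_simp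
    rw [e1]
    have hq : 0 ≤ (h + Real.log (d + 1)) / δ := by positivity
    refine (mul_le_mul_of_nonneg_right hE2 hq).trans ?_
    rw [mul_assoc]
    refine mul_le_mul_of_nonneg_left ?_ hS0.le
    have h3 : Real.log (d + 1) / δ ≤ r + 1 := by rw [div_le_iff₀ (by linarith)]; exact hl
    have h4 : d / D * (h / δ) ≤ 1 := by
      rw [div_mul_div_comm, div_le_one (by positivity)]; linarith
    have h5 : d / D ≤ 1 := by rw [div_le_one hD0]; linarith
    have h6 : d / D * (Real.log (d + 1) / δ) ≤ r + 1 := by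
      calc _ ≤ 1 * (Real.log (d + 1) / δ) := mul_le_mul_of_nonneg_right h5 (by positivity)
        _ ≤ _ := by linarith
    rw [add_div]
    have h7 := mul_le_mul_of_nonneg_left h4 (by positivity : (0:ℝ) ≤ 2 * (r + 3))
    have h8 := mul_le_mul_of_nonneg_left h6 (by positivity : (0:ℝ) ≤ 2 * (r + 3))
    linarith
  have hR3 : S * (lb / (2 * r * d ^ 2)) ≤ R * lb := by
    rw [mul_div_assoc', div_le_iff₀ (by positivity)]
    have := mul_le_mul_of_nonneg_right hSR hlb
    linarith
  -- log W
  have hWl : Real.log W ≤ Real.log C2 + (4 + η) * Real.log d + lb / (2 * r * d ^ 2) + 2 * r := by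
    have h3 : W ≤ C2 * (d ^ (4 + η) * (1 + lb / d ^ 2)) := by
      refine hW.trans (mul_le_mul_of_nonneg_left ?_ (by linarith))
      have h4 : d ^ (4:ℕ) ≤ d ^ (4 + η) := by
        rw [← Real.rpow_natCast]; exact Real.rpow_le_rpow_of_exponent_le hd (by norm_num; exact hη)
      have h5 : d ^ 2 * lb = d ^ 4 * (lb / d ^ 2) := by field_simp
      have h6 := mul_le_mul_of_nonneg_right h4 (by positivity : 0 ≤ lb / d ^ 2)
      rw [h5]; linarith
    have hp : 0 < d ^ (4 + η) := Real.rpow_pos_of_pos (by linarith) _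
    have h4 := Real.log_le_log hW0 h3
    rw [Real.log_mul (by linarith) (by positivity), Real.log_mul (by positivity) (by positivity), Real.log_rpow (by linarith)] at h4
    have h5 := log_one_add_le (y := lb / d ^ 2) (a := 2 * r) (by positivity) (by linarith)
    rw [div_div, mul_comm (d ^ 2) (2 * (r:ℝ))] at h5
    linarith
  -- assemble
  have hfin : S * (lb / (2 * r * d ^ 2) + (Real.log Q - Real.log W - C1) - 2 * (r + 1) ^ 2) ≤
      S * ((r + 1) + (h / δ + 2 * (r + 3) + (2 * r + 7) * (r + 1))) := by
    rw [mul_add S (r + 1 : ℝ), mul_sub S, mul_add S (lb / _)]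
    linarith
  have := le_of_mul_le_mul_left hfin hS0
  linarith

end RealLemmas
end AuxPoly

end

section

open MvPolynomial

namespace AuxPoly
section MainNorm

theorem counts {r d D : ℕ} (hr : 1 ≤ r) (hd : 1 ≤ d) (hD : d ≤ D) {δ Q : ℝ} (hδ0 : 0 ≤ δ) (hδ : δ ^ r = d) (hQ0 : 0 ≤ Q)
    (hQs : Q ^ r = r.factorial * Fintype.card (JJ r d D)) :
    (0 < (Fintype.card (JJ r d D) : ℝ)) ∧ 1 ≤ Q ∧ (Fintype.card (JJ r d D) : ℝ) * r.factorial ≤ d * ((D:ℝ) + r) ^ r ∧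
    ((D:ℝ) - d) ^ (r + 1) ≤ (r + 1).factorial * Fintype.card (TT (r + 1) (D - d)) ∧
    Q ≤ δ * (D + r) ∧ δ * (D - d) ≤ Q ∧ (Fintype.card (JJ r d D) : ℝ) ≤ Q ^ r := by
  have hf : (1:ℝ) ≤ r.factorial := by exact_mod_cast Nat.factorial_pos r
  have h1 := card_JJ_ge (r := r) hD
  have h2 := card_JJ_le (r := r) hD
  have h1R : (d:ℝ) * ((D - d + r).choose r : ℕ) ≤ Fintype.card (JJ r d D) := by exact_mod_cast h1
  have h2R : (Fintype.card (JJ r d D) : ℝ) ≤ d * ((D + r).choose r : ℕ) := by exact_mod_cast h2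
  have hspos : 1 ≤ Fintype.card (JJ r d D) := by
    have : 0 < (D - d + r).choose r := Nat.choose_pos (by omega)
    nlinarith
  have hsR : (1:ℝ) ≤ Fintype.card (JJ r d D) := by exact_mod_cast hspos
  have hdR : (1:ℝ) ≤ d := by exact_mod_cast hd
  have hDd : (0:ℝ) ≤ (D:ℝ) - d := by
    have : (d:ℝ) ≤ D := by exact_mod_cast hD
    linarith
  have hc1 : ∀ k : ℕ, ((D:ℝ) - d) ^ k ≤ k.factorial * ((D - d + k).choose k : ℕ) := by
    intro k
    have h3 := Nat.pow_le_choose (α := ℝ) k (D - d + k)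
    have hk : (0:ℝ) < k.factorial := by exact_mod_cast Nat.factorial_pos k
    rw [div_le_iff₀' hk] at h3
    refine le_trans (pow_le_pow_left₀ hDd ?_ _) h3
    rw [← Nat.cast_sub hD]
    have : D - d ≤ D - d + k + 1 - k := by omega
    exact_mod_cast this
  have hup : (Fintype.card (JJ r d D) : ℝ) * r.factorial ≤ d * ((D:ℝ) + r) ^ r := by
    have h3 := Nat.choose_le_pow_div (α := ℝ) r (D + r)
    rw [le_div_iff₀ (by linarith)] at h3
    push_cast at h3
    calc (Fintype.card (JJ r d D) : ℝ) * r.factorial ≤ d * ((D + r).choose r : ℕ) * r.factorial :=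
          mul_le_mul_of_nonneg_right h2R (by linarith)
      _ = d * (((D + r).choose r : ℕ) * r.factorial) := by ring
      _ ≤ _ := mul_le_mul_of_nonneg_left h3 (by linarith)
  have hr0 : r ≠ 0 := by omega
  refine ⟨by linarith, ?_, hup, ?_, ?_, ?_, ?_⟩
  · rw [← pow_le_pow_iff_left₀ zero_le_one hQ0 hr0, one_pow, hQs]
    nlinarith
  · rw [card_TT]; exact hc1 (r + 1)
  · rw [← pow_le_pow_iff_left₀ hQ0 (by positivity) hr0, hQs, mul_pow, hδ]; linarith
  · rw [← pow_le_pow_iff_left₀ (by positivity) hQ0 hr0, hQs, mul_pow, hδ]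
    calc (d:ℝ) * (D - d) ^ r ≤ d * (r.factorial * ((D - d + r).choose r : ℕ)) := mul_le_mul_of_nonneg_left (hc1 r) (by linarith)
      _ = r.factorial * (d * ((D - d + r).choose r : ℕ)) := by ring
      _ ≤ _ := mul_le_mul_of_nonneg_left h1R (by linarith)
  · rw [hQs]; nlinarith

theorem sum_lb {s S Q d LW C1 r : ℝ} (P : Finset ℕ) (hS : 0 ≤ S) (hs : 0 ≤ s) (hr : 0 ≤ r)
    (h1 : Real.log Q - LW - C1 ≤ ∑ p ∈ P, (1 - 10 * d ^ 2 / √p) / p * Real.log p)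
    (h2 : ∑ p ∈ P, Real.log p ≤ 2 * Q) :
    S * (Real.log Q - LW - C1) - 2 * (r + 1) * s * Q ≤
      ∑ p ∈ P, (S * ((1 - 10 * d ^ 2 / √p) / p) - (r + 1) * s) * Real.log p := by
  have e : ∑ p ∈ P, (S * ((1 - 10 * d ^ 2 / √p) / p) - (r + 1) * s) * Real.log p =
      S * ∑ p ∈ P, (1 - 10 * d ^ 2 / √p) / p * Real.log p - (r + 1) * s * ∑ p ∈ P, Real.log p := by
    rw [Finset.mul_sum, Finset.mul_sum, ← Finset.sum_sub_distrib]
    refine Finset.sum_congr rfl (fun p _ => by ring)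
  rw [e]
  have h3 := mul_le_mul_of_nonneg_left h1 hS
  have h4 := mul_le_mul_of_nonneg_left h2 (by positivity : 0 ≤ (r + 1) * s)
  linarith

def ZZ (d : ℕ) {r : ℕ} (f : MvPolynomial (Fin (r + 1)) ℤ) (H : ℝ) : Set (Fin (r + 1) → ℤ) :=
  {y | eval y f = 0 ∧ ∀ i, |(y i : ℝ)| ≤ (d + 1) * H}

theorem det_log_ub {r d D : ℕ} {H : ℝ} (hH : 1 ≤ H) [DecidableEq (JJ r d D)] (x : JJ r d D → Fin (r + 1) → ℤ)
    (hx : ∀ j i, |(x j i : ℝ)| ≤ (d + 1) * H)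
    (hdet : (Matrix.of (fun i j : JJ r d D => eval (x i) (monomial j.1.1 (1:ℤ)))).det ≠ 0) :
    Real.log |(((Matrix.of (fun i j : JJ r d D => eval (x i) (monomial j.1.1 (1:ℤ)))).det : ℤ) : ℝ)| ≤
      (Fintype.card (JJ r d D) : ℝ) * Real.log (Fintype.card (JJ r d D)) +
        ((∑ j : JJ r d D, j.1.1.degree : ℕ) : ℝ) * (Real.log H + Real.log ((d:ℝ) + 1)) := by
  have h1 := det_ub x hx
  have h2 : (0:ℝ) < |(((Matrix.of (fun i j : JJ r d D => eval (x i) (monomial j.1.1 (1:ℤ)))).det : ℤ) : ℝ)| :=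
    abs_pos.2 (by exact_mod_cast hdet)
  have h3 := Real.log_le_log h2 h1
  have hf : (0:ℝ) < (Fintype.card (JJ r d D)).factorial := by exact_mod_cast Nat.factorial_pos _
  have hd : (0:ℝ) < (d:ℝ) + 1 := by positivity
  have hH0 : 0 < H := by linarith
  rw [Real.log_mul hf.ne' (by positivity), Real.log_pow, Real.log_mul hd.ne' hH0.ne'] at h3
  have h4 : Real.log ((Fintype.card (JJ r d D)).factorial : ℝ) ≤ (Fintype.card (JJ r d D) : ℝ) * Real.log (Fintype.card (JJ r d D)) := by
    rw [← Real.log_pow]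
    refine Real.log_le_log hf ?_
    exact_mod_cast Nat.factorial_le_pow _
  linarith

theorem main_norm {r : ℕ} (hr : 1 ≤ r) {η : ℝ} (hη : 0 < η) : ∃ K : ℝ, ∀ (d D : ℕ) (f : MvPolynomial (Fin (r + 1)) ℤ) (H δ : ℝ),
    1 ≤ d → NormHyp r d f → 1 ≤ H → 1 ≤ δ → δ ^ r = d → 2 * (r + 1) * ((d:ℝ) + r) ≤ D → d * Real.log H ≤ δ * D →
    (∀ g : MvPolynomial (Fin (r + 1)) ℤ, g.totalDegree ≤ D → (∀ x ∈ ZZ d f H, eval x g = 0) → f ∣ g) →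
    Real.log (δ * (D - d)) ≤ (4 + η) * Real.log d + Real.log H / δ + K := by
  classical
  obtain ⟨C1, hC1, hps⟩ := prime_sum hη
  refine ⟨Real.log (8 * r + 146) + C1 + 2 * r + 2 * (r + 1) ^ 2 + (r + 1) + 2 * (r + 3) + (2 * r + 7) * (r + 1), ?_⟩
  intro d D f H δ hd hf hH hδ1 hδ hD hhD hZ
  have hrR : (1:ℝ) ≤ r := by exact_mod_cast hr
  have hdR : (1:ℝ) ≤ d := by exact_mod_cast hd
  have hdD' : (d:ℝ) < D := by nlinarith
  have hdD : d ≤ D := by exact_mod_cast hdD'.le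
  obtain ⟨v, β, hN, hNlog⟩ := sec_log hd hf
  obtain ⟨hReg, hprim, -, -⟩ := hf
  obtain ⟨x, hxZ, hdet⟩ := exists_pts (D := D) hReg (ZZ d f H) hZ
  set b := f.coeff (Finsupp.single 0 d) with hb
  set N := (gram d (aeval (line v β) (homogeneousComponent d f))).det with hNdef
  have hb0 : b ≠ 0 := hReg.2
  set lb := Real.log |(b:ℝ)| with hlb
  have hlb0 : 0 ≤ lb := Real.log_nonneg (by exact_mod_cast Int.one_le_abs hb0)
  set W : ℝ := (8 * r + 46) * ((d:ℝ) ^ 2 * lb + (d:ℝ) ^ 4) + 100 * (d:ℝ) ^ (4 + η) with hW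
  have hdp : (d:ℝ) ^ 4 ≤ (d:ℝ) ^ (4 + η) := by
    rw [← Real.rpow_natCast]; exact Real.rpow_le_rpow_of_exponent_le hdR (by norm_num; exact hη.le)
  have hdp1 : (1:ℝ) ≤ (d:ℝ) ^ 4 := one_le_pow₀ hdR
  have hpart : 0 ≤ (8 * (r:ℝ) + 46) * ((d:ℝ) ^ 2 * lb + (d:ℝ) ^ 4) := by positivity
  have hW1 : (d:ℝ) ^ (4 + η) ≤ W := by rw [hW]; linarith
  have hW2 : 100 * (d:ℝ) ^ 4 ≤ W := by rw [hW]; linarith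
  set B : ℕ := (b * N).natAbs with hB
  have hB0 : B ≠ 0 := Int.natAbs_ne_zero.2 (mul_ne_zero hb0 hN)
  have hBlog : Real.log B ≤ W := by
    have e : (B : ℝ) = |(b:ℝ)| * |(N:ℝ)| := by
      rw [hB, Nat.cast_natAbs, abs_mul]; push_cast; rfl
    rw [e, Real.log_mul (abs_pos.2 (by exact_mod_cast hb0)).ne' (abs_pos.2 (by exact_mod_cast hN)).ne', hW]
    linarith
  set s := Fintype.card (JJ r d D) with hs
  set Q : ℝ := ((r.factorial : ℝ) * s) ^ ((1:ℝ) / r) with hQdef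
  have hQ0 : 0 ≤ Q := by positivity
  have hQs : Q ^ r = r.factorial * s := by
    rw [hQdef, one_div, Real.rpow_inv_natCast_pow (by positivity) (by omega)]
  obtain ⟨c1, c2, c3, c4, c5, c6, c7⟩ := counts hr hd hdD (by linarith) hδ hQ0 hQs
  have hlbound := log_det_lb hr hd hdD hReg hprim (v := v) (β := β) x (fun i => (hxZ i).1) hdet (gp W Q B) (by
    intro p hp
    rw [gp, Finset.mem_filter] at hp
    obtain ⟨hp1, hp2, hp3⟩ := hp
    refine ⟨(mem_pr.1 hp1).1, ?_, ?_, ?_⟩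
    · have : 100 * (d:ℝ) ^ 4 ≤ p := by linarith
      exact_mod_cast this
    · intro h; apply hp3; exact Int.natCast_dvd.1 (h.mul_right N)
    · intro h; apply hp3; exact Int.natCast_dvd.1 (h.mul_left b)) hQ0 hQs
  have hub := det_log_ub hH x (fun j => (hxZ j).2) hdet
  have hS0 : 0 ≤ (r / (r + 1) * s * Q : ℝ) := by positivity
  have hsl := sum_lb (s := s) (r := r) (gp W Q B) hS0 c1.le (by linarith) (hps d W Q B hdR hW1 hB0 hBlog c2) (gp_theta hQ0)
  have hE : ((∑ j : JJ r d D, j.1.1.degree : ℕ) : ℝ) + d * Fintype.card (TT (r + 1) (D - d)) ≤ D * s := by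
    exact_mod_cast sum_JJ_le hdD
  have hW3 : W ≤ (8 * r + 146) * ((d:ℝ) ^ (4 + η) + (d:ℝ) ^ 2 * lb) := by
    have h1 : 0 ≤ (d:ℝ) ^ 2 * lb := by positivity
    have h2 := mul_le_mul_of_nonneg_left hdp (by positivity : (0:ℝ) ≤ 8 * r + 46)
    rw [hW]; linarith
  have hfin := final_alg (C1 := C1) (C2 := 8 * r + 146) (η := η) hr hdR hD c1 (Nat.cast_nonneg _) c3 c4 hE c2 c5 c6 hδ1 hδ c7 hlb0
    (Real.log_nonneg hH) hhD (by linarith) hη.le (by linarith) hW3 (by linarith)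
  have hpos : 0 < δ * ((D:ℝ) - d) := mul_pos (by linarith) (by linarith)
  exact (Real.log_le_log hpos c6).trans hfin

end MainNorm
end AuxPoly

end

section

open MvPolynomial

namespace AuxPoly
section Final

theorem transfer {r d D : ℕ} {f : MvPolynomial (Fin (r + 1)) ℤ} {a : Fin r → ℤ} (ha : ∀ i, 0 ≤ a i ∧ a i ≤ d) {H : ℝ} (hH : 1 ≤ H)
    (hcon : ¬ ∃ g : MvPolynomial (Fin (r + 1)) ℤ, g.totalDegree ≤ D ∧ ¬ f ∣ g ∧
      ∀ x : Fin (r + 1) → ℤ, eval x f = 0 → (∀ i, (|x i| : ℝ) ≤ H) → eval x g = 0) :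
    ∀ g : MvPolynomial (Fin (r + 1)) ℤ, g.totalDegree ≤ D → (∀ x ∈ ZZ d (shear a f) H, eval x g = 0) → shear a f ∣ g := by
  intro g hg hv
  by_contra hnd
  apply hcon
  refine ⟨shear (-a) g, shear_totalDegree _ hg, ?_, ?_⟩
  · intro h
    apply hnd
    have h1 := map_dvd (shear a) h
    have h2 := DFunLike.congr_fun (shear_comp a) g
    rw [AlgHom.comp_apply, AlgHom.id_apply] at h2
    rwa [h2] at h1
  · intro x hx hxH
    rw [eval_shear]
    apply hv
    refine ⟨?_, ?_⟩
    · rw [eval_shear]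
      rw [← hx]
      congr 2
      ext i
      refine Fin.cases ?_ (fun i => ?_) i <;> simp
    · intro i
      have hdH : (0:ℝ) ≤ d * H := by positivity
      refine Fin.cases ?_ (fun i => ?_) i
      · rw [Fin.cons_zero]; linarith [hxH 0]
      · rw [Fin.cons_succ]
        push_cast
        rw [Pi.neg_apply]
        push_cast
        have h1 : |(a i : ℝ)| ≤ d := by
          rw [abs_of_nonneg (by exact_mod_cast (ha i).1)]; exact_mod_cast (ha i).2
        have h2 : |(x i.succ : ℝ) + -(a i : ℝ) * x 0| ≤ |(x i.succ : ℝ)| + |(a i : ℝ)| * |(x 0 : ℝ)| := by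
          refine (abs_add_le _ _).trans ?_
          rw [abs_mul, abs_neg]
        have h3 := mul_le_mul h1 (hxH 0) (abs_nonneg _) (Nat.cast_nonneg _)
        linarith [hxH i.succ]

theorem main_final {r : ℕ} (hr : 1 ≤ r) :
    ∃ c : ℝ, ∀ (f : MvPolynomial (Fin (r + 1)) ℤ) (d : ℕ),
      d = f.totalDegree → 1 ≤ d →
      Finset.gcd f.support f.coeff = 1 →
      Irreducible (MvPolynomial.map (Int.castRingHom ℂ) (MvPolynomial.homogeneousComponent d f)) →
      ∀ H : ℝ, 1 ≤ H →
      ∃ g : MvPolynomial (Fin (r + 1)) ℤ,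
        (g.totalDegree : ℝ) ≤ c * (d : ℝ) ^ ((4 : ℝ) - 1 / ((r:ℝ) + 1)) * H ^ (1 / (d : ℝ) ^ (1 / (r : ℝ))) ∧
        ¬ f ∣ g ∧
        ∀ x : Fin (r + 1) → ℤ, MvPolynomial.eval x f = 0 → (∀ i, (|x i| : ℝ) ≤ H) → MvPolynomial.eval x g = 0 := by
  have hrR : (1:ℝ) ≤ r := by exact_mod_cast hr
  set η : ℝ := 1 / (r * (r + 1)) with hη
  have hη0 : 0 < η := by positivity
  obtain ⟨K, hK⟩ := main_norm hr hη0
  set c : ℝ := 2 * Real.exp K + 2 * (r + 1) ^ 2 + 2 with hc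
  refine ⟨c, fun f d hdf hd hprim hirr H hH => ?_⟩
  have hdR : (1:ℝ) ≤ d := by exact_mod_cast hd
  set δ : ℝ := (d:ℝ) ^ (1 / (r:ℝ)) with hδ
  have hδ1 : 1 ≤ δ := Real.one_le_rpow hdR (by positivity)
  have hδr : δ ^ r = d := by
    rw [hδ, one_div, Real.rpow_inv_natCast_pow (by positivity) (by omega)]
  set A : ℝ := (d : ℝ) ^ ((4 : ℝ) - 1 / ((r:ℝ) + 1)) with hA
  set Y : ℝ := H ^ (1 / δ) with hY
  have hlogH : 0 ≤ Real.log H := Real.log_nonneg hH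
  have hYe : Y = Real.exp (Real.log H / δ) := by
    rw [hY, Real.rpow_def_of_pos (by linarith)]; congr 1; ring
  have hY1 : 1 + Real.log H / δ ≤ Y := by
    rw [hYe]; linarith [Real.add_one_le_exp (Real.log H / δ)]
  have hq0 : 0 ≤ Real.log H / δ := by positivity
  have hAd : (d:ℝ) ≤ A := by
    rw [hA]
    have h1 : 1 / ((r:ℝ) + 1) ≤ 1 := by rw [div_le_one (by positivity)]; linarith
    calc (d:ℝ) = (d:ℝ) ^ (1:ℝ) := (Real.rpow_one _).symm
      _ ≤ _ := Real.rpow_le_rpow_of_exponent_le hdR (by linarith)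
  have hT : d * (1 + Real.log H / δ) ≤ A * Y := mul_le_mul hAd hY1 (by linarith) (by linarith)
  have hTd : (d:ℝ) ≤ A * Y := by nlinarith
  have hT1 : 1 ≤ A * Y := hdR.trans hTd
  set T := A * Y with hTdef
  set D := ⌊c * T⌋₊ with hD
  have hK0 := Real.exp_pos K
  have hc0 : 0 ≤ c * T := by positivity
  have hDle : (D:ℝ) ≤ c * T := Nat.floor_le hc0
  have hDge : (c - 1) * T ≤ D := by
    have := Nat.lt_floor_add_one (c * T)
    linarith
  have hc1 : 2 * ((r:ℝ) + 1) ^ 2 ≤ c - 1 := by rw [hc]; linarith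
  have hDr : 2 * ((r:ℝ) + 1) ^ 2 * T ≤ D := le_trans (mul_le_mul_of_nonneg_right hc1 (by linarith)) hDge
  have hDr2 : 2 * ((r:ℝ) + 1) * ((d:ℝ) + r) ≤ D := by
    have h1 : (d:ℝ) + r ≤ (r + 1) * T := by nlinarith
    have h2 := mul_le_mul_of_nonneg_left h1 (by positivity : (0:ℝ) ≤ 2 * (r + 1))
    linarith
  have hDT : T ≤ D := by nlinarith
  have hhD : d * Real.log H ≤ δ * D := by
    have h1 : d * (Real.log H / δ) ≤ D := by linarith
    have h2 := mul_le_mul_of_nonneg_left h1 (by linarith : 0 ≤ δ)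
    have h3 : δ * (d * (Real.log H / δ)) = d * Real.log H := by field_simp
    linarith
  have hdD : 2 * (d:ℝ) ≤ D := by nlinarith
  by_contra hcon
  have hcon2 : ¬ ∃ g : MvPolynomial (Fin (r + 1)) ℤ, g.totalDegree ≤ D ∧ ¬ f ∣ g ∧
      ∀ x : Fin (r + 1) → ℤ, eval x f = 0 → (∀ i, (|x i| : ℝ) ≤ H) → eval x g = 0 := by
    rintro ⟨g, h1, h2, h3⟩
    apply hcon
    refine ⟨g, ?_, h2, h3⟩
    have h4 : (g.totalDegree : ℝ) ≤ D := by exact_mod_cast h1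
    rw [mul_assoc]
    exact h4.trans hDle
  obtain ⟨a, ha, hNH⟩ := normalise hd hdf hprim hirr
  have hfin := hK d D (shear a f) H δ hd hNH hH hδ1 hδr hDr2 hhD (transfer ha hH hcon2)
  have hpos : 0 < δ * ((D:ℝ) - d) := mul_pos (by linarith) (by linarith)
  rw [Real.log_le_iff_le_exp hpos, Real.exp_add, Real.exp_add, ← hYe, mul_comm (4 + η), ← Real.rpow_def_of_pos (by linarith)] at hfin
  have hexp : (d:ℝ) ^ (4 + η) = δ * A := by
    rw [hδ, hA, ← Real.rpow_add (by linarith)]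
    congr 1
    rw [hη]; field_simp; ring
  rw [hexp] at hfin
  have h5 : (D:ℝ) - d ≤ T * Real.exp K := by
    have : δ * ((D:ℝ) - d) ≤ δ * (T * Real.exp K) := by rw [hTdef]; linarith
    exact le_of_mul_le_mul_left this (by linarith)
  have h6 : (c - 1) * T ≤ 2 * (T * Real.exp K) := by linarith
  have h7 : (c - 1) * T = 2 * (T * Real.exp K) + (2 * (r + 1) ^ 2 + 1) * T := by rw [hc]; ring
  have h8 : 0 < (2 * ((r:ℝ) + 1) ^ 2 + 1) * T := by positivity
  linarith

end Final
end AuxPoly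

end


theorem exists_auxiliary_polynomial (n : ℕ) (hn : 2 < n) :
    ∃ c : ℝ, ∀ (f : MvPolynomial (Fin n) ℤ) (d : ℕ),
      d = f.totalDegree → 1 ≤ d →
      Irreducible (MvPolynomial.map (Int.castRingHom ℚ) f) →
      Finset.gcd f.support f.coeff = 1 →
      Irreducible (MvPolynomial.map (Int.castRingHom ℂ)
        (MvPolynomial.homogeneousComponent d f)) →
      ∀ H : ℝ, 1 ≤ H →
      ∃ g : MvPolynomial (Fin n) ℤ,
        (g.totalDegree : ℝ) ≤
          c * (d : ℝ) ^ ((4 : ℝ) - 1 / (n : ℝ)) * H ^ (1 / (d : ℝ) ^ (1 / ((n : ℝ) - 1))) ∧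
        ¬ f ∣ g ∧
        ∀ x : Fin n → ℤ, MvPolynomial.eval x f = 0 → (∀ i, (|x i| : ℝ) ≤ H) →
          MvPolynomial.eval x g = 0 := by
  obtain ⟨r, rfl⟩ : ∃ r, n = r + 1 := ⟨n - 1, by omega⟩
  obtain ⟨c, hc⟩ := AuxPoly.main_final (r := r) (by omega)
  refine ⟨c, fun f d hdf hd _ hprim hirr H hH => ?_⟩
  have h := hc f d hdf hd hprim hirr H hH
  have e : ((r + 1 : ℕ) : ℝ) - 1 = r := by push_cast; ring
  rw [e]
  push_cast
  exact h
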